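/- arXiv:1412.4437 — 3 statements merged into one kernel-verified Lean document; each statement's English description precedes it below -/
import Mathlib

section
/- Let n ≥ 2, let ℓ ≥ 0 be an integer, and let h : [−1,1] → ℂ be continuous. Then there exists a constant λ ∈ ℂ, depending only on n, ℓ and h, such that for every spherical harmonic Y of degree ℓ on S^{n−1} and every point x ∈ S^{n−1} one has ∫_{S^{n−1}} h(⟨x,y⟩) Y(y) dσ(y) = λ · Y(x). -/
open MeasureTheory Real
open scoped RealInnerProductSpace

noncomputable section

/-- The surface measure on the unit sphere `S^{n-1} ⊆ ℝ^n`. -/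
def sphereMeasure (n : ℕ) : Measure (Metric.sphere (0 : EuclideanSpace ℝ (Fin n)) 1) :=
  (volume : Measure (EuclideanSpace ℝ (Fin n))).toSphere

/-- The Laplacian of a polynomial in `n` variables. -/
def polyLaplacian {n : ℕ} (P : MvPolynomial (Fin n) ℝ) : MvPolynomial (Fin n) ℝ :=
  ∑ i : Fin n, MvPolynomial.pderiv i (MvPolynomial.pderiv i P)

namespace SphericalHarmonic

open MvPolynomial Set Filter Topology
open MeasureTheory.Measure (volumeIoiPow)

variable {n : ℕ}

lemma integrable_pow_mul_exp_volumeIoiPow (m d : ℕ) :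
    Integrable (fun r : Ioi (0 : ℝ) => (r : ℝ) ^ d * exp (-(r : ℝ) ^ 2 / 2)) (volumeIoiPow m) := by
  have key : IntegrableOn (fun x : ℝ => x ^ m * (x ^ d * exp (-x ^ 2 / 2))) (Ioi 0) := by
    have h := integrableOn_rpow_mul_exp_neg_mul_sq (b := 1 / 2) (by norm_num)
      (s := ((m + d : ℕ) : ℝ)) (neg_one_lt_zero.trans_le (Nat.cast_nonneg _))
    refine h.congr_fun (fun x _ => ?_) measurableSet_Ioi
    simp only [Real.rpow_natCast]
    rw [pow_add, mul_assoc]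
    congr 3
    ring
  rw [integrableOn_iff_comap_subtypeVal measurableSet_Ioi] at key
  rw [volumeIoiPow, integrable_withDensity_iff_integrable_smul' (by fun_prop) (by simp)]
  refine key.congr (.of_forall ?_)
  rintro ⟨x, hx : 0 < x⟩
  simp [ENNReal.toReal_ofReal (pow_nonneg hx.le m)]

lemma integral_pow_mul_exp_volumeIoiPow_pos (m d : ℕ) :
    0 < ∫ r : Ioi (0 : ℝ), (r : ℝ) ^ d * exp (-(r : ℝ) ^ 2 / 2) ∂(volumeIoiPow m) := by
  have hpos (r : Ioi (0 : ℝ)) : 0 < (r : ℝ) ^ d * exp (-(r : ℝ) ^ 2 / 2) :=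
    mul_pos (pow_pos r.2 d) (exp_pos _)
  rw [integral_pos_iff_support_of_nonneg (fun r => (hpos r).le)
    (integrable_pow_mul_exp_volumeIoiPow m d)]
  have hsupp : Function.support
      (fun r : Ioi (0 : ℝ) => (r : ℝ) ^ d * exp (-(r : ℝ) ^ 2 / 2)) = univ :=
    eq_univ_of_forall fun r => (hpos r).ne'
  rw [hsupp]
  refine lt_of_lt_of_le ?_ (measure_mono (subset_univ (Iio (⟨1, mem_Ioi.mpr one_pos⟩ : Ioi (0 : ℝ)))))
  rw [Measure.volumeIoiPow_apply_Iio]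
  simp only [one_pow, ENNReal.ofReal_pos]
  positivity

lemma eval_smul_of_isHomogeneous {σ R : Type*} [CommSemiring R] {f : MvPolynomial σ R} {d : ℕ}
    (hf : f.IsHomogeneous d) (r : R) (x : σ → R) :
    eval (r • x) f = r ^ d * eval x f := by
  simp only [eval_eq, Finset.mul_sum]
  refine Finset.sum_congr rfl fun m hm => ?_
  have hdeg : ∑ i ∈ m.support, m i = d := by
    have := hf (mem_support_iff.mp hm)
    rw [Finsupp.weight_apply, Finsupp.sum] at this
    simpa using this
  simp only [Pi.smul_apply, smul_eq_mul, mul_pow, Finset.prod_mul_distrib, Finset.prod_pow_eq_pow_sum,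
    hdeg]
  ring

lemma continuous_eval_euclidean (f : MvPolynomial (Fin n) ℝ) :
    Continuous fun y : EuclideanSpace ℝ (Fin n) => eval (fun i => y i) f :=
  (MvPolynomial.continuous_eval f).comp (by fun_prop)

instance : IsFiniteMeasure (sphereMeasure n) := by
  unfold sphereMeasure
  infer_instance

lemma integrable_eval_sphere (f : MvPolynomial (Fin n) ℝ) :
    Integrable (fun y : Metric.sphere (0 : EuclideanSpace ℝ (Fin n)) 1 =>
      eval (fun i => (y : EuclideanSpace ℝ (Fin n)) i) f) (sphereMeasure n) :=
  ((continuous_eval_euclidean f).comp continuous_subtype_val).integrable_of_hasCompactSupport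
    (HasCompactSupport.of_compactSpace _)

/-- Separation of the radial variable in a Gaussian integral of a homogeneous polynomial. -/
lemma gaussian_polar [NeZero n] {f : MvPolynomial (Fin n) ℝ} {d : ℕ} (hf : f.IsHomogeneous d) :
    Integrable (fun y : EuclideanSpace ℝ (Fin n) => eval (fun i => y i) f * exp (-‖y‖ ^ 2 / 2)) ∧
    ∫ y : EuclideanSpace ℝ (Fin n), eval (fun i => y i) f * exp (-‖y‖ ^ 2 / 2) =
      (∫ y, eval (fun i => (y : EuclideanSpace ℝ (Fin n)) i) f ∂(sphereMeasure n)) *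
        ∫ r : Ioi (0 : ℝ), (r : ℝ) ^ d * exp (-(r : ℝ) ^ 2 / 2) ∂(volumeIoiPow (n - 1)) := by
  set μ : Measure (EuclideanSpace ℝ (Fin n)) := volume
  set F : EuclideanSpace ℝ (Fin n) → ℝ := fun y => eval (fun i => y i) f * exp (-‖y‖ ^ 2 / 2) with hF
  set G : Metric.sphere (0 : EuclideanSpace ℝ (Fin n)) 1 × Ioi (0 : ℝ) → ℝ := fun p =>
    eval (fun i => (p.1 : EuclideanSpace ℝ (Fin n)) i) f *
      ((p.2 : ℝ) ^ d * exp (-(p.2 : ℝ) ^ 2 / 2)) with hG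
  have hmp := μ.measurePreserving_homeomorphUnitSphereProd
  have hemb := (homeomorphUnitSphereProd (EuclideanSpace ℝ (Fin n))).measurableEmbedding
  rw [finrank_euclideanSpace_fin] at hmp
  have hcomp : G ∘ homeomorphUnitSphereProd (EuclideanSpace ℝ (Fin n)) = F ∘ Subtype.val := by
    funext y
    have hy : ‖(y : EuclideanSpace ℝ (Fin n))‖ ≠ 0 := norm_ne_zero_iff.mpr y.2
    have h := eval_smul_of_isHomogeneous hf (‖(y : EuclideanSpace ℝ (Fin n))‖)
      (fun i => (‖(y : EuclideanSpace ℝ (Fin n))‖⁻¹ • (y : EuclideanSpace ℝ (Fin n))) i)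
    have h2 : ‖(y : EuclideanSpace ℝ (Fin n))‖ •
      (fun i => (‖(y : EuclideanSpace ℝ (Fin n))‖⁻¹ • (y : EuclideanSpace ℝ (Fin n))) i) =
        fun i => (y : EuclideanSpace ℝ (Fin n)) i := by
      funext i
      simp [hy]
    rw [h2] at h
    simp only [hG, hF, Function.comp_apply, homeomorphUnitSphereProd_apply_fst_coe,
      homeomorphUnitSphereProd_apply_snd_coe, h]
    ring
  have hS : Integrable (fun y : Metric.sphere (0 : EuclideanSpace ℝ (Fin n)) 1 =>
      eval (fun i => (y : EuclideanSpace ℝ (Fin n)) i) f) μ.toSphere := integrable_eval_sphere f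
  have hGint : Integrable G (μ.toSphere.prod (volumeIoiPow (n - 1))) :=
    hS.mul_prod (integrable_pow_mul_exp_volumeIoiPow (n - 1) d)
  constructor
  · have := (hmp.integrable_comp_emb hemb).mpr hGint
    rw [hcomp, ← integrableOn_iff_comap_subtypeVal (measurableSet_singleton _).compl,
      IntegrableOn, restrict_compl_singleton] at this
    exact this
  · have := hmp.integral_comp hemb G
    rw [← restrict_compl_singleton (μ := μ) 0,
      ← integral_subtype_comap (measurableSet_singleton _).compl F]
    have hprod := integral_prod_mul (μ := μ.toSphere) (ν := volumeIoiPow (n - 1))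
      (fun y : Metric.sphere (0 : EuclideanSpace ℝ (Fin n)) 1 =>
        eval (fun i => (y : EuclideanSpace ℝ (Fin n)) i) f)
      (fun r : Ioi (0 : ℝ) => (r : ℝ) ^ d * exp (-(r : ℝ) ^ 2 / 2))
    refine Eq.trans ?_ (this.trans hprod)
    exact integral_congr_ae (.of_forall fun y => (congrFun hcomp y).symm)

lemma hasFDerivAt_eval (f : MvPolynomial (Fin n) ℝ) (y : EuclideanSpace ℝ (Fin n)) :
    HasFDerivAt (fun y : EuclideanSpace ℝ (Fin n) => eval (fun i => y i) f)
      (∑ i, eval (fun i => y i) (pderiv i f) • EuclideanSpace.proj (𝕜 := ℝ) i) y := by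
  induction f using MvPolynomial.induction_on with
  | C a => simpa using hasFDerivAt_const a y
  | add p q hp hq =>
    simp only [map_add, add_smul, Finset.sum_add_distrib]
    exact hp.add hq
  | mul_X p j hp =>
    have hX : HasFDerivAt (fun y : EuclideanSpace ℝ (Fin n) => y j)
      (EuclideanSpace.proj (𝕜 := ℝ) j : EuclideanSpace ℝ (Fin n) →L[ℝ] ℝ) y :=
      (EuclideanSpace.proj (𝕜 := ℝ) j).hasFDerivAt
    have := hp.mul hX
    simp only [map_mul, eval_X]
    refine this.congr_fderiv ?_
    simp only [pderiv_mul, pderiv_X, map_add, map_mul, eval_X, add_smul, Finset.sum_add_distrib,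
      Finset.smul_sum, smul_smul]
    rw [add_comm]
    congr 1
    · simp only [mul_comm]
    · rw [Finset.sum_eq_single j]
      · simp
      · intro b _ hb
        simp [Pi.single_eq_of_ne hb.symm]
      · simp

lemma hasFDerivAt_gaussian (y : EuclideanSpace ℝ (Fin n)) :
    HasFDerivAt (fun y : EuclideanSpace ℝ (Fin n) => exp (-‖y‖ ^ 2 / 2))
      (exp (-‖y‖ ^ 2 / 2) • -(innerSL ℝ y)) y := by
  have h := ((hasStrictFDerivAt_norm_sq y).hasFDerivAt.const_mul (-1 / 2 : ℝ)).exp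
  have e (z : EuclideanSpace ℝ (Fin n)) : -1 / 2 * ‖z‖ ^ 2 = -‖z‖ ^ 2 / 2 := by ring
  simp only [e] at h
  refine h.congr_fderiv ?_
  ext z
  simp
  ring_nf

lemma isHomogeneous_polyLaplacian {f : MvPolynomial (Fin n) ℝ} {d : ℕ} (hf : f.IsHomogeneous d) :
    (polyLaplacian f).IsHomogeneous (d - 1 - 1) :=
  IsHomogeneous.sum _ _ _ fun _ _ => hf.pderiv.pderiv

/-- Gaussian integration by parts in one coordinate direction. -/
lemma integral_X_mul_pderiv_gaussian [NeZero n] {f : MvPolynomial (Fin n) ℝ} {d : ℕ}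
    (hf : f.IsHomogeneous d) (i : Fin n) :
    ∫ y : EuclideanSpace ℝ (Fin n), eval (fun i => y i) (X i * pderiv i f) * exp (-‖y‖ ^ 2 / 2) =
      ∫ y : EuclideanSpace ℝ (Fin n),
        eval (fun i => y i) (pderiv i (pderiv i f)) * exp (-‖y‖ ^ 2 / 2) := by
  have hX : (X i * pderiv i f).IsHomogeneous (1 + (d - 1)) := (isHomogeneous_X ℝ i).mul hf.pderiv
  have hgrad (y : EuclideanSpace ℝ (Fin n)) :
      (∑ j, eval (fun i => y i) (pderiv j (pderiv i f)) • EuclideanSpace.proj (𝕜 := ℝ) j :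
        EuclideanSpace ℝ (Fin n) →L[ℝ] ℝ) (EuclideanSpace.single i 1) =
      eval (fun i => y i) (pderiv i (pderiv i f)) := by
    simp
  have hgauss (y : EuclideanSpace ℝ (Fin n)) :
      eval (fun i => y i) (pderiv i f) *
        (exp (-‖y‖ ^ 2 / 2) • -(innerSL ℝ y)) (EuclideanSpace.single i 1) =
      -(eval (fun i => y i) (X i * pderiv i f) * exp (-‖y‖ ^ 2 / 2)) := by
    simp [EuclideanSpace.inner_single_right]
    ring
  have h := integral_bilinear_hasFDerivAt_right_eq_neg_left_of_integrable
    (μ := (volume : Measure (EuclideanSpace ℝ (Fin n))))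
    (B := ContinuousLinearMap.mul ℝ ℝ) (v := EuclideanSpace.single i (1 : ℝ))
    (f := fun y => eval (fun i => y i) (pderiv i f)) (g := fun y => exp (-‖y‖ ^ 2 / 2))
    (f' := fun y => ∑ j, eval (fun i => y i) (pderiv j (pderiv i f)) •
      EuclideanSpace.proj (𝕜 := ℝ) j)
    (g' := fun y => exp (-‖y‖ ^ 2 / 2) • -(innerSL ℝ y))
    (by
      simp only [ContinuousLinearMap.mul_apply', hgrad]
      exact (gaussian_polar hf.pderiv.pderiv).1)
    (by
      simp only [ContinuousLinearMap.mul_apply', hgauss]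
      exact (gaussian_polar hX).1.neg)
    (gaussian_polar hf.pderiv).1
    (fun y _ => hasFDerivAt_eval _ y) (fun y _ => hasFDerivAt_gaussian y)
  simp only [ContinuousLinearMap.mul_apply', hgrad, hgauss, integral_neg] at h
  exact neg_injective h

lemma integral_polyLaplacian_gaussian [NeZero n] {f : MvPolynomial (Fin n) ℝ} {d : ℕ}
    (hf : f.IsHomogeneous d) :
    ∫ y : EuclideanSpace ℝ (Fin n), eval (fun i => y i) (polyLaplacian f) * exp (-‖y‖ ^ 2 / 2) =
      d * ∫ y : EuclideanSpace ℝ (Fin n), eval (fun i => y i) f * exp (-‖y‖ ^ 2 / 2) := by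
  calc
    _ = ∑ i, ∫ y : EuclideanSpace ℝ (Fin n),
        eval (fun i => y i) (pderiv i (pderiv i f)) * exp (-‖y‖ ^ 2 / 2) := by
      simp only [polyLaplacian, map_sum, Finset.sum_mul]
      exact integral_finsetSum _ fun i _ => (gaussian_polar hf.pderiv.pderiv).1
    _ = ∑ i, ∫ y : EuclideanSpace ℝ (Fin n),
        eval (fun i => y i) (X i * pderiv i f) * exp (-‖y‖ ^ 2 / 2) :=
      Finset.sum_congr rfl fun i _ => (integral_X_mul_pderiv_gaussian hf i).symm
    _ = ∫ y : EuclideanSpace ℝ (Fin n), d * (eval (fun i => y i) f * exp (-‖y‖ ^ 2 / 2)) := by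
      rw [← integral_finsetSum _ fun i _ =>
        (gaussian_polar ((isHomogeneous_X ℝ i).mul hf.pderiv)).1]
      congr 1 with y
      rw [← Finset.sum_mul, ← map_sum, hf.sum_X_mul_pderiv]
      simp [mul_assoc]
    _ = _ := integral_const_mul _ _

/-- On homogeneous polynomials of degree `d`, the integral over the sphere is proportional to the
integral of the Laplacian, with a factor depending only on `n` and `d`. -/
lemma exists_integral_sphere_eq_polyLaplacian [NeZero n] {d : ℕ} (hd : d ≠ 0) :
    ∃ c : ℝ, ∀ f : MvPolynomial (Fin n) ℝ, f.IsHomogeneous d →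
      ∫ y, eval (fun i => (y : EuclideanSpace ℝ (Fin n)) i) f ∂(sphereMeasure n) =
        c * ∫ y, eval (fun i => (y : EuclideanSpace ℝ (Fin n)) i) (polyLaplacian f)
          ∂(sphereMeasure n) := by
  have hM := integral_pow_mul_exp_volumeIoiPow_pos (n - 1) d
  set M : ℕ → ℝ := fun d =>
    ∫ r : Ioi (0 : ℝ), (r : ℝ) ^ d * exp (-(r : ℝ) ^ 2 / 2) ∂(volumeIoiPow (n - 1))
  refine ⟨M (d - 1 - 1) / (d * M d), fun f hf => ?_⟩
  have h := integral_polyLaplacian_gaussian hf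
  rw [(gaussian_polar hf).2, (gaussian_polar (isHomogeneous_polyLaplacian hf)).2] at h
  have hd' : (d : ℝ) ≠ 0 := Nat.cast_ne_zero.mpr hd
  have hM' : M d ≠ 0 := hM.ne'
  field_simp
  linear_combination -h


/-- The linear form `y ↦ ⟨x, y⟩` as a polynomial. -/
def linearForm (x : EuclideanSpace ℝ (Fin n)) : MvPolynomial (Fin n) ℝ :=
  ∑ i, C (x i) * X i

/-- The derivative of a polynomial in the direction `x`. -/
def dirDeriv (x : EuclideanSpace ℝ (Fin n)) (P : MvPolynomial (Fin n) ℝ) :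
    MvPolynomial (Fin n) ℝ :=
  ∑ i, C (x i) * pderiv i P

lemma eval_linearForm (x y : EuclideanSpace ℝ (Fin n)) :
    eval (fun i => y i) (linearForm x) = ⟪x, y⟫ := by
  simp [linearForm, PiLp.inner_apply, mul_comm]

lemma isHomogeneous_linearForm (x : EuclideanSpace ℝ (Fin n)) :
    (linearForm x).IsHomogeneous 1 :=
  IsHomogeneous.sum _ _ _ fun i _ => (isHomogeneous_X ℝ i).C_mul (x i)

lemma isHomogeneous_dirDeriv (x : EuclideanSpace ℝ (Fin n)) {P : MvPolynomial (Fin n) ℝ} {m : ℕ}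
    (hP : P.IsHomogeneous m) : (dirDeriv x P).IsHomogeneous (m - 1) :=
  IsHomogeneous.sum _ _ _ fun i _ => hP.pderiv.C_mul (x i)

lemma eval_dirDeriv_self (x : EuclideanSpace ℝ (Fin n)) {P : MvPolynomial (Fin n) ℝ} {m : ℕ}
    (hP : P.IsHomogeneous m) :
    eval (fun i => x i) (dirDeriv x P) = m * eval (fun i => x i) P := by
  have := congrArg (eval fun i => x i) hP.sum_X_mul_pderiv
  simpa [dirDeriv] using this

lemma pderiv_comm (i j : Fin n) (P : MvPolynomial (Fin n) ℝ) :
    pderiv i (pderiv j P) = pderiv j (pderiv i P) := by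
  have h : ⁅pderiv (R := ℝ) i, pderiv (R := ℝ) j⁆ = 0 := by
    ext k
    simp [Derivation.commutator_apply, pderiv_X, Pi.single_apply, apply_ite]
  have := congrArg (fun D => D P) h
  simpa [Derivation.commutator_apply, sub_eq_zero] using this

lemma polyLaplacian_dirDeriv (x : EuclideanSpace ℝ (Fin n)) {P : MvPolynomial (Fin n) ℝ}
    (hP : polyLaplacian P = 0) : polyLaplacian (dirDeriv x P) = 0 := by
  have : polyLaplacian (dirDeriv x P) = dirDeriv x (polyLaplacian P) := by
    simp only [polyLaplacian, dirDeriv, map_sum, pderiv_C_mul, Finset.mul_sum]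
    rw [Finset.sum_comm]
    refine Finset.sum_congr rfl fun j _ => Finset.sum_congr rfl fun i _ => ?_
    rw [pderiv_comm i j, pderiv_comm i j]
  rw [this, hP]
  simp [dirDeriv]

lemma pderiv_linearForm (x : EuclideanSpace ℝ (Fin n)) (i : Fin n) :
    pderiv i (linearForm x) = C (x i) := by
  simp only [linearForm, map_sum, pderiv_C_mul, pderiv_X]
  rw [Finset.sum_eq_single i]
  · simp
  · intro j _ hj
    simp [Pi.single_eq_of_ne hj]
  · simp

lemma polyLaplacian_linearForm_pow_mul (x : EuclideanSpace ℝ (Fin n)) (hx : ‖x‖ = 1)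
    {P : MvPolynomial (Fin n) ℝ} (hP : polyLaplacian P = 0) (k : ℕ) :
    polyLaplacian (linearForm x ^ (k + 1) * P) =
      C (((k : ℝ) + 1) * k) * (linearForm x ^ (k - 1) * P) +
        C (2 * ((k : ℝ) + 1)) * (linearForm x ^ k * dirDeriv x P) := by
  have hx2 : ∑ i, (C (x i) : MvPolynomial (Fin n) ℝ) ^ 2 = 1 := by
    have h := EuclideanSpace.real_norm_sq_eq x
    rw [hx] at h
    simp only [← map_pow, ← map_sum, ← h]
    simp
  have hi (i : Fin n) : pderiv i (pderiv i (linearForm x ^ (k + 1) * P)) =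
      C (((k : ℝ) + 1) * k) * (linearForm x ^ (k - 1) * P) * C (x i) ^ 2 +
        C (2 * ((k : ℝ) + 1)) * linearForm x ^ k * (C (x i) * pderiv i P) +
          linearForm x ^ (k + 1) * pderiv i (pderiv i P) := by
    simp only [pderiv_mul, pderiv_pow, pderiv_linearForm, map_add, pderiv_C, map_mul, map_one,
      map_natCast, Nat.add_sub_cancel, Derivation.map_natCast, map_ofNat]
    push_cast
    ring
  simp only [polyLaplacian] at hP ⊢
  simp only [hi, Finset.sum_add_distrib, ← Finset.mul_sum, hP, hx2, dirDeriv]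
  ring

lemma integral_add_sphere (f g : MvPolynomial (Fin n) ℝ) :
    ∫ y, eval (fun i => (y : EuclideanSpace ℝ (Fin n)) i) (f + g) ∂(sphereMeasure n) =
      ∫ y, eval (fun i => (y : EuclideanSpace ℝ (Fin n)) i) f ∂(sphereMeasure n) +
      ∫ y, eval (fun i => (y : EuclideanSpace ℝ (Fin n)) i) g ∂(sphereMeasure n) := by
  simp only [map_add]
  exact integral_add (integrable_eval_sphere f) (integrable_eval_sphere g)

lemma integral_C_mul_sphere (a : ℝ) (f : MvPolynomial (Fin n) ℝ) :
    ∫ y, eval (fun i => (y : EuclideanSpace ℝ (Fin n)) i) (C a * f) ∂(sphereMeasure n) =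
      a * ∫ y, eval (fun i => (y : EuclideanSpace ℝ (Fin n)) i) f ∂(sphereMeasure n) := by
  simp only [map_mul, eval_C]
  exact integral_const_mul _ _

/-- The Funk–Hecke formula for the kernels `⟨x, y⟩ ^ k`. -/
lemma exists_integral_linearForm_pow_mul [NeZero n] (k m : ℕ) :
    ∃ c : ℝ, ∀ P : MvPolynomial (Fin n) ℝ, P.IsHomogeneous m → polyLaplacian P = 0 →
      ∀ x : EuclideanSpace ℝ (Fin n), ‖x‖ = 1 →
        ∫ y, eval (fun i => (y : EuclideanSpace ℝ (Fin n)) i) (linearForm x ^ k * P)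
          ∂(sphereMeasure n) = c * eval (fun i => x i) P := by
  induction k using Nat.strong_induction_on generalizing m with
  | _ k ih =>
  rcases k with _ | k
  · rcases eq_or_ne m 0 with rfl | hm
    · refine ⟨(sphereMeasure n).real univ, fun P hP _ x _ => ?_⟩
      rw [← totalDegree_zero_iff_isHomogeneous, totalDegree_eq_zero_iff_eq_C] at hP
      rw [hP]
      simp
    · obtain ⟨c, hc⟩ := exists_integral_sphere_eq_polyLaplacian (n := n) hm
      refine ⟨0, fun P hP hΔ x _ => ?_⟩
      simp only [pow_zero, one_mul]
      rw [hc P hP, hΔ]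
      simp
  · obtain ⟨c, hc⟩ := exists_integral_sphere_eq_polyLaplacian (n := n) (d := k + 1 + m) (by omega)
    obtain ⟨c₁, h₁⟩ := ih (k - 1) (by omega) m
    obtain ⟨c₂, h₂⟩ := ih k (by omega) (m - 1)
    refine ⟨c * ((k + 1) * k * c₁ + 2 * (k + 1) * c₂ * m), fun P hP hΔ x hx => ?_⟩
    have hhom : (linearForm x ^ (k + 1) * P).IsHomogeneous (k + 1 + m) := by
      simpa using ((isHomogeneous_linearForm x).pow (k + 1)).mul hP
    rw [hc _ hhom, polyLaplacian_linearForm_pow_mul x hx hΔ, integral_add_sphere,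
      integral_C_mul_sphere, integral_C_mul_sphere, h₁ P hP hΔ x hx,
      h₂ _ (isHomogeneous_dirDeriv x hP) (polyLaplacian_dirDeriv x hΔ) x hx,
      eval_dirDeriv_self x hP]
    ring

lemma integrable_kernel_mul_eval {h : ℝ → ℝ} (hh : ContinuousOn h (Icc (-1) 1))
    (P : MvPolynomial (Fin n) ℝ) (x : Metric.sphere (0 : EuclideanSpace ℝ (Fin n)) 1) :
    Integrable (fun y : Metric.sphere (0 : EuclideanSpace ℝ (Fin n)) 1 =>
      h ⟪(x : EuclideanSpace ℝ (Fin n)), (y : EuclideanSpace ℝ (Fin n))⟫ *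
        eval (fun i => (y : EuclideanSpace ℝ (Fin n)) i) P) (sphereMeasure n) := by
  refine Continuous.integrable_of_hasCompactSupport ?_ (HasCompactSupport.of_compactSpace _)
  refine (hh.comp_continuous (by fun_prop) fun y => ?_).mul
    ((continuous_eval_euclidean P).comp continuous_subtype_val)
  exact real_inner_mem_Icc_of_norm_eq_one (norm_eq_of_mem_sphere x) (norm_eq_of_mem_sphere y)

/-- The Funk–Hecke formula for polynomial kernels. -/
lemma exists_integral_polynomial_mul [NeZero n] (m : ℕ) (p : Polynomial ℝ) :
    ∃ c : ℝ, ∀ P : MvPolynomial (Fin n) ℝ, P.IsHomogeneous m → polyLaplacian P = 0 →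
      ∀ x : Metric.sphere (0 : EuclideanSpace ℝ (Fin n)) 1,
        ∫ y : Metric.sphere (0 : EuclideanSpace ℝ (Fin n)) 1,
          p.eval ⟪(x : EuclideanSpace ℝ (Fin n)), (y : EuclideanSpace ℝ (Fin n))⟫ *
            eval (fun i => (y : EuclideanSpace ℝ (Fin n)) i) P ∂(sphereMeasure n) =
          c * eval (fun i => (x : EuclideanSpace ℝ (Fin n)) i) P := by
  induction p using Polynomial.induction_on' with
  | add p q hp hq =>
    obtain ⟨a, ha⟩ := hp
    obtain ⟨b, hb⟩ := hq
    refine ⟨a + b, fun P hP hΔ x => ?_⟩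
    simp only [Polynomial.eval_add, add_mul]
    rw [integral_add (integrable_kernel_mul_eval p.continuousOn P x)
      (integrable_kernel_mul_eval q.continuousOn P x), ha P hP hΔ x, hb P hP hΔ x]
  | monomial k a =>
    obtain ⟨c, hc⟩ := exists_integral_linearForm_pow_mul (n := n) k m
    refine ⟨a * c, fun P hP hΔ x => ?_⟩
    have := hc P hP hΔ x (norm_eq_of_mem_sphere x)
    simp only [map_mul, map_pow, eval_linearForm] at this
    simp only [Polynomial.eval_monomial, mul_assoc, integral_const_mul, this]

/-- The Funk–Hecke formula for continuous real kernels. -/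
lemma exists_integral_continuousOn_mul [NeZero n] (m : ℕ) {h : ℝ → ℝ}
    (hh : ContinuousOn h (Icc (-1) 1)) :
    ∃ c : ℝ, ∀ P : MvPolynomial (Fin n) ℝ, P.IsHomogeneous m → polyLaplacian P = 0 →
      ∀ x : Metric.sphere (0 : EuclideanSpace ℝ (Fin n)) 1,
        ∫ y : Metric.sphere (0 : EuclideanSpace ℝ (Fin n)) 1,
          h ⟪(x : EuclideanSpace ℝ (Fin n)), (y : EuclideanSpace ℝ (Fin n))⟫ *
            eval (fun i => (y : EuclideanSpace ℝ (Fin n)) i) P ∂(sphereMeasure n) =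
          c * eval (fun i => (x : EuclideanSpace ℝ (Fin n)) i) P := by
  choose p hp using fun k : ℕ =>
    exists_polynomial_near_of_continuousOn (-1) 1 h hh (1 / ((k : ℝ) + 1)) (by positivity)
  choose c hc using fun k => exists_integral_polynomial_mul (n := n) m (p k)
  have hlim (P : MvPolynomial (Fin n) ℝ) (hP : P.IsHomogeneous m) (hΔ : polyLaplacian P = 0)
      (x : Metric.sphere (0 : EuclideanSpace ℝ (Fin n)) 1) :
      Tendsto (fun k => c k * eval (fun i => (x : EuclideanSpace ℝ (Fin n)) i) P) atTop
        (𝓝 (∫ y : Metric.sphere (0 : EuclideanSpace ℝ (Fin n)) 1,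
          h ⟪(x : EuclideanSpace ℝ (Fin n)), (y : EuclideanSpace ℝ (Fin n))⟫ *
            eval (fun i => (y : EuclideanSpace ℝ (Fin n)) i) P ∂(sphereMeasure n))) := by
    rw [← funext fun k => hc k P hP hΔ x]
    have hmem (y : Metric.sphere (0 : EuclideanSpace ℝ (Fin n)) 1) :
        ⟪(x : EuclideanSpace ℝ (Fin n)), (y : EuclideanSpace ℝ (Fin n))⟫ ∈ Icc (-1 : ℝ) 1 :=
      real_inner_mem_Icc_of_norm_eq_one (norm_eq_of_mem_sphere x) (norm_eq_of_mem_sphere y)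
    refine tendsto_integral_of_dominated_convergence _
      (fun k => (integrable_kernel_mul_eval (p k).continuousOn P x).aestronglyMeasurable)
      ((integrable_kernel_mul_eval hh P x).norm.add (integrable_eval_sphere P).norm)
      (fun k => .of_forall fun y => ?_) (.of_forall fun y => ?_)
    · have h1 := (hp k _ (hmem y)).le.trans (div_le_one_of_le₀ (by simp) (by positivity))
      rw [Pi.add_apply, norm_mul, norm_mul, ← add_one_mul]
      gcongr
      have := norm_add_le (h ⟪(x : EuclideanSpace ℝ (Fin n)), (y : EuclideanSpace ℝ (Fin n))⟫)
        ((p k).eval ⟪(x : EuclideanSpace ℝ (Fin n)), (y : EuclideanSpace ℝ (Fin n))⟫ -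
          h ⟪(x : EuclideanSpace ℝ (Fin n)), (y : EuclideanSpace ℝ (Fin n))⟫)
      rw [add_sub_cancel] at this
      exact this.trans (by gcongr; exact h1)
    · refine Tendsto.mul_const _ (tendsto_iff_norm_sub_tendsto_zero.mpr ?_)
      exact squeeze_zero (fun _ => norm_nonneg _) (fun k => (hp k _ (hmem y)).le)
        tendsto_one_div_add_atTop_nhds_zero_nat
  by_cases hex : ∃ P : MvPolynomial (Fin n) ℝ, P.IsHomogeneous m ∧ polyLaplacian P = 0 ∧
      ∃ x : Metric.sphere (0 : EuclideanSpace ℝ (Fin n)) 1,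
        eval (fun i => (x : EuclideanSpace ℝ (Fin n)) i) P ≠ 0
  · obtain ⟨P₀, hP₀, hΔ₀, x₀, hx₀⟩ := hex
    refine ⟨_, fun P hP hΔ x => tendsto_nhds_unique (hlim P hP hΔ x)
      (Tendsto.mul_const _ (((hlim P₀ hP₀ hΔ₀ x₀).div_const _).congr fun k =>
        mul_div_cancel_right₀ (c k) hx₀))⟩
  · push Not at hex
    refine ⟨0, fun P hP hΔ x => ?_⟩
    simp [hex P hP hΔ]

end SphericalHarmonic

theorem stmt0 (n : ℕ) (hn : 2 ≤ n) (ℓ : ℕ) (h : ℝ → ℂ)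
    (hh : ContinuousOn h (Set.Icc (-1 : ℝ) 1)) :
    ∃ lam : ℂ, ∀ P : MvPolynomial (Fin n) ℝ, P.IsHomogeneous ℓ → polyLaplacian P = 0 →
      ∀ x : Metric.sphere (0 : EuclideanSpace ℝ (Fin n)) 1,
        (∫ y : Metric.sphere (0 : EuclideanSpace ℝ (Fin n)) 1,
            h ⟪(x : EuclideanSpace ℝ (Fin n)), (y : EuclideanSpace ℝ (Fin n))⟫ *
              ((MvPolynomial.eval (fun i => (y : EuclideanSpace ℝ (Fin n)) i) P : ℝ) : ℂ)
            ∂(sphereMeasure n))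
          = lam * ((MvPolynomial.eval (fun i => (x : EuclideanSpace ℝ (Fin n)) i) P : ℝ) : ℂ) := by
  have : NeZero n := ⟨by omega⟩
  have hre : ContinuousOn (fun t => (h t).re) (Set.Icc (-1) 1) :=
    Complex.continuous_re.comp_continuousOn hh
  have him : ContinuousOn (fun t => (h t).im) (Set.Icc (-1) 1) :=
    Complex.continuous_im.comp_continuousOn hh
  obtain ⟨a, ha⟩ := SphericalHarmonic.exists_integral_continuousOn_mul (n := n) ℓ hre
  obtain ⟨b, hb⟩ := SphericalHarmonic.exists_integral_continuousOn_mul (n := n) ℓ him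
  refine ⟨a + b * Complex.I, fun P hP hΔ x => ?_⟩
  have hsplit (z : ℂ) (r : ℝ) :
      z * (r : ℂ) = ((z.re * r : ℝ) : ℂ) + ((z.im * r : ℝ) : ℂ) * Complex.I := by
    apply Complex.ext <;> simp
  simp only [hsplit]
  rw [integral_add (SphericalHarmonic.integrable_kernel_mul_eval hre P x).ofReal
      ((SphericalHarmonic.integrable_kernel_mul_eval him P x).ofReal.mul_const _),
    integral_mul_const, integral_complex_ofReal, integral_complex_ofReal, ha P hP hΔ x,
    hb P hP hΔ x]
  simp
end
end

section
/- Let n ≥ 3, set ν = (n−2)/2, let ℓ ≥ 0 be an integer, and let h : [−1,1] → ℂ be continuous. Then for every spherical harmonic Y of degree ℓ on S^{n−1} and every x ∈ S^{n−1}: ∫_{S^{n−1}} h(⟨x,y⟩) Y(y) dσ(y) = λ_h(ℓ) · Y(x), where λ_h(ℓ) = (vol(S^{n−2}) / C_ℓ^ν(1)) · ∫_{−1}^{1} h(t) C_ℓ^ν(t) (1−t²)^{ν−1/2} dt. -/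
open MeasureTheory Real
open scoped RealInnerProductSpace

noncomputable section

/-- The Gegenbauer polynomial `C_ℓ^ν`, via its explicit formula. -/
def gegenbauerC (ν : ℝ) (ℓ : ℕ) (t : ℝ) : ℝ :=
  ∑ k ∈ Finset.range (ℓ / 2 + 1),
    (-1 : ℝ) ^ k * (Real.Gamma (ν + ℓ - k) / (Real.Gamma ν * k.factorial * (ℓ - 2 * k).factorial))
      * (2 * t) ^ (ℓ - 2 * k)

theorem integrable_pow_mul_exp_neg_sq (k : ℕ) :
    Integrable fun y : ℝ => y ^ k * exp (-y ^ 2) := by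
  have h := integrable_rpow_mul_exp_neg_mul_sq one_pos (s := k)
    (by have := Nat.cast_nonneg (α := ℝ) k; linarith)
  simpa only [Real.rpow_natCast, neg_mul, one_mul] using h

theorem two_mul_integral_pow_succ_mul_exp_neg_sq (k : ℕ) :
    2 * ∫ y : ℝ, y ^ (k + 1) * exp (-y ^ 2) = k * ∫ y : ℝ, y ^ (k - 1) * exp (-y ^ 2) := by
  have h1 := (integrable_pow_mul_exp_neg_sq (k - 1)).const_mul (k : ℝ)
  have h2 := (integrable_pow_mul_exp_neg_sq (k + 1)).const_mul 2
  have hd (y : ℝ) : HasDerivAt (fun y : ℝ => y ^ k * exp (-y ^ 2))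
      (k * (y ^ (k - 1) * exp (-y ^ 2)) - 2 * (y ^ (k + 1) * exp (-y ^ 2))) y := by
    convert! (hasDerivAt_pow k y).mul ((hasDerivAt_pow 2 y).neg.exp) using 1
    push_cast
    simp only [Pi.neg_apply]
    ring
  have h0 := integral_eq_zero_of_hasDerivAt_of_integrable hd (h1.sub h2)
    (integrable_pow_mul_exp_neg_sq k)
  rw [integral_sub h1 h2, integral_const_mul, integral_const_mul] at h0
  linarith

/-- The integral of a polynomial against the Gaussian weight `exp (-∑ yᵢ²)`. -/
def gaussianIntegral {n : ℕ} (Q : MvPolynomial (Fin n) ℝ) : ℝ :=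
  ∫ y : Fin n → ℝ, MvPolynomial.eval y Q * exp (-∑ i, y i ^ 2)

theorem eval_monomial_mul_exp {n : ℕ} (s : Fin n →₀ ℕ) (c : ℝ) (y : Fin n → ℝ) :
    MvPolynomial.eval y (MvPolynomial.monomial s c) * exp (-∑ i, y i ^ 2) =
      c * ∏ i, (y i ^ s i * exp (-y i ^ 2)) := by
  rw [MvPolynomial.eval_monomial, Finsupp.prod_fintype _ _ (fun i => pow_zero _),
    Finset.prod_mul_distrib, ← Real.exp_sum, Finset.sum_neg_distrib, mul_assoc]

theorem integrable_eval_mul_exp {n : ℕ} (Q : MvPolynomial (Fin n) ℝ) :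
    Integrable fun y : Fin n → ℝ => MvPolynomial.eval y Q * exp (-∑ i, y i ^ 2) := by
  induction Q using MvPolynomial.induction_on' with
  | monomial s c =>
    simp only [eval_monomial_mul_exp]
    exact (Integrable.fintype_prod (f := fun i (t : ℝ) => t ^ s i * exp (-t ^ 2))
      fun i => integrable_pow_mul_exp_neg_sq (s i)).const_mul c
  | add p q hp hq =>
    simpa only [map_add, add_mul] using! hp.add hq

theorem gaussianIntegral_add {n : ℕ} (p q : MvPolynomial (Fin n) ℝ) :
    gaussianIntegral (p + q) = gaussianIntegral p + gaussianIntegral q := by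
  simp only [gaussianIntegral, map_add, add_mul]
  exact integral_add (integrable_eval_mul_exp p) (integrable_eval_mul_exp q)

theorem gaussianIntegral_C_mul {n : ℕ} (c : ℝ) (p : MvPolynomial (Fin n) ℝ) :
    gaussianIntegral (MvPolynomial.C c * p) = c * gaussianIntegral p := by
  simp only [gaussianIntegral, map_mul, MvPolynomial.eval_C, mul_assoc, integral_const_mul]

theorem gaussianIntegral_sum {n : ℕ} {ι : Type*} (t : Finset ι)
    (p : ι → MvPolynomial (Fin n) ℝ) :
    gaussianIntegral (∑ i ∈ t, p i) = ∑ i ∈ t, gaussianIntegral (p i) := by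
  classical
  induction t using Finset.induction_on with
  | empty => simp [gaussianIntegral]
  | insert i t hi ih => rw [Finset.sum_insert hi, Finset.sum_insert hi, gaussianIntegral_add, ih]

theorem gaussianIntegral_monomial {n : ℕ} (s : Fin n →₀ ℕ) (c : ℝ) :
    gaussianIntegral (MvPolynomial.monomial s c) =
      c * ∏ i, ∫ y : ℝ, y ^ s i * exp (-y ^ 2) := by
  simp only [gaussianIntegral, eval_monomial_mul_exp]
  rw [integral_const_mul, integral_fintype_prod_volume_eq_prod
    (f := fun i (t : ℝ) => t ^ s i * exp (-t ^ 2))]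

theorem gaussianIntegral_one {n : ℕ} :
    gaussianIntegral (1 : MvPolynomial (Fin n) ℝ) = π ^ ((n : ℝ) / 2) := by
  have h : (1 : MvPolynomial (Fin n) ℝ) = MvPolynomial.monomial 0 1 := rfl
  have h1 := integral_gaussian 1
  simp only [neg_mul, one_mul, div_one] at h1
  rw [h, gaussianIntegral_monomial]
  simp only [Finsupp.coe_zero, Pi.zero_apply, pow_zero, one_mul, h1, Finset.prod_const,
    Finset.card_univ, Fintype.card_fin]
  rw [Real.sqrt_eq_rpow, ← Real.rpow_mul_natCast pi_pos.le]
  congr 1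
  ring

/-- Gaussian integration by parts. -/
theorem two_mul_gaussianIntegral_X_mul {n : ℕ} (i : Fin n) (Q : MvPolynomial (Fin n) ℝ) :
    2 * gaussianIntegral (MvPolynomial.X i * Q) = gaussianIntegral (MvPolynomial.pderiv i Q) := by
  induction Q using MvPolynomial.induction_on' with
  | monomial s c =>
    have hX : MvPolynomial.X i * MvPolynomial.monomial s c =
        MvPolynomial.monomial (s + Finsupp.single i 1) c := by
      rw [mul_comm, MvPolynomial.X, MvPolynomial.monomial_mul, mul_one]
    rw [hX, MvPolynomial.pderiv_monomial, gaussianIntegral_monomial, gaussianIntegral_monomial,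
      ← Finset.mul_prod_erase _ _ (Finset.mem_univ i),
      ← Finset.mul_prod_erase _ _ (Finset.mem_univ i)]
    have e1 : ∏ j ∈ Finset.univ.erase i,
        ∫ y : ℝ, y ^ (s + Finsupp.single i 1 : Fin n →₀ ℕ) j * exp (-y ^ 2) =
        ∏ j ∈ Finset.univ.erase i, ∫ y : ℝ, y ^ s j * exp (-y ^ 2) :=
      Finset.prod_congr rfl fun j hj => by
        simp [(Finset.ne_of_mem_erase hj).symm]
    have e2 : ∏ j ∈ Finset.univ.erase i,
        ∫ y : ℝ, y ^ (s - Finsupp.single i 1 : Fin n →₀ ℕ) j * exp (-y ^ 2) =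
        ∏ j ∈ Finset.univ.erase i, ∫ y : ℝ, y ^ s j * exp (-y ^ 2) :=
      Finset.prod_congr rfl fun j hj => by
        simp [(Finset.ne_of_mem_erase hj).symm]
    rw [e1, e2]
    have := two_mul_integral_pow_succ_mul_exp_neg_sq (s i)
    simp only [Finsupp.add_apply, Finsupp.tsub_apply, Finsupp.single_eq_same]
    linear_combination (c * ∏ j ∈ Finset.univ.erase i, ∫ y : ℝ, y ^ s j * exp (-y ^ 2)) * this
  | add p q hp hq =>
    rw [mul_add, map_add, gaussianIntegral_add, gaussianIntegral_add, mul_add, hp, hq]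

/-- The linear form `⟨x, ·⟩` as a polynomial. -/
def linearForm {n : ℕ} (x : Fin n → ℝ) : MvPolynomial (Fin n) ℝ :=
  ∑ i, MvPolynomial.C (x i) * MvPolynomial.X i

/-- The derivative of a polynomial in the direction `x`. -/
def directionalDeriv {n : ℕ} (x : Fin n → ℝ) (P : MvPolynomial (Fin n) ℝ) :
    MvPolynomial (Fin n) ℝ :=
  ∑ i, MvPolynomial.C (x i) * MvPolynomial.pderiv i P

theorem pderiv_linearForm {n : ℕ} (x : Fin n → ℝ) (i : Fin n) :
    MvPolynomial.pderiv i (linearForm x) = MvPolynomial.C (x i) := by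
  simp [linearForm, MvPolynomial.pderiv_X, Pi.single_apply]

theorem eval_linearForm {n : ℕ} (x y : Fin n → ℝ) :
    MvPolynomial.eval y (linearForm x) = ∑ i, x i * y i := by
  simp [linearForm]

theorem isHomogeneous_linearForm {n : ℕ} (x : Fin n → ℝ) : (linearForm x).IsHomogeneous 1 :=
  MvPolynomial.IsHomogeneous.sum _ _ _ fun i _ => (MvPolynomial.isHomogeneous_X ℝ i).C_mul _

theorem isHomogeneous_directionalDeriv {n ℓ : ℕ} (x : Fin n → ℝ) {P : MvPolynomial (Fin n) ℝ}
    (hP : P.IsHomogeneous ℓ) : (directionalDeriv x P).IsHomogeneous (ℓ - 1) :=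
  MvPolynomial.IsHomogeneous.sum _ _ _ fun _ _ => hP.pderiv.C_mul _

theorem pderiv_comm {n : ℕ} (i j : Fin n) (P : MvPolynomial (Fin n) ℝ) :
    MvPolynomial.pderiv i (MvPolynomial.pderiv j P) =
      MvPolynomial.pderiv j (MvPolynomial.pderiv i P) := by
  have h : ⁅(MvPolynomial.pderiv i : Derivation ℝ (MvPolynomial (Fin n) ℝ) _),
      (MvPolynomial.pderiv j : Derivation ℝ (MvPolynomial (Fin n) ℝ) _)⁆ = 0 :=
    MvPolynomial.derivation_ext fun k => by
      rw [Derivation.commutator_apply]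
      simp [MvPolynomial.pderiv_X, Pi.single_apply, apply_ite]
  have h' := DFunLike.congr_fun h P
  rw [Derivation.commutator_apply] at h'
  exact sub_eq_zero.mp h'

theorem polyLaplacian_directionalDeriv {n : ℕ} (x : Fin n → ℝ) (P : MvPolynomial (Fin n) ℝ) :
    polyLaplacian (directionalDeriv x P) = directionalDeriv x (polyLaplacian P) := by
  simp only [polyLaplacian, directionalDeriv, map_sum, MvPolynomial.pderiv_C_mul, Finset.mul_sum]
  rw [Finset.sum_comm]
  refine Finset.sum_congr rfl fun i _ => Finset.sum_congr rfl fun j _ => ?_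
  rw [pderiv_comm j i, pderiv_comm j i]

theorem eval_directionalDeriv_self {n ℓ : ℕ} (x : Fin n → ℝ) {P : MvPolynomial (Fin n) ℝ}
    (hP : P.IsHomogeneous ℓ) :
    MvPolynomial.eval x (directionalDeriv x P) = ℓ * MvPolynomial.eval x P := by
  have h := congrArg (MvPolynomial.eval x) hP.sum_X_mul_pderiv
  simpa [directionalDeriv] using h

theorem pderiv_linearForm_pow_mul {n : ℕ} (x : Fin n → ℝ) (m : ℕ) (i : Fin n)
    (P : MvPolynomial (Fin n) ℝ) :
    MvPolynomial.pderiv i (linearForm x ^ m * P) =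
      MvPolynomial.C (m * x i) * (linearForm x ^ (m - 1) * P) +
        linearForm x ^ m * MvPolynomial.pderiv i P := by
  rw [MvPolynomial.pderiv_mul, MvPolynomial.pderiv_pow, pderiv_linearForm, map_mul, map_natCast]
  ring

theorem two_mul_gaussianIntegral_linearForm_mul {n : ℕ} (x : Fin n → ℝ)
    (Q : MvPolynomial (Fin n) ℝ) :
    2 * gaussianIntegral (linearForm x * Q) =
      ∑ i, x i * gaussianIntegral (MvPolynomial.pderiv i Q) := by
  rw [linearForm, Finset.sum_mul, gaussianIntegral_sum, Finset.mul_sum]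
  refine Finset.sum_congr rfl fun i _ => ?_
  rw [mul_assoc, gaussianIntegral_C_mul, ← two_mul_gaussianIntegral_X_mul]
  ring

theorem gaussianIntegral_mul_directionalDeriv {n : ℕ} (x : Fin n → ℝ)
    (R P : MvPolynomial (Fin n) ℝ) :
    gaussianIntegral (R * directionalDeriv x P) =
      ∑ i, x i * gaussianIntegral (R * MvPolynomial.pderiv i P) := by
  rw [directionalDeriv, Finset.mul_sum, gaussianIntegral_sum]
  refine Finset.sum_congr rfl fun i _ => ?_
  rw [mul_left_comm, gaussianIntegral_C_mul]

theorem two_mul_gaussianIntegral_linearForm_pow_succ_mul {n : ℕ} (x : Fin n → ℝ)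
    (hx : ∑ i, x i ^ 2 = 1) (m : ℕ) (P : MvPolynomial (Fin n) ℝ) :
    2 * gaussianIntegral (linearForm x ^ (m + 1) * P) =
      m * gaussianIntegral (linearForm x ^ (m - 1) * P) +
        gaussianIntegral (linearForm x ^ m * directionalDeriv x P) := by
  rw [pow_succ', mul_assoc, two_mul_gaussianIntegral_linearForm_mul,
    gaussianIntegral_mul_directionalDeriv]
  simp only [pderiv_linearForm_pow_mul, gaussianIntegral_add, gaussianIntegral_C_mul, mul_add,
    Finset.sum_add_distrib]
  congr 1
  rw [← one_mul (m * gaussianIntegral _), ← hx, Finset.sum_mul]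
  exact Finset.sum_congr rfl fun i _ => by ring

theorem two_mul_degree_mul_gaussianIntegral {n ℓ : ℕ} (x : Fin n → ℝ) (m : ℕ)
    {P : MvPolynomial (Fin n) ℝ} (hP : P.IsHomogeneous ℓ) (hPharm : polyLaplacian P = 0) :
    2 * ℓ * gaussianIntegral (linearForm x ^ m * P) =
      m * gaussianIntegral (linearForm x ^ (m - 1) * directionalDeriv x P) := by
  have h1 : gaussianIntegral (MvPolynomial.C (ℓ : ℝ) * (linearForm x ^ m * P)) =
      ∑ i, gaussianIntegral (MvPolynomial.X i * (linearForm x ^ m * MvPolynomial.pderiv i P)) := by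
    rw [← gaussianIntegral_sum]
    congr 1
    have := hP.sum_X_mul_pderiv
    rw [nsmul_eq_mul] at this
    rw [map_natCast, mul_left_comm, ← this, Finset.mul_sum]
    exact Finset.sum_congr rfl fun i _ => by ring
  rw [gaussianIntegral_C_mul] at h1
  have h2 : ∑ i, gaussianIntegral (linearForm x ^ m *
      MvPolynomial.pderiv i (MvPolynomial.pderiv i P)) = 0 := by
    rw [← gaussianIntegral_sum, ← Finset.mul_sum]
    change gaussianIntegral (_ * polyLaplacian P) = 0
    simp [hPharm, gaussianIntegral]
  rw [mul_assoc, h1, Finset.mul_sum, gaussianIntegral_mul_directionalDeriv, Finset.mul_sum]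
  simp only [two_mul_gaussianIntegral_X_mul, pderiv_linearForm_pow_mul, gaussianIntegral_add,
    gaussianIntegral_C_mul, Finset.sum_add_distrib, h2, add_zero, mul_assoc]

theorem gaussianIntegral_linearForm_pow_mul_recurrence {n ℓ : ℕ} (x : Fin n → ℝ)
    (hx : ∑ i, x i ^ 2 = 1) (m : ℕ) {P : MvPolynomial (Fin n) ℝ} (hP : P.IsHomogeneous ℓ)
    (hPharm : polyLaplacian P = 0) :
    2 * ((m : ℝ) - ℓ) * gaussianIntegral (linearForm x ^ m * P) =
      m * (m - 1) * gaussianIntegral (linearForm x ^ (m - 2) * P) := by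
  have hB := two_mul_degree_mul_gaussianIntegral x m hP hPharm
  cases m with
  | zero =>
    simp only [Nat.cast_zero, zero_mul] at hB ⊢
    linear_combination -hB
  | succ m =>
    have hA := two_mul_gaussianIntegral_linearForm_pow_succ_mul x hx m P
    rw [Nat.add_sub_cancel] at hB
    rw [show m + 1 - 2 = m - 1 by omega]
    push_cast at hB ⊢
    linear_combination (m + 1 : ℝ) * hA - hB

theorem gaussianIntegral_linearForm_pow_degree_mul {n : ℕ} (x : Fin n → ℝ)
    (ℓ : ℕ) {P : MvPolynomial (Fin n) ℝ} (hP : P.IsHomogeneous ℓ) (hPharm : polyLaplacian P = 0) :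
    2 ^ ℓ * gaussianIntegral (linearForm x ^ ℓ * P) =
      ℓ.factorial * π ^ ((n : ℝ) / 2) * MvPolynomial.eval x P := by
  induction ℓ generalizing P with
  | zero =>
    obtain ⟨c, rfl⟩ : ∃ c, P = MvPolynomial.C c :=
      ⟨_, MvPolynomial.totalDegree_eq_zero_iff_eq_C.mp
        ((MvPolynomial.totalDegree_zero_iff_isHomogeneous (p := P)).mpr hP)⟩
    rw [pow_zero, pow_zero, one_mul, one_mul, ← mul_one (MvPolynomial.C c),
      gaussianIntegral_C_mul, gaussianIntegral_one]
    simp [mul_comm]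
  | succ ℓ ih =>
    have hB := two_mul_degree_mul_gaussianIntegral x (ℓ + 1) hP hPharm
    have hD : polyLaplacian (directionalDeriv x P) = 0 := by
      rw [polyLaplacian_directionalDeriv, hPharm]
      simp [directionalDeriv]
    have h := ih (isHomogeneous_directionalDeriv x hP) hD
    rw [eval_directionalDeriv_self x hP] at h
    rw [Nat.add_sub_cancel] at hB
    have h0 : ((ℓ + 1 : ℕ) : ℝ) ≠ 0 := by positivity
    have hB' : 2 * gaussianIntegral (linearForm x ^ (ℓ + 1) * P) =
        gaussianIntegral (linearForm x ^ ℓ * directionalDeriv x P) :=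
      mul_left_cancel₀ h0 (by linear_combination hB)
    rw [Nat.factorial_succ]
    push_cast at h ⊢
    linear_combination 2 ^ ℓ * hB' + h

theorem eval_smul_of_isHomogeneous {n d : ℕ} {F : MvPolynomial (Fin n) ℝ}
    (hF : F.IsHomogeneous d) (r : ℝ) (s : Fin n → ℝ) :
    MvPolynomial.eval (fun i => r * s i) F = r ^ d * MvPolynomial.eval s F := by
  rw [MvPolynomial.eval_eq', MvPolynomial.eval_eq', Finset.mul_sum]
  refine Finset.sum_congr rfl fun m hm => ?_
  have h : ∑ i, m i = d := by
    rw [← hF (MvPolynomial.mem_support_iff.mp hm), Finsupp.weight_apply,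
      Finsupp.sum_fintype _ _ (by simp)]
    simp
  simp only [mul_pow, Finset.prod_mul_distrib, Finset.prod_pow_eq_pow_sum, h]
  ring

theorem integral_Ioi_pow_mul_exp_neg_sq (k : ℕ) :
    ∫ r in Set.Ioi (0 : ℝ), r ^ k * exp (-r ^ 2) = Gamma ((k + 1) / 2) / 2 := by
  have h := integral_rpow_mul_exp_neg_rpow (p := 2) (q := k) two_pos
    (by have := Nat.cast_nonneg (α := ℝ) k; linarith)
  simp only [Real.rpow_natCast, Real.rpow_two] at h
  rw [h]
  ring

/-- Polar coordinates: the integral over the sphere of a homogeneous polynomial is proportional to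
its Gaussian integral. -/
theorem integral_sphere_mul_Gamma {n d : ℕ} (hn : 0 < n) {F : MvPolynomial (Fin n) ℝ}
    (hF : F.IsHomogeneous d) :
    (∫ y : Metric.sphere (0 : EuclideanSpace ℝ (Fin n)) 1,
        MvPolynomial.eval (fun i => (y : EuclideanSpace ℝ (Fin n)) i) F ∂(sphereMeasure n)) *
      Gamma (((d : ℝ) + n) / 2) = 2 * gaussianIntegral F := by
  have : Nonempty (Fin n) := ⟨⟨0, hn⟩⟩
  let μ : Measure (EuclideanSpace ℝ (Fin n)) := volume
  let f : EuclideanSpace ℝ (Fin n) → ℝ := fun y =>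
    MvPolynomial.eval (fun i => y i) F * exp (-‖y‖ ^ 2)
  have h1 : gaussianIntegral F = ∫ y : EuclideanSpace ℝ (Fin n), f y := by
    rw [gaussianIntegral, ← (PiLp.volume_preserving_toLp (Fin n)).integral_comp
      (MeasurableEquiv.toLp 2 (Fin n → ℝ)).measurableEmbedding]
    refine integral_congr_ae (Filter.Eventually.of_forall fun y => ?_)
    simp [f, EuclideanSpace.norm_sq_eq]
  have h2 : ∫ y : EuclideanSpace ℝ (Fin n), f y =
      ∫ y : ({(0 : EuclideanSpace ℝ (Fin n))}ᶜ : Set (EuclideanSpace ℝ (Fin n))), f y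
        ∂(μ.comap (↑)) := by
    rw [integral_subtype_comap (measurableSet_singleton _).compl f, restrict_compl_singleton]
  have h3 : ∫ y : ({(0 : EuclideanSpace ℝ (Fin n))}ᶜ : Set (EuclideanSpace ℝ (Fin n))), f y
        ∂(μ.comap (↑)) =
      ∫ z : Metric.sphere (0 : EuclideanSpace ℝ (Fin n)) 1 × Set.Ioi (0 : ℝ),
        MvPolynomial.eval (fun i => (z.1 : EuclideanSpace ℝ (Fin n)) i) F *
          ((z.2 : ℝ) ^ d * exp (-(z.2 : ℝ) ^ 2))
          ∂(μ.toSphere.prod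
            (Measure.volumeIoiPow (Module.finrank ℝ (EuclideanSpace ℝ (Fin n)) - 1))) := by
    rw [← μ.measurePreserving_homeomorphUnitSphereProd.integral_comp
      (Homeomorph.measurableEmbedding _)]
    refine integral_congr_ae (Filter.Eventually.of_forall fun y => ?_)
    have hy : ‖(y : EuclideanSpace ℝ (Fin n))‖ ≠ 0 := norm_ne_zero_iff.mpr y.2
    have h := eval_smul_of_isHomogeneous hF ‖(y : EuclideanSpace ℝ (Fin n))‖
      (fun i => ‖(y : EuclideanSpace ℝ (Fin n))‖⁻¹ * (y : EuclideanSpace ℝ (Fin n)) i)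
    simp only [mul_inv_cancel_left₀ hy] at h
    simp only [f, h, homeomorphUnitSphereProd_apply_snd_coe, homeomorphUnitSphereProd_apply_fst_coe,
      PiLp.smul_apply, smul_eq_mul]
    ring
  have h4 : ∫ r : Set.Ioi (0 : ℝ), (r : ℝ) ^ d * exp (-(r : ℝ) ^ 2)
      ∂(Measure.volumeIoiPow (Module.finrank ℝ (EuclideanSpace ℝ (Fin n)) - 1)) =
        Gamma (((d : ℝ) + n) / 2) / 2 := by
    have hk : ((n - 1 + d : ℕ) : ℝ) + 1 = d + n := by
      rw [Nat.cast_add, Nat.cast_sub hn]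
      push_cast
      ring
    rw [← hk, ← integral_Ioi_pow_mul_exp_neg_sq]
    simp only [Measure.volumeIoiPow, ENNReal.ofReal]
    rw [integral_withDensity_eq_integral_smul
        ((measurable_subtype_coe.pow_const _).real_toNNReal),
      integral_subtype_comap measurableSet_Ioi fun a : ℝ =>
        Real.toNNReal (a ^ (Module.finrank ℝ (EuclideanSpace ℝ (Fin n)) - 1)) •
          (a ^ d * exp (-a ^ 2))]
    refine setIntegral_congr_fun measurableSet_Ioi fun r hr => ?_
    have hE : Module.finrank ℝ (EuclideanSpace ℝ (Fin n)) = n := finrank_euclideanSpace_fin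
    simp only [NNReal.smul_def, smul_eq_mul, hE]
    rw [Real.coe_toNNReal _ (pow_nonneg (le_of_lt hr) _), pow_add]
    ring
  rw [h1, h2, h3, integral_prod_mul (fun s : Metric.sphere (0 : EuclideanSpace ℝ (Fin n)) 1 =>
      MvPolynomial.eval (fun i => (s : EuclideanSpace ℝ (Fin n)) i) F)
    (fun r : Set.Ioi (0 : ℝ) => (r : ℝ) ^ d * exp (-(r : ℝ) ^ 2)), h4]
  simp only [sphereMeasure, μ]
  ring

theorem sphereMeasure_univ_mul_Gamma {n : ℕ} (hn : 0 < n) :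
    ((sphereMeasure n) Set.univ).toReal * Gamma ((n : ℝ) / 2) = 2 * π ^ ((n : ℝ) / 2) := by
  have h := integral_sphere_mul_Gamma hn (MvPolynomial.isHomogeneous_one (Fin n) ℝ)
  rw [gaussianIntegral_one] at h
  simpa [Measure.real] using h

/-- The integral over the sphere of `⟨x, y⟩ ^ m * P y`. -/
def sphereMoment {n : ℕ} (x : Fin n → ℝ) (P : MvPolynomial (Fin n) ℝ) (m : ℕ) : ℝ :=
  ∫ y : Metric.sphere (0 : EuclideanSpace ℝ (Fin n)) 1,
    MvPolynomial.eval (fun i => (y : EuclideanSpace ℝ (Fin n)) i) (linearForm x ^ m * P)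
      ∂(sphereMeasure n)

theorem sphereMoment_mul_Gamma {n ℓ : ℕ} (hn : 0 < n) (x : Fin n → ℝ)
    {P : MvPolynomial (Fin n) ℝ} (hP : P.IsHomogeneous ℓ) (m : ℕ) :
    sphereMoment x P m * Gamma (((m : ℝ) + ℓ + n) / 2) =
      2 * gaussianIntegral (linearForm x ^ m * P) := by
  have h := integral_sphere_mul_Gamma hn (((isHomogeneous_linearForm x).pow m).mul hP)
  simpa [sphereMoment] using h

theorem sphereMoment_recurrence {n ℓ : ℕ} (hn : 0 < n) (x : Fin n → ℝ) (hx : ∑ i, x i ^ 2 = 1)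
    {P : MvPolynomial (Fin n) ℝ} (hP : P.IsHomogeneous ℓ) (hPharm : polyLaplacian P = 0) (m : ℕ) :
    ((m : ℝ) - ℓ) * (m + ℓ + n - 2) * sphereMoment x P m =
      m * (m - 1) * sphereMoment x P (m - 2) := by
  have h := gaussianIntegral_linearForm_pow_mul_recurrence x hx m hP hPharm
  have hm := sphereMoment_mul_Gamma hn x hP m
  have hn' : (0 : ℝ) < n := Nat.cast_pos.mpr hn
  have hG : 0 < Gamma (((m : ℝ) + ℓ + n) / 2) := Gamma_pos_of_pos (by positivity)
  rcases lt_or_ge m 2 with hlt | hge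
  · have h0 : (m : ℝ) * (m - 1) = 0 := by interval_cases m <;> simp
    rw [h0, zero_mul] at h ⊢
    have h1 : ((m : ℝ) - ℓ) * sphereMoment x P m = 0 := by
      refine mul_right_cancel₀ hG.ne' ?_
      linear_combination ((m : ℝ) - ℓ) * hm + h
    linear_combination (m + ℓ + n - 2 : ℝ) * h1
  · obtain ⟨k, rfl⟩ := Nat.exists_eq_add_of_le' hge
    rw [Nat.add_sub_cancel] at h ⊢
    have hk := sphereMoment_mul_Gamma hn x hP k
    have hpos : 0 < Gamma (((k : ℝ) + ℓ + n) / 2) := Gamma_pos_of_pos (by positivity)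
    have hrec : Gamma ((((k + 2 : ℕ) : ℝ) + ℓ + n) / 2) =
        ((k : ℝ) + ℓ + n) / 2 * Gamma (((k : ℝ) + ℓ + n) / 2) := by
      rw [← Gamma_add_one (by positivity)]
      push_cast
      ring_nf
    rw [hrec] at hm
    refine mul_right_cancel₀ hpos.ne' ?_
    push_cast at *
    linear_combination 2 * (k + 2 - ℓ : ℝ) * hm + 2 * h - (k + 2 : ℝ) * (k + 1) * hk

theorem sphereMoment_degree {n ℓ : ℕ} (hn : 0 < n) (x : Fin n → ℝ)
    {P : MvPolynomial (Fin n) ℝ} (hP : P.IsHomogeneous ℓ) (hPharm : polyLaplacian P = 0) :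
    2 ^ ℓ * Gamma (ℓ + (n : ℝ) / 2) * sphereMoment x P ℓ =
      2 * ℓ.factorial * π ^ ((n : ℝ) / 2) * MvPolynomial.eval x P := by
  have hm := sphereMoment_mul_Gamma hn x hP ℓ
  have h := gaussianIntegral_linearForm_pow_degree_mul x ℓ hP hPharm
  rw [show ((ℓ : ℝ) + ℓ + n) / 2 = ℓ + (n : ℝ) / 2 by ring] at hm
  linear_combination 2 ^ ℓ * hm + 2 * h

/-- The Gegenbauer polynomial `C_ℓ^ν` as an element of `ℝ[X]`. -/
def gegenbauerPoly (ν : ℝ) (ℓ : ℕ) : Polynomial ℝ :=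
  ∑ k ∈ Finset.range (ℓ / 2 + 1),
    Polynomial.C ((-1 : ℝ) ^ k *
      (Gamma (ν + ℓ - k) / (Gamma ν * k.factorial * (ℓ - 2 * k).factorial)) * 2 ^ (ℓ - 2 * k)) *
      Polynomial.X ^ (ℓ - 2 * k)

theorem eval_gegenbauerPoly (ν : ℝ) (ℓ : ℕ) (t : ℝ) :
    (gegenbauerPoly ν ℓ).eval t = gegenbauerC ν ℓ t := by
  simp only [gegenbauerPoly, gegenbauerC, Polynomial.eval_finsetSum, Polynomial.eval_mul,
    Polynomial.eval_C, Polynomial.eval_pow, Polynomial.eval_X, mul_pow, mul_assoc]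

theorem gegenbauerPoly_zero {ν : ℝ} (hν : 0 < ν) : gegenbauerPoly ν 0 = 1 := by
  simp [gegenbauerPoly, (Gamma_pos_of_pos hν).ne']

theorem derivative_gegenbauerPoly_succ {ν : ℝ} (hν : 0 < ν) (ℓ : ℕ) :
    Polynomial.derivative (gegenbauerPoly ν (ℓ + 1)) =
      Polynomial.C (2 * ν) * gegenbauerPoly (ν + 1) ℓ := by
  have hG := (Gamma_pos_of_pos hν).ne'
  have key (k : ℕ) (hk : k ∈ Finset.range (ℓ / 2 + 1)) :
      Polynomial.derivative (Polynomial.C ((-1 : ℝ) ^ k *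
        (Gamma (ν + (ℓ + 1 : ℕ) - k) / (Gamma ν * k.factorial * (ℓ + 1 - 2 * k).factorial)) *
          2 ^ (ℓ + 1 - 2 * k)) * Polynomial.X ^ (ℓ + 1 - 2 * k)) =
      Polynomial.C (2 * ν) * (Polynomial.C ((-1 : ℝ) ^ k *
        (Gamma (ν + 1 + ℓ - k) / (Gamma (ν + 1) * k.factorial * (ℓ - 2 * k).factorial)) *
          2 ^ (ℓ - 2 * k)) * Polynomial.X ^ (ℓ - 2 * k)) := by
    have hk' : 2 * k ≤ ℓ := by
      have := Finset.mem_range.mp hk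
      omega
    obtain ⟨j, rfl⟩ := Nat.exists_eq_add_of_le hk'
    rw [show 2 * k + j + 1 - 2 * k = j + 1 by omega, Nat.add_sub_cancel_left,
      Polynomial.derivative_C_mul_X_pow, Nat.add_sub_cancel, ← mul_assoc, ← Polynomial.C_mul,
      Gamma_add_one hν.ne', Nat.factorial_succ]
    congr 2
    have : ν + ((2 * k + j + 1 : ℕ) : ℝ) - k = ν + 1 + ((2 * k + j : ℕ) : ℝ) - k := by
      push_cast
      ring
    rw [this]
    push_cast
    field_simp
    ring
  rw [gegenbauerPoly, gegenbauerPoly, Polynomial.derivative_sum, Finset.mul_sum]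
  rcases Nat.even_or_odd' ℓ with ⟨r, rfl | rfl⟩
  · rw [show (2 * r + 1) / 2 = 2 * r / 2 by omega]
    exact Finset.sum_congr rfl key
  · rw [show (2 * r + 1 + 1) / 2 = (2 * r + 1) / 2 + 1 by omega, Finset.sum_range_succ,
      Finset.sum_congr rfl key, show 2 * r + 1 + 1 - 2 * ((2 * r + 1) / 2 + 1) = 0 by omega]
    simp

/-- The Gegenbauer differential equation. -/
theorem gegenbauerPoly_differential_eq {ν : ℝ} (hν : 0 < ν) (ℓ : ℕ) :
    (1 - Polynomial.X ^ 2) * Polynomial.derivative (Polynomial.derivative (gegenbauerPoly ν ℓ)) -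
      Polynomial.C (2 * ν + 1) * Polynomial.X * Polynomial.derivative (gegenbauerPoly ν ℓ) +
      Polynomial.C (ℓ * (ℓ + 2 * ν)) * gegenbauerPoly ν ℓ = 0 := by
  refine Polynomial.funext fun t => ?_
  set c : ℕ → ℝ := fun k => (-1 : ℝ) ^ k *
      (Gamma (ν + ℓ - k) / (Gamma ν * k.factorial * (ℓ - 2 * k).factorial)) * 2 ^ (ℓ - 2 * k)
    with hc
  have hp : gegenbauerPoly ν ℓ = ∑ k ∈ Finset.range (ℓ / 2 + 1),
      Polynomial.C (c k) * Polynomial.X ^ (ℓ - 2 * k) := rfl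
  let U : ℕ → ℝ := fun k => c k * (((ℓ - 2 * k : ℕ) : ℝ) * (((ℓ - 2 * k : ℕ) : ℝ) - 1)) *
    t ^ (ℓ - 2 * k - 2)
  let W : ℕ → ℝ := fun k => c k * (2 * k * (2 * ℓ - 2 * k + 2 * ν)) * t ^ (ℓ - 2 * k)
  have hsplit : ∀ k ∈ Finset.range (ℓ / 2 + 1),
      (1 - t ^ 2) * (c k * ((ℓ - 2 * k : ℕ) : ℝ) * ((ℓ - 2 * k - 1 : ℕ) : ℝ) *
        t ^ (ℓ - 2 * k - 1 - 1)) - (2 * ν + 1) * t * (c k * ((ℓ - 2 * k : ℕ) : ℝ) *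
        t ^ (ℓ - 2 * k - 1)) + ℓ * (ℓ + 2 * ν) * (c k * t ^ (ℓ - 2 * k)) = U k + W k := by
    intro k hk
    have hk' : 2 * k ≤ ℓ := by
      have := Finset.mem_range.mp hk
      omega
    obtain ⟨j, hj⟩ := Nat.exists_eq_add_of_le hk'
    have hℓ : (ℓ : ℝ) = 2 * k + j := by exact_mod_cast hj
    have hj' : ℓ - 2 * k = j := by omega
    simp only [U, W, hj', hℓ]
    rcases j with _ | _ | j
    · push_cast
      ring
    · push_cast
      ring
    · simp only [Nat.add_sub_cancel, show j + 1 + 1 - 2 = j by omega]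
      push_cast
      ring
  have hcancel : ∀ k ∈ Finset.range (ℓ / 2), U k + W (k + 1) = 0 := by
    intro k hk
    have hk' : 2 * k + 2 ≤ ℓ := by
      have := Finset.mem_range.mp hk
      omega
    obtain ⟨j, hj⟩ := Nat.exists_eq_add_of_le hk'
    have hℓ : (ℓ : ℝ) = 2 * k + 2 + j := by exact_mod_cast hj
    have h1 : ℓ - 2 * k = j + 2 := by omega
    have h2 : ℓ - 2 * (k + 1) = j := by omega
    have hG : Gamma (ν + (2 * k + 2 + j) - k) =
        (ν + k + 1 + j) * Gamma (ν + (2 * k + 2 + j) - (k + 1)) := by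
      rw [show ν + (2 * k + 2 + j) - (k : ℝ) = (ν + k + 1 + j) + 1 by ring,
        Gamma_add_one (by positivity)]
      congr 2
      ring
    simp only [U, W, hc, h1, h2, hℓ, Nat.add_sub_cancel, Nat.factorial_succ]
    push_cast
    rw [hG]
    have := (Gamma_pos_of_pos hν).ne'
    field_simp
    ring
  have hlast : U (ℓ / 2) = 0 := by
    have : ℓ - 2 * (ℓ / 2) = 0 ∨ ℓ - 2 * (ℓ / 2) = 1 := by omega
    rcases this with h | h <;> simp [U, h]
  have hsum : ∑ k ∈ Finset.range (ℓ / 2 + 1), (U k + W k) = 0 := by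
    rw [Finset.sum_add_distrib, Finset.sum_range_succ, Finset.sum_range_succ' W, hlast,
      show W 0 = 0 by simp [W]]
    have := Finset.sum_eq_zero hcancel
    rw [Finset.sum_add_distrib] at this
    linarith
  rw [← Finset.sum_congr rfl hsplit, Finset.sum_add_distrib, Finset.sum_sub_distrib,
    ← Finset.mul_sum, ← Finset.mul_sum, ← Finset.mul_sum] at hsum
  simp only [hp, Polynomial.derivative_sum, Polynomial.derivative_C_mul_X_pow,
    Polynomial.eval_finsetSum, Polynomial.eval_add, Polynomial.eval_sub, Polynomial.eval_mul,
    Polynomial.eval_C, Polynomial.eval_X, Polynomial.eval_pow, Polynomial.eval_one,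
    Polynomial.eval_zero]
  exact hsum

theorem gegenbauerC_one_succ {ν : ℝ} (hν : 0 < ν) (ℓ : ℕ) :
    (ℓ + 1) * (ℓ + 1 + 2 * ν) * gegenbauerC ν (ℓ + 1) 1 =
      (2 * ν + 1) * (2 * ν) * gegenbauerC (ν + 1) ℓ 1 := by
  have h := congrArg (Polynomial.eval 1) (gegenbauerPoly_differential_eq hν (ℓ + 1))
  rw [derivative_gegenbauerPoly_succ hν] at h
  simp only [Polynomial.eval_add, Polynomial.eval_sub, Polynomial.eval_mul, Polynomial.eval_C,
    Polynomial.eval_X, Polynomial.eval_pow, Polynomial.eval_one, Polynomial.eval_zero,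
    eval_gegenbauerPoly] at h
  push_cast at h
  linear_combination h

theorem gegenbauerC_one_pos {ν : ℝ} (hν : 0 < ν) (ℓ : ℕ) : 0 < gegenbauerC ν ℓ 1 := by
  induction ℓ generalizing ν with
  | zero => simp [← eval_gegenbauerPoly, gegenbauerPoly_zero hν]
  | succ ℓ ih =>
    have h := gegenbauerC_one_succ hν ℓ
    have h1 : 0 < (2 * ν + 1) * (2 * ν) * gegenbauerC (ν + 1) ℓ 1 :=
      mul_pos (by positivity) (ih (by positivity))
    rw [← h] at h1
    exact pos_of_mul_pos_right h1 (by positivity)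

/-- The integral of a polynomial against the Gegenbauer weight `(1 - t ^ 2) ^ (ν - 1 / 2)`. -/
def gegenbauerIntegral (ν : ℝ) (p : Polynomial ℝ) : ℝ :=
  ∫ t in (-1 : ℝ)..1, p.eval t * (1 - t ^ 2) ^ (ν - 1 / 2)

theorem continuous_gegenbauerWeight {ν : ℝ} (hν : 1 / 2 ≤ ν) :
    Continuous fun t : ℝ => (1 - t ^ 2) ^ (ν - 1 / 2) :=
  (by fun_prop : Continuous fun t : ℝ => 1 - t ^ 2).rpow_const fun _ => Or.inr (by linarith)

theorem intervalIntegrable_eval_mul_gegenbauerWeight {ν : ℝ} (hν : 1 / 2 ≤ ν)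
    (p : Polynomial ℝ) :
    IntervalIntegrable (fun t : ℝ => p.eval t * (1 - t ^ 2) ^ (ν - 1 / 2)) volume (-1) 1 :=
  (p.continuous.mul (continuous_gegenbauerWeight hν)).intervalIntegrable _ _

theorem gegenbauerIntegral_add {ν : ℝ} (hν : 1 / 2 ≤ ν) (p q : Polynomial ℝ) :
    gegenbauerIntegral ν (p + q) = gegenbauerIntegral ν p + gegenbauerIntegral ν q := by
  simp only [gegenbauerIntegral, Polynomial.eval_add, add_mul]
  exact intervalIntegral.integral_add (intervalIntegrable_eval_mul_gegenbauerWeight hν p)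
    (intervalIntegrable_eval_mul_gegenbauerWeight hν q)

theorem gegenbauerIntegral_C_mul (ν c : ℝ) (p : Polynomial ℝ) :
    gegenbauerIntegral ν (Polynomial.C c * p) = c * gegenbauerIntegral ν p := by
  simp only [gegenbauerIntegral, Polynomial.eval_mul, Polynomial.eval_C, mul_assoc,
    intervalIntegral.integral_const_mul]

theorem gegenbauerWeight_succ {ν t : ℝ} (hν : 1 / 2 ≤ ν) (ht : t ∈ Set.Icc (-1 : ℝ) 1) :
    (1 - t ^ 2) ^ (ν + 1 / 2) = (1 - t ^ 2) * (1 - t ^ 2) ^ (ν - 1 / 2) := by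
  have h0 : 0 ≤ 1 - t ^ 2 := by nlinarith [ht.1, ht.2]
  rw [show ν + 1 / 2 = 1 + (ν - 1 / 2) by ring, rpow_add_of_nonneg h0 zero_le_one (by linarith),
    rpow_one]

theorem gegenbauerIntegral_one_sub_sq_mul {ν : ℝ} (hν : 1 / 2 ≤ ν) (p : Polynomial ℝ) :
    gegenbauerIntegral ν ((1 - Polynomial.X ^ 2) * p) = gegenbauerIntegral (ν + 1) p := by
  refine intervalIntegral.integral_congr fun t ht => ?_
  rw [Set.uIcc_of_le (by norm_num)] at ht
  simp only [Polynomial.eval_mul, Polynomial.eval_sub, Polynomial.eval_one, Polynomial.eval_pow,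
    Polynomial.eval_X]
  rw [show ν + 1 - 1 / 2 = ν + 1 / 2 by ring, gegenbauerWeight_succ hν ht]
  ring

theorem gegenbauerIntegral_divergence {ν : ℝ} (hν : 1 / 2 ≤ ν) (q : Polynomial ℝ) :
    gegenbauerIntegral ν ((1 - Polynomial.X ^ 2) * Polynomial.derivative q -
      Polynomial.C (2 * ν + 1) * Polynomial.X * q) = 0 := by
  have hd (t : ℝ) : HasDerivAt (fun t : ℝ => q.eval t * (1 - t ^ 2) ^ (ν + 1 / 2))
      ((Polynomial.derivative q).eval t * (1 - t ^ 2) ^ (ν + 1 / 2) +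
        q.eval t * (-(2 * t) * (ν + 1 / 2) * (1 - t ^ 2) ^ (ν - 1 / 2))) t := by
    have h1 : HasDerivAt (fun t : ℝ => 1 - t ^ 2) (-(2 * t)) t := by
      simpa using (hasDerivAt_pow 2 t).const_sub 1
    have h2 := h1.rpow_const (p := ν + 1 / 2) (Or.inr (by linarith))
    rw [show ν + 1 / 2 - 1 = ν - 1 / 2 by ring] at h2
    exact (q.hasDerivAt t).mul h2
  have hc := continuous_gegenbauerWeight hν
  have hc' : Continuous fun t : ℝ => (1 - t ^ 2) ^ (ν + 1 / 2) := by
    simpa only [show ν + 1 - 1 / 2 = ν + 1 / 2 by ring] using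
      continuous_gegenbauerWeight (ν := ν + 1) (by linarith)
  have hint := intervalIntegral.integral_eq_sub_of_hasDerivAt (a := -1) (b := 1)
    (fun t _ => hd t) (Continuous.intervalIntegrable (by fun_prop) _ _)
  have hz : (0 : ℝ) ^ (ν + 1 / 2) = 0 := zero_rpow (by linarith)
  norm_num [hz] at hint
  rw [← hint]
  refine intervalIntegral.integral_congr fun t ht => ?_
  rw [Set.uIcc_of_le (by norm_num)] at ht
  have hw := gegenbauerWeight_succ hν ht
  simp only [one_div] at hw
  simp only [Polynomial.eval_mul, Polynomial.eval_sub, Polynomial.eval_one, Polynomial.eval_pow,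
    Polynomial.eval_X, Polynomial.eval_C, one_div]
  rw [hw]
  ring

theorem gegenbauerIntegral_pow_mul_derivative {ν : ℝ} (hν : 1 / 2 ≤ ν) (ℓ m : ℕ) :
    gegenbauerIntegral ν (Polynomial.C (m : ℝ) * Polynomial.X ^ (m - 1) * (1 - Polynomial.X ^ 2) *
        Polynomial.derivative (gegenbauerPoly ν ℓ)) =
      ℓ * (ℓ + 2 * ν) * gegenbauerIntegral ν (Polynomial.X ^ m * gegenbauerPoly ν ℓ) := by
  have h := gegenbauerIntegral_divergence hν
    (Polynomial.X ^ m * Polynomial.derivative (gegenbauerPoly ν ℓ))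
  have hode := gegenbauerPoly_differential_eq (ν := ν) (by linarith) ℓ
  rw [show (1 - Polynomial.X ^ 2) * Polynomial.derivative
      (Polynomial.X ^ m * Polynomial.derivative (gegenbauerPoly ν ℓ)) -
      Polynomial.C (2 * ν + 1) * Polynomial.X *
        (Polynomial.X ^ m * Polynomial.derivative (gegenbauerPoly ν ℓ)) =
      Polynomial.C (m : ℝ) * Polynomial.X ^ (m - 1) * (1 - Polynomial.X ^ 2) *
        Polynomial.derivative (gegenbauerPoly ν ℓ) +
      Polynomial.C (-(ℓ * (ℓ + 2 * ν))) * (Polynomial.X ^ m * gegenbauerPoly ν ℓ) by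
    rw [Polynomial.derivative_mul, Polynomial.derivative_X_pow, Polynomial.C_neg]
    linear_combination Polynomial.X ^ m * hode, gegenbauerIntegral_add hν,
    gegenbauerIntegral_C_mul] at h
  linarith

theorem gegenbauerIntegral_pow_mul_recurrence {ν : ℝ} (hν : 1 / 2 ≤ ν) (ℓ m : ℕ) :
    ((m : ℝ) - ℓ) * (m + ℓ + 2 * ν) *
        gegenbauerIntegral ν (Polynomial.X ^ m * gegenbauerPoly ν ℓ) =
      m * (m - 1) * gegenbauerIntegral ν (Polynomial.X ^ (m - 2) * gegenbauerPoly ν ℓ) := by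
  have h := gegenbauerIntegral_divergence hν
    (Polynomial.C (m : ℝ) * Polynomial.X ^ (m - 1) * gegenbauerPoly ν ℓ)
  have hD := gegenbauerIntegral_pow_mul_derivative hν ℓ m
  rw [show (1 - Polynomial.X ^ 2) * Polynomial.derivative
      (Polynomial.C (m : ℝ) * Polynomial.X ^ (m - 1) * gegenbauerPoly ν ℓ) -
      Polynomial.C (2 * ν + 1) * Polynomial.X *
        (Polynomial.C (m : ℝ) * Polynomial.X ^ (m - 1) * gegenbauerPoly ν ℓ) =
      Polynomial.C (m : ℝ) * Polynomial.X ^ (m - 1) * (1 - Polynomial.X ^ 2) *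
        Polynomial.derivative (gegenbauerPoly ν ℓ) +
      (Polynomial.C ((m : ℝ) * (m - 1)) * (Polynomial.X ^ (m - 2) * gegenbauerPoly ν ℓ) +
      Polynomial.C (-((m : ℝ) * (m + 2 * ν))) * (Polynomial.X ^ m * gegenbauerPoly ν ℓ)) by
    rcases m with _ | _ | m
    · simp
    · simp
      ring
    · simp
      ring, gegenbauerIntegral_add hν, gegenbauerIntegral_add hν,
    gegenbauerIntegral_C_mul, gegenbauerIntegral_C_mul, hD] at h
  linarith

theorem integral_gegenbauerWeight {ν : ℝ} (hν : 0 < ν) :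
    (∫ t in (-1 : ℝ)..1, (1 - t ^ 2) ^ (ν - 1 / 2)) * Gamma (ν + 1) = √π * Gamma (ν + 1 / 2) := by
  have hs : 0 < ν + 1 / 2 := by linarith
  have hbeta : ∫ u in (0 : ℝ)..1, u ^ (ν - 1 / 2) * (1 - u) ^ (ν - 1 / 2) =
      Gamma (ν + 1 / 2) * Gamma (ν + 1 / 2) / Gamma (2 * ν + 1) := by
    have h := ProbabilityTheory.beta_eq_betaIntegralReal _ _ hs hs
    rw [ProbabilityTheory.beta, show ν + 1 / 2 + (ν + 1 / 2) = 2 * ν + 1 by ring] at h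
    rw [h, Complex.betaIntegral, ← Complex.ofReal_re (∫ u in (0 : ℝ)..1, _),
      ← intervalIntegral.integral_ofReal]
    congr 1
    refine intervalIntegral.integral_congr fun u hu => ?_
    rw [Set.uIcc_of_le zero_le_one] at hu
    have h1 : ((ν + 1 / 2 : ℝ) : ℂ) - 1 = ((ν - 1 / 2 : ℝ) : ℂ) := by
      push_cast
      ring
    simp only [h1]
    rw [Complex.ofReal_mul, Complex.ofReal_cpow hu.1, Complex.ofReal_cpow (sub_nonneg.mpr hu.2)]
    push_cast
    rfl
  have hsub : ∫ t in (-1 : ℝ)..1, (1 - t ^ 2) ^ (ν - 1 / 2) =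
      2 * (4 ^ (ν - 1 / 2) * ∫ u in (0 : ℝ)..1, u ^ (ν - 1 / 2) * (1 - u) ^ (ν - 1 / 2)) := by
    have h := intervalIntegral.smul_integral_comp_mul_sub (E := ℝ) (a := 0) (b := 1)
      (fun t : ℝ => (1 - t ^ 2) ^ (ν - 1 / 2)) 2 1
    rw [show (2 : ℝ) * 0 - 1 = -1 by norm_num, show (2 : ℝ) * 1 - 1 = 1 by norm_num,
      smul_eq_mul] at h
    rw [← h, ← intervalIntegral.integral_const_mul (4 ^ (ν - 1 / 2))]
    refine congrArg ((2 : ℝ) * ·) (intervalIntegral.integral_congr fun u hu => ?_)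
    rw [Set.uIcc_of_le zero_le_one] at hu
    rw [← mul_rpow hu.1 (sub_nonneg.mpr hu.2),
      ← mul_rpow (by norm_num) (mul_nonneg hu.1 (sub_nonneg.mpr hu.2))]
    congr 1
    ring
  have hdup := Gamma_mul_Gamma_add_half (ν + 1 / 2)
  rw [show ν + 1 / 2 + 1 / 2 = ν + 1 by ring, show 2 * (ν + 1 / 2) = 2 * ν + 1 by ring,
    show 1 - (2 * ν + 1) = -(2 * ν) by ring, rpow_neg two_pos.le] at hdup
  have h4 : 2 * (4 : ℝ) ^ (ν - 1 / 2) = 2 ^ (2 * ν) := by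
    rw [show (4 : ℝ) = 2 ^ (2 : ℝ) by norm_num, ← rpow_mul two_pos.le,
      show 2 * (ν - 1 / 2) = 2 * ν - 1 by ring, rpow_sub_one two_ne_zero]
    ring
  have h2 : (0 : ℝ) < 2 ^ (2 * ν) := rpow_pos_of_pos two_pos _
  have hG : 0 < Gamma (2 * ν + 1) := Gamma_pos_of_pos (by linarith)
  rw [hsub, ← mul_assoc, h4, hbeta]
  field_simp at hdup ⊢
  linear_combination hdup

theorem gegenbauerIntegral_pow_degree_mul {ν : ℝ} (hν : 1 / 2 ≤ ν) (ℓ : ℕ) :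
    2 ^ ℓ * Gamma (ℓ + ν + 1) * gegenbauerIntegral ν (Polynomial.X ^ ℓ * gegenbauerPoly ν ℓ) =
      ℓ.factorial * √π * Gamma (ν + 1 / 2) * gegenbauerC ν ℓ 1 := by
  induction ℓ generalizing ν with
  | zero =>
    have h := integral_gegenbauerWeight (ν := ν) (by linarith)
    simp only [← eval_gegenbauerPoly, gegenbauerPoly_zero (show 0 < ν by linarith),
      gegenbauerIntegral, pow_zero, mul_one, Polynomial.eval_one, one_mul, Nat.cast_zero, zero_add,
      Nat.factorial_zero, Nat.cast_one]
    linear_combination h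
  | succ ℓ ih =>
    have hν0 : 0 < ν := by linarith
    have hD := gegenbauerIntegral_pow_mul_derivative hν (ℓ + 1) (ℓ + 1)
    rw [derivative_gegenbauerPoly_succ hν0, Nat.add_sub_cancel,
      show Polynomial.C ((ℓ + 1 : ℕ) : ℝ) * Polynomial.X ^ ℓ * (1 - Polynomial.X ^ 2) *
          (Polynomial.C (2 * ν) * gegenbauerPoly (ν + 1) ℓ) =
        Polynomial.C (((ℓ + 1 : ℕ) : ℝ) * (2 * ν)) * ((1 - Polynomial.X ^ 2) *
          (Polynomial.X ^ ℓ * gegenbauerPoly (ν + 1) ℓ)) by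
        simp only [Polynomial.C_mul]
        ring,
      gegenbauerIntegral_C_mul, gegenbauerIntegral_one_sub_sq_mul hν] at hD
    have h1 := gegenbauerC_one_succ hν0 ℓ
    have hi := ih (ν := ν + 1) (by linarith)
    rw [show ν + 1 + 1 / 2 = ν + 1 / 2 + 1 by ring,
      Gamma_add_one (s := ν + 1 / 2) (by linarith),
      show (ℓ : ℝ) + (ν + 1) + 1 = ℓ + 1 + ν + 1 by ring] at hi
    rw [Nat.factorial_succ]
    push_cast at hD ⊢
    have h0 : (ℓ + 1 : ℝ) * (ℓ + 1 + 2 * ν) ≠ 0 := by positivity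
    refine mul_left_cancel₀ h0 ?_
    linear_combination -2 ^ (ℓ + 1) * Gamma (ℓ + 1 + ν + 1) * hD + 4 * ν * (ℓ + 1) * hi -
      (ℓ + 1) * ℓ.factorial * √π * Gamma (ν + 1 / 2) * h1

/-- The value of the eigenvalue on monomials: the Funk-Hecke formula for `h t = t ^ m`. -/
theorem sphereMoment_eq {n ℓ : ℕ} (hn : 3 ≤ n) {ν : ℝ} (hν : ν = ((n : ℝ) - 2) / 2)
    (x : Fin n → ℝ) (hx : ∑ i, x i ^ 2 = 1) {P : MvPolynomial (Fin n) ℝ}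
    (hP : P.IsHomogeneous ℓ) (hPharm : polyLaplacian P = 0) (m : ℕ) :
    sphereMoment x P m = ((sphereMeasure (n - 1)) Set.univ).toReal / gegenbauerC ν ℓ 1 *
      gegenbauerIntegral ν (Polynomial.X ^ m * gegenbauerPoly ν ℓ) * MvPolynomial.eval x P := by
  have hn3 : (3 : ℝ) ≤ n := by exact_mod_cast hn
  have hν2 : 1 / 2 ≤ ν := by linarith
  induction m using Nat.strong_induction_on with
  | _ m ih =>
    rcases eq_or_ne m ℓ with rfl | hm
    · have h1 := sphereMoment_degree (by omega) x hP hPharm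
      have h2 := gegenbauerIntegral_pow_degree_mul hν2 m
      have h3 := sphereMeasure_univ_mul_Gamma (n := n - 1) (by omega)
      have hC := gegenbauerC_one_pos (ν := ν) (by linarith) m
      have hG : 0 < Gamma (m + (n : ℝ) / 2) := Gamma_pos_of_pos (by positivity)
      rw [Nat.cast_sub (by omega), Nat.cast_one,
        show ((n : ℝ) - 1) / 2 = ν + 1 / 2 by rw [hν]; ring] at h3
      rw [show (m : ℝ) + ν + 1 = m + (n : ℝ) / 2 by rw [hν]; ring] at h2
      rw [show (n : ℝ) / 2 = (ν + 1 / 2) + 1 / 2 by rw [hν]; ring] at h1 h2 hG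
      rw [rpow_add pi_pos, ← sqrt_eq_rpow] at h1
      have h0 : 2 ^ m * Gamma (m + (ν + 1 / 2 + 1 / 2)) * gegenbauerC ν m 1 ≠ 0 := by positivity
      refine mul_left_cancel₀ h0 ?_
      rw [div_mul_eq_mul_div, div_mul_eq_mul_div, mul_div_assoc', eq_div_iff hC.ne']
      linear_combination gegenbauerC ν m 1 ^ 2 * h1 -
        ((sphereMeasure (n - 1)) Set.univ).toReal * MvPolynomial.eval x P * gegenbauerC ν m 1 * h2 -
        m.factorial * √π * gegenbauerC ν m 1 ^ 2 * MvPolynomial.eval x P * h3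
    · have h1 := sphereMoment_recurrence (by omega) x hx hP hPharm m
      have h2 := gegenbauerIntegral_pow_mul_recurrence hν2 ℓ m
      have h0 : ((m : ℝ) - ℓ) * (m + ℓ + n - 2) ≠ 0 := by
        refine mul_ne_zero (sub_ne_zero.mpr (by exact_mod_cast hm)) (ne_of_gt ?_)
        have := Nat.cast_nonneg (α := ℝ) m
        have := Nat.cast_nonneg (α := ℝ) ℓ
        linarith
      rw [show (m : ℝ) + ℓ + 2 * ν = m + ℓ + n - 2 by rw [hν]; ring] at h2
      refine mul_left_cancel₀ h0 ?_
      set K := ((sphereMeasure (n - 1)) Set.univ).toReal / gegenbauerC ν ℓ 1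
      rcases lt_or_ge m 2 with hlt | hge
      · have hz : (m : ℝ) * (m - 1) = 0 := by interval_cases m <;> simp
        rw [hz, zero_mul] at h1 h2
        linear_combination h1 - K * MvPolynomial.eval x P * h2
      · rw [ih (m - 2) (by omega)] at h1
        linear_combination h1 - K * MvPolynomial.eval x P * h2

instance isFiniteMeasure_sphereMeasure (n : ℕ) : IsFiniteMeasure (sphereMeasure n) := by
  unfold sphereMeasure
  infer_instance

theorem continuous_eval_sphere {n : ℕ} (F : MvPolynomial (Fin n) ℝ) :
    Continuous fun y : Metric.sphere (0 : EuclideanSpace ℝ (Fin n)) 1 =>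
      MvPolynomial.eval (fun i => (y : EuclideanSpace ℝ (Fin n)) i) F :=
  (MvPolynomial.continuous_eval F).comp (by fun_prop)

theorem integrable_sphere {n : ℕ} {E : Type*} [NormedAddCommGroup E]
    {f : Metric.sphere (0 : EuclideanSpace ℝ (Fin n)) 1 → E} (hf : Continuous f) :
    Integrable f (sphereMeasure n) :=
  hf.integrable_of_hasCompactSupport (HasCompactSupport.of_compactSpace f)

theorem inner_mem_Icc {n : ℕ} (x y : Metric.sphere (0 : EuclideanSpace ℝ (Fin n)) 1) :
    ⟪(x : EuclideanSpace ℝ (Fin n)), (y : EuclideanSpace ℝ (Fin n))⟫ ∈ Set.Icc (-1 : ℝ) 1 := by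
  have h := abs_real_inner_le_norm (x : EuclideanSpace ℝ (Fin n)) (y : EuclideanSpace ℝ (Fin n))
  rw [norm_eq_of_mem_sphere, norm_eq_of_mem_sphere, one_mul] at h
  exact abs_le.mp h

theorem continuous_comp_inner {n : ℕ} {E : Type*} [TopologicalSpace E] {f : ℝ → E}
    (hf : ContinuousOn f (Set.Icc (-1 : ℝ) 1))
    (x : Metric.sphere (0 : EuclideanSpace ℝ (Fin n)) 1) :
    Continuous fun y : Metric.sphere (0 : EuclideanSpace ℝ (Fin n)) 1 =>
      f ⟪(x : EuclideanSpace ℝ (Fin n)), (y : EuclideanSpace ℝ (Fin n))⟫ :=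
  hf.comp_continuous (by fun_prop) fun y => inner_mem_Icc x y

/-- The Funk-Hecke formula for polynomials. -/
theorem integral_sphere_polynomial {n ℓ : ℕ} (hn : 3 ≤ n) {ν : ℝ} (hν : ν = ((n : ℝ) - 2) / 2)
    {P : MvPolynomial (Fin n) ℝ} (hP : P.IsHomogeneous ℓ) (hPharm : polyLaplacian P = 0)
    (x : Metric.sphere (0 : EuclideanSpace ℝ (Fin n)) 1) (p : Polynomial ℝ) :
    ∫ y : Metric.sphere (0 : EuclideanSpace ℝ (Fin n)) 1,
        p.eval ⟪(x : EuclideanSpace ℝ (Fin n)), (y : EuclideanSpace ℝ (Fin n))⟫ *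
          MvPolynomial.eval (fun i => (y : EuclideanSpace ℝ (Fin n)) i) P ∂(sphereMeasure n) =
      ((sphereMeasure (n - 1)) Set.univ).toReal / gegenbauerC ν ℓ 1 *
        gegenbauerIntegral ν (p * gegenbauerPoly ν ℓ) *
        MvPolynomial.eval (fun i => (x : EuclideanSpace ℝ (Fin n)) i) P := by
  have hn3 : (3 : ℝ) ≤ n := by exact_mod_cast hn
  have hν2 : 1 / 2 ≤ ν := by linarith
  have hx : ∑ i, (x : EuclideanSpace ℝ (Fin n)) i ^ 2 = 1 := by
    rw [← EuclideanSpace.real_norm_sq_eq, norm_eq_of_mem_sphere, one_pow]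
  have hinner (y : EuclideanSpace ℝ (Fin n)) :
      ⟪(x : EuclideanSpace ℝ (Fin n)), y⟫ = ∑ i, (x : EuclideanSpace ℝ (Fin n)) i * y i := by
    simp [PiLp.inner_apply, mul_comm]
  induction p using Polynomial.induction_on' with
  | add p q hp hq =>
    have hi (r : Polynomial ℝ) : Integrable
        (fun y : Metric.sphere (0 : EuclideanSpace ℝ (Fin n)) 1 =>
          r.eval ⟪(x : EuclideanSpace ℝ (Fin n)), (y : EuclideanSpace ℝ (Fin n))⟫ *
          MvPolynomial.eval (fun i => (y : EuclideanSpace ℝ (Fin n)) i) P) (sphereMeasure n) :=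
      integrable_sphere
        ((continuous_comp_inner r.continuous.continuousOn x).mul (continuous_eval_sphere P))
    simp only [Polynomial.eval_add, add_mul]
    rw [integral_add (hi p) (hi q), hp, hq, gegenbauerIntegral_add hν2]
    ring
  | monomial m c =>
    have h := sphereMoment_eq hn hν (fun i => (x : EuclideanSpace ℝ (Fin n)) i) hx hP hPharm m
    rw [sphereMoment] at h
    simp only [MvPolynomial.eval_mul, MvPolynomial.eval_pow, eval_linearForm] at h
    rw [← Polynomial.C_mul_X_pow_eq_monomial, mul_assoc (Polynomial.C c), gegenbauerIntegral_C_mul]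
    simp only [Polynomial.eval_mul, Polynomial.eval_C, Polynomial.eval_pow, Polynomial.eval_X,
      mul_assoc c, integral_const_mul, hinner]
    rw [h]
    ring

/-- The Funk-Hecke formula for real-valued continuous functions. -/
theorem integral_sphere_real {n ℓ : ℕ} (hn : 3 ≤ n) {ν : ℝ} (hν : ν = ((n : ℝ) - 2) / 2)
    {P : MvPolynomial (Fin n) ℝ} (hP : P.IsHomogeneous ℓ) (hPharm : polyLaplacian P = 0)
    (x : Metric.sphere (0 : EuclideanSpace ℝ (Fin n)) 1) {f : ℝ → ℝ}
    (hf : ContinuousOn f (Set.Icc (-1 : ℝ) 1)) :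
    ∫ y : Metric.sphere (0 : EuclideanSpace ℝ (Fin n)) 1,
        f ⟪(x : EuclideanSpace ℝ (Fin n)), (y : EuclideanSpace ℝ (Fin n))⟫ *
          MvPolynomial.eval (fun i => (y : EuclideanSpace ℝ (Fin n)) i) P ∂(sphereMeasure n) =
      ((sphereMeasure (n - 1)) Set.univ).toReal / gegenbauerC ν ℓ 1 *
        (∫ t in (-1 : ℝ)..1, f t * (gegenbauerC ν ℓ t * (1 - t ^ 2) ^ (ν - 1 / 2))) *
        MvPolynomial.eval (fun i => (x : EuclideanSpace ℝ (Fin n)) i) P := by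
  have hn3 : (3 : ℝ) ≤ n := by exact_mod_cast hn
  have hν2 : 1 / 2 ≤ ν := by linarith
  set K := ((sphereMeasure (n - 1)) Set.univ).toReal / gegenbauerC ν ℓ 1
  set Q : Metric.sphere (0 : EuclideanSpace ℝ (Fin n)) 1 → ℝ :=
    fun y => MvPolynomial.eval (fun i => (y : EuclideanSpace ℝ (Fin n)) i) P with hQ
  set w : ℝ → ℝ := fun t => gegenbauerC ν ℓ t * (1 - t ^ 2) ^ (ν - 1 / 2) with hw
  have hQc : Continuous Q := continuous_eval_sphere P
  have hwc : Continuous w := by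
    simp only [hw, ← eval_gegenbauerPoly]
    exact (Polynomial.continuous _).mul (continuous_gegenbauerWeight hν2)
  have h1 {g : ℝ → ℝ} (hg : ContinuousOn g (Set.Icc (-1 : ℝ) 1)) : Integrable
      (fun y : Metric.sphere (0 : EuclideanSpace ℝ (Fin n)) 1 =>
        g ⟪(x : EuclideanSpace ℝ (Fin n)), (y : EuclideanSpace ℝ (Fin n))⟫ * Q y)
      (sphereMeasure n) :=
    integrable_sphere ((continuous_comp_inner hg x).mul hQc)
  have h2 {g : ℝ → ℝ} (hg : ContinuousOn g (Set.Icc (-1 : ℝ) 1)) :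
      IntervalIntegrable (fun t => g t * w t) volume (-1) 1 := by
    refine ContinuousOn.intervalIntegrable ?_
    rw [Set.uIcc_of_le (by norm_num)]
    exact hg.mul hwc.continuousOn
  let A : ℝ := ∫ y, |Q y| ∂(sphereMeasure n)
  let B : ℝ := ∫ t in (-1 : ℝ)..1, |w t|
  refine eq_of_forall_dist_le fun δ hδ => ?_
  have hA : 0 ≤ A := integral_nonneg fun y => abs_nonneg _
  have hB : 0 ≤ B := intervalIntegral.integral_nonneg (by norm_num) fun t _ => abs_nonneg _
  have hD : 0 < A + |K| * B * |Q x| + 1 := by positivity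
  obtain ⟨p, hp⟩ := exists_polynomial_near_of_continuousOn (-1) 1 f hf
    (δ / (A + |K| * B * |Q x| + 1)) (by positivity)
  set ε := δ / (A + |K| * B * |Q x| + 1) with hε
  have hpoly := integral_sphere_polynomial hn hν hP hPharm x p
  have hpc : ContinuousOn (fun t => p.eval t) (Set.Icc (-1 : ℝ) 1) := p.continuous.continuousOn
  have hgi : gegenbauerIntegral ν (p * gegenbauerPoly ν ℓ) =
      ∫ t in (-1 : ℝ)..1, p.eval t * w t := by
    simp only [gegenbauerIntegral, Polynomial.eval_mul, eval_gegenbauerPoly, hw, mul_assoc]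
  rw [hgi] at hpoly
  have hL : |(∫ y, p.eval ⟪(x : EuclideanSpace ℝ (Fin n)), (y : EuclideanSpace ℝ (Fin n))⟫ * Q y
      ∂(sphereMeasure n)) -
      ∫ y, f ⟪(x : EuclideanSpace ℝ (Fin n)), (y : EuclideanSpace ℝ (Fin n))⟫ * Q y
        ∂(sphereMeasure n)| ≤ ε * A := by
    rw [← integral_sub (h1 hpc) (h1 hf), ← integral_const_mul, ← Real.norm_eq_abs]
    refine norm_integral_le_of_norm_le ((integrable_sphere hQc.abs).const_mul ε)
      (Filter.Eventually.of_forall fun y => ?_)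
    rw [← sub_mul, norm_mul, Real.norm_eq_abs, Real.norm_eq_abs]
    exact mul_le_mul_of_nonneg_right (hp _ (inner_mem_Icc x y)).le (abs_nonneg _)
  have hR : |(∫ t in (-1 : ℝ)..1, p.eval t * w t) - ∫ t in (-1 : ℝ)..1, f t * w t| ≤ ε * B := by
    rw [← intervalIntegral.integral_sub (h2 hpc) (h2 hf), ← intervalIntegral.integral_const_mul,
      ← Real.norm_eq_abs]
    refine intervalIntegral.norm_integral_le_of_norm_le (by norm_num)
      (Filter.Eventually.of_forall fun t ht => ?_)
      ((continuous_const.mul hwc.abs).intervalIntegrable _ _)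
    rw [← sub_mul, norm_mul, Real.norm_eq_abs, Real.norm_eq_abs]
    exact mul_le_mul_of_nonneg_right (hp _ (Set.Ioc_subset_Icc_self ht)).le (abs_nonneg _)
  have hR' : |K * (∫ t in (-1 : ℝ)..1, p.eval t * w t) * Q x -
      K * (∫ t in (-1 : ℝ)..1, f t * w t) * Q x| ≤ |K| * (ε * B) * |Q x| := by
    rw [← sub_mul, ← mul_sub, abs_mul, abs_mul]
    gcongr
  have hεD : ε * (A + |K| * B * |Q x| + 1) = δ := div_mul_cancel₀ _ hD.ne'
  have hε0 : 0 < ε := by positivity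
  rw [Real.dist_eq]
  rw [abs_le] at *
  rw [hpoly] at hL
  constructor <;> nlinarith [hL.1, hL.2, hR'.1, hR'.2]

theorem stmt1 (n : ℕ) (hn : 3 ≤ n) (ℓ : ℕ) (h : ℝ → ℂ)
    (hh : ContinuousOn h (Set.Icc (-1 : ℝ) 1))
    (ν : ℝ) (hν : ν = ((n : ℝ) - 2) / 2)
    (P : MvPolynomial (Fin n) ℝ) (hP : P.IsHomogeneous ℓ) (hPharm : polyLaplacian P = 0)
    (x : Metric.sphere (0 : EuclideanSpace ℝ (Fin n)) 1) :
    (∫ y : Metric.sphere (0 : EuclideanSpace ℝ (Fin n)) 1,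
        h ⟪(x : EuclideanSpace ℝ (Fin n)), (y : EuclideanSpace ℝ (Fin n))⟫ *
          ((MvPolynomial.eval (fun i => (y : EuclideanSpace ℝ (Fin n)) i) P : ℝ) : ℂ)
        ∂(sphereMeasure n))
      = ((((sphereMeasure (n - 1)) Set.univ).toReal / gegenbauerC ν ℓ 1 : ℝ) : ℂ)
          * (∫ t in (-1 : ℝ)..1, h t * ((gegenbauerC ν ℓ t * (1 - t ^ 2) ^ (ν - 1 / 2) : ℝ) : ℂ))
          * ((MvPolynomial.eval (fun i => (x : EuclideanSpace ℝ (Fin n)) i) P : ℝ) : ℂ) := by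
  have hn3 : (3 : ℝ) ≤ n := by exact_mod_cast hn
  have hν2 : 1 / 2 ≤ ν := by linarith
  have hre := integral_sphere_real hn hν hP hPharm x (Complex.continuous_re.comp_continuousOn hh)
  have him := integral_sphere_real hn hν hP hPharm x (Complex.continuous_im.comp_continuousOn hh)
  have hwc : Continuous fun t => gegenbauerC ν ℓ t * (1 - t ^ 2) ^ (ν - 1 / 2) := by
    simp only [← eval_gegenbauerPoly]
    exact (Polynomial.continuous _).mul (continuous_gegenbauerWeight hν2)
  have hi : Integrable (fun y : Metric.sphere (0 : EuclideanSpace ℝ (Fin n)) 1 =>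
      h ⟪(x : EuclideanSpace ℝ (Fin n)), (y : EuclideanSpace ℝ (Fin n))⟫ *
        ((MvPolynomial.eval (fun i => (y : EuclideanSpace ℝ (Fin n)) i) P : ℝ) : ℂ))
      (sphereMeasure n) :=
    integrable_sphere ((continuous_comp_inner hh x).mul
      (Complex.continuous_ofReal.comp (continuous_eval_sphere P)))
  have hj : IntervalIntegrable (fun t => h t *
      ((gegenbauerC ν ℓ t * (1 - t ^ 2) ^ (ν - 1 / 2) : ℝ) : ℂ)) volume (-1) 1 := by
    refine ContinuousOn.intervalIntegrable ?_
    rw [Set.uIcc_of_le (by norm_num)]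
    exact hh.mul (Complex.continuous_ofReal.comp hwc).continuousOn
  have hjre := Complex.reCLM.intervalIntegral_comp_comm hj
  have hjim := Complex.imCLM.intervalIntegral_comp_comm hj
  simp only [Complex.reCLM_apply, Complex.imCLM_apply, Complex.re_mul_ofReal,
    Complex.im_mul_ofReal] at hjre hjim
  have hire := Complex.reCLM.integral_comp_comm hi
  have hiim := Complex.imCLM.integral_comp_comm hi
  simp only [Complex.reCLM_apply, Complex.imCLM_apply, Complex.re_mul_ofReal,
    Complex.im_mul_ofReal] at hire hiim
  simp only [Function.comp_apply] at hre him
  refine Complex.ext ?_ ?_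
  · rw [Complex.re_mul_ofReal, Complex.re_ofReal_mul, ← hjre, ← hre]
    exact hire.symm
  · rw [Complex.im_mul_ofReal, Complex.im_ofReal_mul, ← hjim, ← him]
    exact hiim.symm
end
end

section
/- Let n ≥ 2 and set ν = (n−2)/2. Let f : ℝ^n → ℝ be smooth with Δf + f = 0 on ℝ^n, let K ⊂ ℝ^n be compact, let t ∈ ℕ, and let ε > 0. Then there exist N ∈ ℕ, homogeneous polynomials P_1, …, P_N of degrees ℓ_1, …, ℓ_N with ΔP_j = 0, and real constants c_1, …, c_N, such that the function g(x) = Σ_{j=1}^N c_j P_j(x) J_{ℓ_j+ν}(|x|)/|x|^{ℓ_j+ν} (extended smoothly across x = 0) satisfies ‖f − g‖_{C^t(K)} < ε. -/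
open MeasureTheory Real

noncomputable section

/-- The Euclidean Laplacian `Δf = Σᵢ ∂²f/∂xᵢ²` of a function on `ℝ^n`. -/
def laplacian {n : ℕ} (f : EuclideanSpace ℝ (Fin n) → ℝ) (x : EuclideanSpace ℝ (Fin n)) : ℝ :=
  ∑ i : Fin n,
    fderiv ℝ (fun y => fderiv ℝ f y (EuclideanSpace.single i 1)) x (EuclideanSpace.single i 1)

/-- The Bessel function of the first kind `J_μ`, via its power series. -/
def besselJ (μ : ℝ) (r : ℝ) : ℝ :=
  ∑' k : ℕ, ((-1 : ℝ) ^ k / (k.factorial * Real.Gamma (k + μ + 1))) * (r / 2) ^ (2 * (k : ℝ) + μ)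

/-- A smooth nonincreasing cutoff, equal to `1` on `(-∞, 0]` and to `0` on `[1, ∞)`. -/
def radialProfile (s : ℝ) : ℝ := Real.smoothTransition (1 - s)

lemma contDiff_radialProfile : ContDiff ℝ (⊤ : ℕ∞) radialProfile :=
  Real.smoothTransition.contDiff.comp (contDiff_const.sub contDiff_id)

lemma radialProfile_of_one_le {s : ℝ} (hs : 1 ≤ s) : radialProfile s = 0 :=
  Real.smoothTransition.zero_of_nonpos (by linarith)

lemma deriv_radialProfile_of_one_lt {s : ℝ} (hs : 1 < s) : deriv radialProfile s = 0 := by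
  have : radialProfile =ᶠ[nhds s] fun _ => 0 := by
    filter_upwards [lt_mem_nhds hs] with t ht using radialProfile_of_one_le ht.le
  rw [this.deriv_eq, deriv_const]

lemma deriv_radialProfile_nonpos (s : ℝ) : deriv radialProfile s ≤ 0 := by
  have : Antitone radialProfile := fun a b hab =>
    Real.smoothTransition.monotone (by linarith)
  exact this.deriv_nonpos

lemma exists_deriv_radialProfile_ne_zero : ∃ s : ℝ, 0 < s ∧ deriv radialProfile s ≠ 0 := by
  have hd : Differentiable ℝ radialProfile := contDiff_radialProfile.differentiable (by simp)
  obtain ⟨c, hc, h⟩ := exists_deriv_eq_slope radialProfile (zero_lt_one' ℝ)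
    hd.continuous.continuousOn hd.differentiableOn
  refine ⟨c, hc.1, ?_⟩
  rw [h, radialProfile_of_one_le le_rfl]
  simp [radialProfile, Real.smoothTransition.one_of_one_le]

/-- A compactly supported radial function `Φ` whose gradient is `y ↦ φ y • y`, with `∫ φ ≠ 0`. -/
lemma exists_radial_kernel (n : ℕ) (hn : 1 ≤ n) :
    ∃ Φ φ : EuclideanSpace ℝ (Fin n) → ℝ, ContDiff ℝ (⊤ : ℕ∞) Φ ∧ ContDiff ℝ (⊤ : ℕ∞) φ ∧
      HasCompactSupport Φ ∧ HasCompactSupport φ ∧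
      (∀ y, 1 < ‖y‖ → Φ y = 0) ∧ (∀ y, 1 < ‖y‖ → φ y = 0) ∧
      (∀ y w, fderiv ℝ Φ y w = φ y * inner ℝ y w) ∧ ∫ y, φ y ≠ 0 := by
  have hsq : ContDiff ℝ (⊤ : ℕ∞) fun y : EuclideanSpace ℝ (Fin n) => ‖y‖ ^ 2 := contDiff_norm_sq ℝ
  have hd : ContDiff ℝ (⊤ : ℕ∞) (deriv radialProfile) :=
    (contDiff_infty_iff_deriv.1 contDiff_radialProfile).2
  have h1 : ∀ y : EuclideanSpace ℝ (Fin n), 1 < ‖y‖ → 1 < ‖y‖ ^ 2 := fun y hy => by nlinarith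
  have hΦ0 : ∀ y : EuclideanSpace ℝ (Fin n), 1 < ‖y‖ → radialProfile (‖y‖ ^ 2) = 0 := fun y hy =>
    radialProfile_of_one_le (h1 y hy).le
  have hφ0 : ∀ y : EuclideanSpace ℝ (Fin n), 1 < ‖y‖ → 2 * deriv radialProfile (‖y‖ ^ 2) = 0 :=
    fun y hy => by rw [deriv_radialProfile_of_one_lt (h1 y hy), mul_zero]
  have hcs : ∀ g : EuclideanSpace ℝ (Fin n) → ℝ, (∀ y, 1 < ‖y‖ → g y = 0) → HasCompactSupport g :=
    fun g hg => HasCompactSupport.intro (isCompact_closedBall 0 1) fun y hy => hg y (by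
      simpa using hy)
  have hφ : ContDiff ℝ (⊤ : ℕ∞) fun y : EuclideanSpace ℝ (Fin n) =>
    2 * deriv radialProfile (‖y‖ ^ 2) := contDiff_const.mul (hd.comp hsq)
  refine ⟨fun y => radialProfile (‖y‖ ^ 2), fun y => 2 * deriv radialProfile (‖y‖ ^ 2),
    contDiff_radialProfile.comp hsq, hφ, hcs _ hΦ0, hcs _ hφ0, hΦ0, hφ0, ?_, ?_⟩
  · intro y w
    have hp : HasDerivAt radialProfile (deriv radialProfile (‖y‖ ^ 2)) (‖y‖ ^ 2) :=
      (contDiff_radialProfile.differentiable (by simp) _).hasDerivAt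
    have := hp.comp_hasFDerivAt y (hasStrictFDerivAt_norm_sq y).hasFDerivAt
    have h2 := this.fderiv
    simp only [Function.comp_def] at h2
    rw [h2]
    simp
    ring
  · obtain ⟨s, hs, hne⟩ := exists_deriv_radialProfile_ne_zero
    have key : 0 < ∫ y : EuclideanSpace ℝ (Fin n), -(2 * deriv radialProfile (‖y‖ ^ 2)) := by
      refine Continuous.integral_pos_of_hasCompactSupport_nonneg_nonzero
        (x := EuclideanSpace.single ⟨0, hn⟩ (√s)) hφ.continuous.neg
        (hcs _ fun y hy => by rw [hφ0 y hy, neg_zero]) (fun y => ?_) ?_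
      · have := deriv_radialProfile_nonpos (‖y‖ ^ 2)
        simp only [Pi.zero_apply]
        linarith
      · simp [Real.sq_sqrt hs.le, hne]
    rw [integral_neg] at key
    exact fun h => by simp [h] at key

lemma integrable_mul_of_hasCompactSupport {n : ℕ} {φ h : EuclideanSpace ℝ (Fin n) → ℝ}
    (hφ : Continuous φ) (hc : HasCompactSupport φ) (hh : Continuous h) :
    Integrable fun y => φ y * h y :=
  (hφ.mul hh).integrable_of_hasCompactSupport hc.mul_right

lemma integral_mul_fderiv_of_hasCompactSupport {n : ℕ} {φ h : EuclideanSpace ℝ (Fin n) → ℝ}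
    (hφ : ContDiff ℝ (⊤ : ℕ∞) φ) (hc : HasCompactSupport φ) (hh : ContDiff ℝ (⊤ : ℕ∞) h)
    (w : EuclideanSpace ℝ (Fin n)) :
    ∫ y, φ y * fderiv ℝ h y w = -∫ y, fderiv ℝ φ y w * h y := by
  have hcw : HasCompactSupport fun y => fderiv ℝ φ y w := hc.fderiv_apply (𝕜 := ℝ) w
  have c1 : Continuous fun y => fderiv ℝ φ y w :=
    (hφ.continuous_fderiv (by simp)).clm_apply continuous_const
  have c2 : Continuous fun y => fderiv ℝ h y w :=
    (hh.continuous_fderiv (by simp)).clm_apply continuous_const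
  exact integral_mul_fderiv_eq_neg_fderiv_mul_of_integrable
    (integrable_mul_of_hasCompactSupport c1 hcw hh.continuous)
    (integrable_mul_of_hasCompactSupport hφ.continuous hc c2)
    (integrable_mul_of_hasCompactSupport hφ.continuous hc hh.continuous)
    (fun y _ => hφ.differentiable (by simp) y) (fun y _ => hh.differentiable (by simp) y)

lemma fderiv_comp_add_smul {n : ℕ} {h : EuclideanSpace ℝ (Fin n) → ℝ}
    (hh : ContDiff ℝ (⊤ : ℕ∞) h) (x : EuclideanSpace ℝ (Fin n)) (r : ℝ)
    (y w : EuclideanSpace ℝ (Fin n)) :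
    fderiv ℝ (fun y => h (x + r • y)) y w = r * fderiv ℝ h (x + r • y) w := by
  have h1 : HasFDerivAt (fun y : EuclideanSpace ℝ (Fin n) => x + r • y)
      (r • ContinuousLinearMap.id ℝ (EuclideanSpace ℝ (Fin n))) y :=
    ((hasFDerivAt_id y).const_smul r).const_add x
  have h2 := ((hh.differentiable (by simp) (x + r • y)).hasFDerivAt.comp y h1).fderiv
  simp only [Function.comp_def] at h2
  rw [h2]
  simp

lemma contDiff_comp_add_smul {n : ℕ} {h : EuclideanSpace ℝ (Fin n) → ℝ}
    (hh : ContDiff ℝ (⊤ : ℕ∞) h) (x : EuclideanSpace ℝ (Fin n)) (r : ℝ) :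
    ContDiff ℝ (⊤ : ℕ∞) fun y => h (x + r • y) :=
  hh.comp (contDiff_const.add (contDiff_id.const_smul r))

lemma contDiff_fderiv_apply_const {n : ℕ} {h : EuclideanSpace ℝ (Fin n) → ℝ}
    (hh : ContDiff ℝ (⊤ : ℕ∞) h) (w : EuclideanSpace ℝ (Fin n)) :
    ContDiff ℝ (⊤ : ℕ∞) fun y => fderiv ℝ h y w :=
  (hh.fderiv_right (by simp)).clm_apply contDiff_const

lemma hasDerivAt_integral_mul_comp_add_smul {n : ℕ} {φ v : EuclideanSpace ℝ (Fin n) → ℝ}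
    (hφ : Continuous φ) (hc : HasCompactSupport φ) (hv : ContDiff ℝ (⊤ : ℕ∞) v)
    (x : EuclideanSpace ℝ (Fin n)) (r : ℝ) :
    HasDerivAt (fun r : ℝ => ∫ y, φ y * v (x + r • y))
      (∫ y, φ y * fderiv ℝ v (x + r • y) y) r := by
  have hvc := hv.continuous_fderiv (by simp)
  have hcont : Continuous fun p : ℝ × EuclideanSpace ℝ (Fin n) =>
      φ p.2 * fderiv ℝ v (x + p.1 • p.2) p.2 := by
    refine (hφ.comp continuous_snd).mul ((hvc.comp ?_).clm_apply continuous_snd)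
    fun_prop
  have hK : IsCompact (Metric.closedBall r 1 ×ˢ tsupport φ) :=
    (isCompact_closedBall r 1).prod hc
  obtain ⟨C, hC⟩ := hK.exists_bound_of_continuousOn hcont.continuousOn
  refine (hasDerivAt_integral_of_dominated_loc_of_deriv_le
    (F' := fun r y => φ y * fderiv ℝ v (x + r • y) y)
    (bound := (tsupport φ).indicator fun _ => C) (Metric.closedBall_mem_nhds r one_pos)
    (Filter.Eventually.of_forall fun s => ?_) ?_ ?_ ?_ ?_ ?_).2
  · exact (hφ.mul (contDiff_comp_add_smul hv x s).continuous).aestronglyMeasurable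
  · exact integrable_mul_of_hasCompactSupport hφ hc (contDiff_comp_add_smul hv x r).continuous
  · exact (hcont.comp (Continuous.prodMk_right r)).aestronglyMeasurable
  · refine Filter.Eventually.of_forall fun y s hs => ?_
    by_cases hy : y ∈ tsupport φ
    · rw [Set.indicator_of_mem hy]
      exact hC (s, y) ⟨hs, hy⟩
    · rw [Set.indicator_of_notMem hy, image_eq_zero_of_notMem_tsupport hy]
      simp
  · exact (integrable_indicator_iff (isClosed_tsupport φ).measurableSet).2
      (integrableOn_const (hs := hc.measure_lt_top.ne))
  · refine Filter.Eventually.of_forall fun y s _ => HasDerivAt.const_mul _ ?_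
    have h1 : HasDerivAt (fun s : ℝ => x + s • y) y s := by
      simpa using ((hasDerivAt_id s).smul_const y).const_add x
    exact (hv.differentiable (by simp) (x + s • y)).hasFDerivAt.comp_hasDerivAt s h1

lemma integral_kernel_mul_fderiv_radial {n : ℕ} {Φ φ v : EuclideanSpace ℝ (Fin n) → ℝ}
    (hΦ : ContDiff ℝ (⊤ : ℕ∞) Φ) (hΦc : HasCompactSupport Φ)
    (hgrad : ∀ y w, fderiv ℝ Φ y w = φ y * inner ℝ y w) (hv : ContDiff ℝ (⊤ : ℕ∞) v)
    (x : EuclideanSpace ℝ (Fin n)) (r : ℝ) :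
    ∫ y, φ y * fderiv ℝ v (x + r • y) y = -(r * ∫ y, Φ y * laplacian v (x + r • y)) := by
  have hpart : ∀ i : Fin n, ContDiff ℝ (⊤ : ℕ∞) fun y => fderiv ℝ v y (EuclideanSpace.single i 1) :=
    fun i => contDiff_fderiv_apply_const hv _
  have e1 : ∀ y, φ y * fderiv ℝ v (x + r • y) y =
      ∑ i, fderiv ℝ Φ y (EuclideanSpace.single i 1) *
        fderiv ℝ v (x + r • y) (EuclideanSpace.single i 1) := by
    intro y
    have hy : y = ∑ i, y i • EuclideanSpace.single i (1 : ℝ) := by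
      ext j
      simp [Finset.sum_apply, Pi.single_apply]
    conv_lhs => rw [hy, map_sum, Finset.mul_sum]
    refine Finset.sum_congr rfl fun i _ => ?_
    rw [hgrad, EuclideanSpace.inner_single_right, map_smul, ← hy]
    simp
    ring
  have c1 : ∀ i : Fin n, Continuous fun y => fderiv ℝ Φ y (EuclideanSpace.single i 1) := fun i =>
    (contDiff_fderiv_apply_const hΦ _).continuous
  have e2 : ∀ i : Fin n, ∫ y, fderiv ℝ Φ y (EuclideanSpace.single i 1) *
        fderiv ℝ v (x + r • y) (EuclideanSpace.single i 1) =
      -∫ y, Φ y * (r * fderiv ℝ (fun z => fderiv ℝ v z (EuclideanSpace.single i 1)) (x + r • y)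
        (EuclideanSpace.single i 1)) := by
    intro i
    have := integral_mul_fderiv_of_hasCompactSupport hΦ hΦc
      (contDiff_comp_add_smul (hpart i) x r) (EuclideanSpace.single i 1)
    simp only [fderiv_comp_add_smul (hpart i)] at this
    rw [this, neg_neg]
  simp only [e1]
  rw [integral_finsetSum]
  · simp only [e2]
    rw [Finset.sum_neg_distrib, ← integral_finsetSum, ← integral_const_mul]
    · congr 2
      ext y
      rw [laplacian, Finset.mul_sum, Finset.mul_sum]
      exact Finset.sum_congr rfl fun i _ => by ring
    · intro i _
      exact integrable_mul_of_hasCompactSupport hΦ.continuous hΦc (continuous_const.mul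
        (contDiff_comp_add_smul (contDiff_fderiv_apply_const (hpart i) _) x r).continuous)
  · intro i _
    exact integrable_mul_of_hasCompactSupport (c1 i) (hΦc.fderiv_apply (𝕜 := ℝ) _)
      (contDiff_comp_add_smul (hpart i) x r).continuous

lemma abs_integral_fderiv_mul_le {n : ℕ} {g u : EuclideanSpace ℝ (Fin n) → ℝ}
    (hg : ContDiff ℝ (⊤ : ℕ∞) g) (hc : HasCompactSupport g) (h0 : ∀ y, 1 < ‖y‖ → g y = 0)
    {x w : EuclideanSpace ℝ (Fin n)} {r s M : ℝ} (hs : 0 ≤ s) (hsr : s ≤ r)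
    (hu : ∀ y ∈ Metric.closedBall x r, |u y| ≤ M) :
    |∫ y, fderiv ℝ g y w * u (x + s • y)| ≤ (∫ y, ‖fderiv ℝ g y‖) * (‖w‖ * M) := by
  have hint : Integrable fun y => ‖fderiv ℝ g y‖ :=
    ((hg.continuous_fderiv (by simp)).integrable_of_hasCompactSupport (hc.fderiv (𝕜 := ℝ))).norm
  rw [← integral_mul_const, ← Real.norm_eq_abs]
  refine norm_integral_le_of_norm_le (hint.mul_const _) (Filter.Eventually.of_forall fun y => ?_)
  by_cases hy : 1 < ‖y‖
  · have : g =ᶠ[nhds y] fun _ => 0 := by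
      filter_upwards [continuous_norm.continuousAt.eventually_const_lt hy] with z hz using h0 z hz
    rw [this.fderiv_eq]
    simp
  · rw [norm_mul, ← mul_assoc]
    refine mul_le_mul ((fderiv ℝ g y).le_opNorm w) (hu _ ?_) (norm_nonneg _) (by positivity)
    rw [mem_closedBall_iff_norm, add_sub_cancel_left, norm_smul, Real.norm_of_nonneg hs]
    nlinarith [norm_nonneg y]

/-- Interior gradient estimate for solutions of `Δu + u = 0`. -/
lemma exists_gradient_bound (n : ℕ) (hn : 1 ≤ n) :
    ∃ C : ℝ, 0 < C ∧ ∀ (u : EuclideanSpace ℝ (Fin n) → ℝ) (w : EuclideanSpace ℝ (Fin n)),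
      ContDiff ℝ (⊤ : ℕ∞) u →
      (∀ x, laplacian (fun y => fderiv ℝ u y w) x + fderiv ℝ u x w = 0) →
      ∀ (x : EuclideanSpace ℝ (Fin n)) (r M : ℝ), 0 < r →
        (∀ y ∈ Metric.closedBall x r, |u y| ≤ M) →
        |fderiv ℝ u x w| ≤ C * (1 / r + r) * ‖w‖ * M := by
  obtain ⟨Φ, φ, hΦ, hφ, hΦc, hφc, hΦ0, hφ0, hgrad, hne⟩ := exists_radial_kernel n hn
  set A := ∫ y, ‖fderiv ℝ Φ y‖
  set B := ∫ y, ‖fderiv ℝ φ y‖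
  have hA : 0 ≤ A := integral_nonneg fun y => norm_nonneg _
  have hB : 0 ≤ B := integral_nonneg fun y => norm_nonneg _
  have hpos : 0 < |∫ y, φ y| := abs_pos.2 hne
  refine ⟨(A + B + 1) / |∫ y, φ y|, by positivity, fun u w hu hlap x r M hr hM => ?_⟩
  have hM0 : 0 ≤ M := (abs_nonneg _).trans (hM x (Metric.mem_closedBall_self hr.le))
  have hv := contDiff_fderiv_apply_const hu w
  have hlap' : ∀ z, laplacian (fun y => fderiv ℝ u y w) z = -fderiv ℝ u z w := fun z =>
    eq_neg_of_add_eq_zero_left (hlap z)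
  have hparts : ∀ (g : EuclideanSpace ℝ (Fin n) → ℝ), ContDiff ℝ (⊤ : ℕ∞) g →
      HasCompactSupport g → ∀ s : ℝ, s * ∫ y, g y * fderiv ℝ u (x + s • y) w =
        -∫ y, fderiv ℝ g y w * u (x + s • y) := by
    intro g hg hgc s
    rw [← integral_mul_fderiv_of_hasCompactSupport hg hgc (contDiff_comp_add_smul hu x s) w,
      ← integral_const_mul]
    simp only [fderiv_comp_add_smul hu]
    congr 1
    ext y
    ring
  have hder : ∀ s, HasDerivAt (fun s : ℝ => ∫ y, φ y * fderiv ℝ u (x + s • y) w)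
      (-∫ y, fderiv ℝ Φ y w * u (x + s • y)) s := by
    intro s
    have h1 := hasDerivAt_integral_mul_comp_add_smul hφ.continuous hφc hv x s
    rw [integral_kernel_mul_fderiv_radial hΦ hΦc hgrad hv x s] at h1
    rw [← hparts Φ hΦ hΦc s]
    convert h1 using 1
    simp only [hlap', mul_neg, integral_neg, neg_neg]
  have hdiff := Convex.norm_image_sub_le_of_norm_hasDerivWithin_le (s := Set.Icc 0 r)
    (C := A * (‖w‖ * M)) (fun s _ => (hder s).hasDerivWithinAt) (fun s hs => by
      rw [norm_neg]
      exact abs_integral_fderiv_mul_le hΦ hΦc hΦ0 hs.1 hs.2 hM) (convex_Icc 0 r)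
      (Set.left_mem_Icc.2 hr.le) (Set.right_mem_Icc.2 hr.le)
  have hend : |∫ y, φ y * fderiv ℝ u (x + r • y) w| ≤ B * (‖w‖ * M) / r := by
    rw [le_div_iff₀ hr, mul_comm, ← abs_of_pos hr, ← abs_mul, abs_of_pos hr, hparts φ hφ hφc,
      abs_neg]
    exact abs_integral_fderiv_mul_le hφ hφc hφ0 hr.le le_rfl hM
  simp only [zero_smul, add_zero, integral_mul_const, sub_zero, Real.norm_eq_abs,
    abs_of_pos hr] at hdiff
  have hfin : |∫ y, φ y| * |fderiv ℝ u x w| ≤ A * (‖w‖ * M) * r + B * (‖w‖ * M) / r := by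
    rw [← abs_mul]
    have := abs_sub_abs_le_abs_sub ((∫ y, φ y) * fderiv ℝ u x w)
      (∫ y, φ y * fderiv ℝ u (x + r • y) w)
    rw [abs_sub_comm] at this
    linarith
  have hwM : 0 ≤ ‖w‖ * M := by positivity
  rw [div_mul_eq_mul_div, div_mul_eq_mul_div, div_mul_eq_mul_div, le_div_iff₀ hpos, mul_comm]
  refine hfin.trans ?_
  have h1 : A * (‖w‖ * M) * r + B * (‖w‖ * M) / r + (A * (1 / r) + B * r + (1 / r + r)) * (‖w‖ * M)
      = (A + B + 1) * (1 / r + r) * ‖w‖ * M := by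
    field_simp
    ring
  have h2 : 0 ≤ (A * (1 / r) + B * r + (1 / r + r)) * (‖w‖ * M) := by positivity
  linarith

lemma fderiv_fderiv_apply_comm {n : ℕ} {u : EuclideanSpace ℝ (Fin n) → ℝ}
    (hu : ContDiff ℝ (⊤ : ℕ∞) u) (v w x : EuclideanSpace ℝ (Fin n)) :
    fderiv ℝ (fun y => fderiv ℝ u y v) x w = fderiv ℝ (fun y => fderiv ℝ u y w) x v := by
  have hd : DifferentiableAt ℝ (fderiv ℝ u) x :=
    (hu.fderiv_right (m := 1) (by norm_cast)).differentiable (by simp) x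
  have hs : IsSymmSndFDerivAt ℝ u x :=
    hu.contDiffAt.isSymmSndFDerivAt (by simp; exact WithTop.coe_le_coe.2 le_top)
  rw [fderiv_clm_apply hd (differentiableAt_const v),
    fderiv_clm_apply hd (differentiableAt_const w)]
  simpa using hs w v

/-- The space of smooth solutions of the Helmholtz equation `Δf + f = 0` on `ℝ^n`. -/
def helmholtzSol (n : ℕ) : Submodule ℝ (EuclideanSpace ℝ (Fin n) → ℝ) where
  carrier := {f | ContDiff ℝ (⊤ : ℕ∞) f ∧ ∀ x, laplacian f x + f x = 0}
  zero_mem' := ⟨contDiff_const, fun x => by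
    have h0 : (0 : EuclideanSpace ℝ (Fin n) → ℝ) = fun _ => 0 := rfl
    simp [laplacian, h0]⟩
  add_mem' := by
    rintro f g ⟨hf, hf'⟩ ⟨hg, hg'⟩
    refine ⟨hf.add hg, fun x => ?_⟩
    have h1 : ∀ w : EuclideanSpace ℝ (Fin n), (fun y => fderiv ℝ (f + g) y w) =
        fun y => fderiv ℝ f y w + fderiv ℝ g y w := fun w => by
      ext y
      rw [fderiv_add (hf.differentiable (by simp) y) (hg.differentiable (by simp) y)]
      rfl
    have h2 : laplacian (f + g) x = laplacian f x + laplacian g x := by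
      simp only [laplacian, h1, ← Finset.sum_add_distrib]
      refine Finset.sum_congr rfl fun i _ => ?_
      rw [fderiv_fun_add ((contDiff_fderiv_apply_const hf _).differentiable (by simp) x)
        ((contDiff_fderiv_apply_const hg _).differentiable (by simp) x)]
      rfl
    rw [h2, Pi.add_apply]
    linear_combination hf' x + hg' x
  smul_mem' := by
    rintro c f ⟨hf, hf'⟩
    refine ⟨hf.const_smul c, fun x => ?_⟩
    have h1 : ∀ w : EuclideanSpace ℝ (Fin n), (fun y => fderiv ℝ (c • f) y w) =
        fun y => c • fderiv ℝ f y w := fun w => by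
      ext y
      rw [fderiv_const_smul (hf.differentiable (by simp) y)]
      rfl
    have h2 : laplacian (c • f) x = c * laplacian f x := by
      simp only [laplacian, h1, Finset.mul_sum]
      refine Finset.sum_congr rfl fun i _ => ?_
      rw [fderiv_fun_const_smul ((contDiff_fderiv_apply_const hf _).differentiable (by simp) x)]
      rfl
    rw [h2, Pi.smul_apply, smul_eq_mul]
    linear_combination c * hf' x

namespace helmholtzSol

variable {n : ℕ}

lemma contDiff_coe (u : helmholtzSol n) : ContDiff ℝ (⊤ : ℕ∞) (u : EuclideanSpace ℝ (Fin n) → ℝ) :=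
  u.2.1

lemma fderiv_apply_mem (w : EuclideanSpace ℝ (Fin n)) (u : helmholtzSol n) :
    (fun y => fderiv ℝ (u : EuclideanSpace ℝ (Fin n) → ℝ) y w) ∈ helmholtzSol n := by
  refine ⟨contDiff_fderiv_apply_const (contDiff_coe u) w, fun x => ?_⟩
  have hu : (u : EuclideanSpace ℝ (Fin n) → ℝ) = fun y => -∑ i, fderiv ℝ
      (fun z => fderiv ℝ u.1 z (EuclideanSpace.single i (1 : ℝ))) y
        (EuclideanSpace.single i (1 : ℝ)) := by
    ext y
    exact eq_neg_of_add_eq_zero_right (u.2.2 y)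
  have hd : ∀ i : Fin n, ContDiff ℝ (⊤ : ℕ∞) fun y => fderiv ℝ
      (fun z => fderiv ℝ u.1 z (EuclideanSpace.single i (1 : ℝ))) y
        (EuclideanSpace.single i (1 : ℝ)) := fun i =>
    contDiff_fderiv_apply_const (contDiff_fderiv_apply_const (contDiff_coe u) _) _
  have h1 : fderiv ℝ (u : EuclideanSpace ℝ (Fin n) → ℝ) x w = -∑ i, fderiv ℝ (fun y => fderiv ℝ
      (fun z => fderiv ℝ u.1 z (EuclideanSpace.single i (1 : ℝ))) y
        (EuclideanSpace.single i (1 : ℝ))) x w := by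
    conv_lhs => rw [hu]
    rw [fderiv_fun_neg, fderiv_fun_sum fun i _ => (hd i).differentiable (by simp) x]
    simp
  change laplacian _ x + fderiv ℝ u.1 x w = 0
  rw [h1, laplacian, ← sub_eq_add_neg, sub_eq_zero]
  refine Finset.sum_congr rfl fun i _ => ?_
  rw [fderiv_fderiv_apply_comm (contDiff_fderiv_apply_const (contDiff_coe u) _) _ w]
  simp only [fderiv_fderiv_apply_comm (contDiff_coe u) w]

/-- The directional derivative, as an endomorphism of the space of solutions. -/
def dir (w : EuclideanSpace ℝ (Fin n)) : Module.End ℝ (helmholtzSol n) where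
  toFun u := ⟨fun y => fderiv ℝ (u : EuclideanSpace ℝ (Fin n) → ℝ) y w, fderiv_apply_mem w u⟩
  map_add' u v := by
    ext y
    change fderiv ℝ (u.1 + v.1) y w = _
    rw [fderiv_add ((contDiff_coe u).differentiable (by simp) y)
      ((contDiff_coe v).differentiable (by simp) y)]
    rfl
  map_smul' c u := by
    ext y
    change fderiv ℝ (c • u.1) y w = _
    rw [fderiv_const_smul ((contDiff_coe u).differentiable (by simp) y)]
    rfl

lemma dir_apply (w : EuclideanSpace ℝ (Fin n)) (u : helmholtzSol n)
    (x : EuclideanSpace ℝ (Fin n)) :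
    (dir w u : EuclideanSpace ℝ (Fin n) → ℝ) x =
      fderiv ℝ (u : EuclideanSpace ℝ (Fin n) → ℝ) x w := rfl

lemma dir_comm (v w : EuclideanSpace ℝ (Fin n)) (u : helmholtzSol n) :
    dir v (dir w u) = dir w (dir v u) :=
  Subtype.ext (funext fun x => fderiv_fderiv_apply_comm (contDiff_coe u) w v x)

lemma sum_coe_apply {ι : Type*} (s : Finset ι) (u : ι → helmholtzSol n)
    (x : EuclideanSpace ℝ (Fin n)) :
    ((∑ i ∈ s, u i : helmholtzSol n) : EuclideanSpace ℝ (Fin n) → ℝ) x = ∑ i ∈ s, (u i).1 x := by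
  rw [Submodule.coe_sum, Finset.sum_apply]

lemma sum_dir_dir_single (u : helmholtzSol n) :
    ∑ i, dir (EuclideanSpace.single i (1 : ℝ)) (dir (EuclideanSpace.single i (1 : ℝ)) u) = -u := by
  refine Subtype.ext (funext fun x => ?_)
  rw [sum_coe_apply]
  exact eq_neg_of_add_eq_zero_left (u.2.2 x)

lemma dir_eq_sum (w : EuclideanSpace ℝ (Fin n)) (u : helmholtzSol n) :
    dir w u = ∑ i, w i • dir (EuclideanSpace.single i (1 : ℝ)) u := by
  refine Subtype.ext (funext fun x => ?_)
  rw [sum_coe_apply]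
  have hw : w = ∑ i, w i • EuclideanSpace.single i (1 : ℝ) := by
    ext j
    simp [Finset.sum_apply, Pi.single_apply]
  rw [dir_apply]
  conv_lhs => rw [hw, map_sum]
  simp [dir_apply]

lemma exists_dir_bound (n : ℕ) (hn : 1 ≤ n) :
    ∃ C : ℝ, 0 < C ∧ ∀ (u : helmholtzSol n) (w x : EuclideanSpace ℝ (Fin n)) (r M : ℝ), 0 < r →
      (∀ y ∈ Metric.closedBall x r, |u.1 y| ≤ M) →
      |(dir w u).1 x| ≤ C * (1 / r + r) * ‖w‖ * M := by
  obtain ⟨C, hC, h⟩ := exists_gradient_bound n hn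
  exact ⟨C, hC, fun u w => h u w (contDiff_coe u) (dir w u).2.2⟩

lemma abs_dir_pow_le {C : ℝ}
    (h : ∀ (u : helmholtzSol n) (w x : EuclideanSpace ℝ (Fin n)) (r M : ℝ), 0 < r →
      (∀ y ∈ Metric.closedBall x r, |u.1 y| ≤ M) → |(dir w u).1 x| ≤ C * (1 / r + r) * ‖w‖ * M)
    (w x : EuclideanSpace ℝ (Fin n)) {r : ℝ} (hr : 0 < r) (m : ℕ) (u : helmholtzSol n) (M : ℝ)
    (hM : ∀ y ∈ Metric.closedBall x (m * r), |u.1 y| ≤ M) :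
    |((dir w ^ m) u).1 x| ≤ (C * (1 / r + r) * ‖w‖) ^ m * M := by
  induction m generalizing u M with
  | zero => simpa using hM x (by simp)
  | succ m ih =>
    rw [pow_succ, Module.End.mul_apply]
    refine (ih (dir w u) (C * (1 / r + r) * ‖w‖ * M) fun y hy => h u w y r M hr fun z hz =>
      hM z ?_).trans_eq (by ring)
    rw [Metric.mem_closedBall] at *
    push_cast
    linarith [dist_triangle z y x]

lemma norm_iteratedFDeriv_le {C : ℝ} (hC : 0 < C)
    (h : ∀ (u : helmholtzSol n) (w x : EuclideanSpace ℝ (Fin n)) (r M : ℝ), 0 < r →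
      (∀ y ∈ Metric.closedBall x r, |u.1 y| ≤ M) → |(dir w u).1 x| ≤ C * (1 / r + r) * ‖w‖ * M)
    (x : EuclideanSpace ℝ (Fin n)) (m : ℕ) (u : helmholtzSol n) (M : ℝ)
    (hM : ∀ y ∈ Metric.closedBall x m, |u.1 y| ≤ M) :
    ‖iteratedFDeriv ℝ m u.1 x‖ ≤ (C * 2) ^ m * M := by
  have hM0 : 0 ≤ M := (abs_nonneg _).trans (hM x (by simp))
  refine ContinuousMultilinearMap.opNorm_le_bound (by positivity) fun v => ?_
  clear hM0
  induction m generalizing u M with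
  | zero => simpa using hM x (by simp)
  | succ m ih =>
    have hd : ContDiffAt ℝ m (fderiv ℝ u.1) x :=
      ((contDiff_coe u).fderiv_right (m := m) (by norm_cast; exact le_top)).contDiffAt
    have h1 : iteratedFDeriv ℝ (m + 1) u.1 x v =
        iteratedFDeriv ℝ m (dir (v (Fin.last m)) u).1 x (Fin.init v) := by
      rw [iteratedFDeriv_succ_apply_right]
      have h2 := (ContinuousLinearMap.apply ℝ ℝ (v (Fin.last m))).iteratedFDeriv_comp_left hd le_rfl
      have h3 : (ContinuousLinearMap.apply ℝ ℝ (v (Fin.last m))) ∘ fderiv ℝ u.1 =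
        (dir (v (Fin.last m)) u).1 := rfl
      rw [h3] at h2
      rw [h2]
      rfl
    rw [h1]
    refine (ih (dir (v (Fin.last m)) u) (C * 2 * ‖v (Fin.last m)‖ * M) (fun y hy => ?_)
      (Fin.init v)).trans_eq ?_
    · refine (h u _ y 1 M one_pos fun z hz => hM z ?_).trans_eq (by ring)
      rw [Metric.mem_closedBall] at *
      push_cast
      linarith [dist_triangle z y x]
    · rw [Fin.prod_univ_castSucc]
      simp only [Fin.init]
      ring

lemma exists_abs_dir_pow_div_factorial_le (hn : 1 ≤ n) (f : helmholtzSol n) {ρ q : ℝ}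
    (hρ : 0 < ρ) (hq : 0 < q) :
    ∃ A : ℝ, 0 ≤ A ∧ ∀ (m : ℕ) (x y : EuclideanSpace ℝ (Fin n)), ‖x‖ ≤ ρ → ‖y‖ ≤ ρ →
      |((dir x ^ m) f).1 y| / m.factorial ≤ A * q ^ m := by
  obtain ⟨C, hC, h⟩ := exists_dir_bound n hn
  set R := C * ρ * exp 1 / q with hR
  have hRpos : 0 < R := by positivity
  obtain ⟨M, hM⟩ :=
    (isCompact_closedBall (0 : EuclideanSpace ℝ (Fin n)) (ρ + R)).exists_bound_of_continuousOn
    (contDiff_coe f).continuous.continuousOn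
  have hM0 : 0 ≤ M := (norm_nonneg _).trans (hM 0 (Metric.mem_closedBall_self (by positivity)))
  refine ⟨exp (R ^ 2) * M, by positivity, fun m x y hx hy => ?_⟩
  rcases Nat.eq_zero_or_pos m with rfl | hm
  · have h1 : |f.1 y| ≤ M := hM y (by simpa using by linarith)
    have h2 : 1 ≤ exp (R ^ 2) := one_le_exp (by positivity)
    simp only [pow_zero, Module.End.one_apply, Nat.factorial_zero, Nat.cast_one, div_one, mul_one]
    nlinarith
  · have hm' : (0 : ℝ) < m := by exact_mod_cast hm
    have hm1 : (1 : ℝ) ≤ m := by exact_mod_cast hm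
    have hb := abs_dir_pow_le h x y (div_pos hRpos hm') m f M fun z hz => hM z (by
      rw [mul_div_cancel₀ _ hm'.ne', mem_closedBall_iff_norm] at hz
      rw [mem_closedBall_zero_iff]
      have := norm_add_le y (z - y)
      rw [add_sub_cancel] at this
      linarith)
    have h1 : C * (1 / (R / m) + R / m) * ‖x‖ ≤ q * exp (-1) * m * exp (R ^ 2 / m ^ 2) := by
      have e1 : C * (1 / (R / m) + R / m) * ρ = q * exp (-1) * m * (R ^ 2 / m ^ 2 + 1) := by
        have hρ' : C * ρ = R * q * exp (-1) := by
          rw [hR, exp_neg]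
          field_simp
        rw [mul_right_comm, hρ']
        field_simp
        ring
      calc _ ≤ C * (1 / (R / m) + R / m) * ρ := by gcongr
        _ = _ := e1
        _ ≤ _ := by
          gcongr
          exact add_one_le_exp _
    have h2 : (C * (1 / (R / m) + R / m) * ‖x‖) ^ m ≤
        q ^ m * exp (-m) * m ^ m * exp (R ^ 2) := by
      refine (pow_le_pow_left₀ (by positivity) h1 m).trans ?_
      rw [mul_pow, mul_pow, mul_pow, ← exp_nat_mul, ← exp_nat_mul, mul_neg_one]
      gcongr
      rw [sq (m : ℝ), ← div_div, mul_div_cancel₀ _ hm'.ne']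
      exact div_le_self (sq_nonneg R) hm1
    have h3 := Real.pow_div_factorial_le_exp (m : ℝ) hm'.le m
    have hfac : (0 : ℝ) < m.factorial := by exact_mod_cast m.factorial_pos
    rw [div_le_iff₀ hfac] at h3 ⊢
    calc _ ≤ _ := hb
      _ ≤ q ^ m * exp (-m) * (exp m * m.factorial) * exp (R ^ 2) * M := by
        gcongr
        exact h2.trans (by gcongr)
      _ = exp (R ^ 2) * M * q ^ m * m.factorial * (exp (-m) * exp m) := by ring
      _ = _ := by rw [← exp_add]; simp

lemma iteratedDeriv_comp_smul (x : EuclideanSpace ℝ (Fin n)) (m : ℕ) (f : helmholtzSol n) :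
    iteratedDeriv m (fun t : ℝ => f.1 (t • x)) = fun t => ((dir x ^ m) f).1 (t • x) := by
  induction m generalizing f with
  | zero => simp
  | succ m ih =>
    rw [iteratedDeriv_succ', pow_succ, Module.End.mul_apply, ← ih]
    congr 1
    ext t
    have h1 : HasDerivAt (fun s : ℝ => s • x) x t := by
      simpa using (hasDerivAt_id t).smul_const x
    have h2 := ((contDiff_coe f).differentiable (by simp) (t • x)).hasFDerivAt
    exact (h2.comp_hasDerivAt t h1).deriv

/-- The Taylor series at the origin of an entire solution converges to it. -/
lemma hasSum_dir_pow (hn : 1 ≤ n) (f : helmholtzSol n) (x : EuclideanSpace ℝ (Fin n)) :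
    HasSum (fun m : ℕ => ((dir x ^ m) f).1 0 / m.factorial) (f.1 x) := by
  obtain ⟨A, hA, hb⟩ := exists_abs_dir_pow_div_factorial_le hn f
    (show 0 < ‖x‖ + 1 by positivity) (half_pos one_pos)
  have hsum : Summable fun m : ℕ => ((dir x ^ m) f).1 0 / m.factorial := by
    refine Summable.of_norm_bounded (g := fun m => A * (1 / 2) ^ m)
      ((summable_geometric_two).mul_left A) fun m => ?_
    rw [norm_div, Real.norm_natCast]
    exact hb m x 0 (by linarith) (by simp; positivity)
  refine (hasSum_iff_tendsto_nat_of_summable_norm hsum.norm).2 ?_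
  rw [← Filter.tendsto_add_atTop_iff_nat 1]
  have hsm : ContDiff ℝ (⊤ : ℕ∞) fun t : ℝ => f.1 (t • x) :=
    (contDiff_coe f).comp (contDiff_id.smul contDiff_const)
  have hit : ∀ m : ℕ, ∀ t ∈ Set.Icc (0 : ℝ) 1,
      iteratedDerivWithin m (fun t : ℝ => f.1 (t • x)) (Set.Icc 0 1) t =
        ((dir x ^ m) f).1 (t • x) := fun m t ht => by
    rw [iteratedDerivWithin_eq_iteratedDeriv (uniqueDiffOn_Icc one_pos)
      (hsm.contDiffAt.of_le (by exact_mod_cast le_top)) ht, iteratedDeriv_comp_smul]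
  have hrem : ∀ N : ℕ, ‖∑ m ∈ Finset.range (N + 1), ((dir x ^ m) f).1 0 / m.factorial - f.1 x‖ ≤
      A * (((N : ℝ) + 1) * (1 / 2) ^ (N + 1)) := fun N => by
    have ht := taylor_mean_remainder_bound (f := fun t : ℝ => f.1 (t • x)) (n := N)
      (C := A * (1 / 2) ^ (N + 1) * (N + 1).factorial) zero_le_one
      (hsm.of_le (by exact_mod_cast le_top)).contDiffOn (Set.right_mem_Icc.2 zero_le_one)
      fun y hy => by
        rw [hit (N + 1) y hy, Real.norm_eq_abs, ← div_le_iff₀ (by positivity)]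
        refine hb (N + 1) x (y • x) (by linarith) ?_
        rw [norm_smul, Real.norm_of_nonneg hy.1]
        nlinarith [norm_nonneg x, hy.2]
    rw [taylor_within_apply, norm_sub_rev] at ht
    simp only [one_smul, sub_zero, one_pow, mul_one, smul_eq_mul] at ht
    rw [Finset.sum_congr rfl fun m _ => by
      rw [hit m 0 (Set.left_mem_Icc.2 zero_le_one), zero_smul, ← div_eq_inv_mul]] at ht
    refine ht.trans_eq ?_
    rw [Nat.factorial_succ]
    have : (N.factorial : ℝ) ≠ 0 := by positivity
    push_cast
    field_simp
  rw [tendsto_iff_norm_sub_tendsto_zero]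
  refine squeeze_zero (fun _ => norm_nonneg _) hrem ?_
  rw [← mul_zero A]
  refine Filter.Tendsto.const_mul A ?_
  have := (tendsto_self_mul_const_pow_of_lt_one (r := (1 / 2 : ℝ)) (by norm_num) (by norm_num)).comp
    (Filter.tendsto_add_atTop_nat 1)
  refine this.congr fun N => ?_
  simp

/-- The homogeneous component of degree `d` of the Taylor series at the origin. -/
def taylorPoly : ℕ → helmholtzSol n →ₗ[ℝ] MvPolynomial (Fin n) ℝ
  | 0 => Algebra.linearMap ℝ (MvPolynomial (Fin n) ℝ) ∘ₗ LinearMap.proj 0 ∘ₗ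
      (helmholtzSol n).subtype
  | d + 1 => ((d : ℝ) + 1)⁻¹ • ∑ i, LinearMap.mulLeft ℝ (MvPolynomial.X i) ∘ₗ taylorPoly d ∘ₗ
      dir (EuclideanSpace.single i 1)

lemma taylorPoly_zero (u : helmholtzSol n) : taylorPoly 0 u = MvPolynomial.C (u.1 0) := rfl

lemma taylorPoly_succ (d : ℕ) (u : helmholtzSol n) :
    taylorPoly (d + 1) u = ((d : ℝ) + 1)⁻¹ • ∑ i, MvPolynomial.X i *
      taylorPoly d (dir (EuclideanSpace.single i 1) u) := by
  simp [taylorPoly]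

lemma isHomogeneous_taylorPoly (d : ℕ) (u : helmholtzSol n) :
    (taylorPoly d u).IsHomogeneous d := by
  induction d generalizing u with
  | zero => exact MvPolynomial.isHomogeneous_C _ _
  | succ d ih =>
    rw [taylorPoly_succ, MvPolynomial.smul_eq_C_mul]
    refine MvPolynomial.IsHomogeneous.C_mul (MvPolynomial.IsHomogeneous.sum _ _ _ fun i _ => ?_) _
    rw [add_comm]
    exact (MvPolynomial.isHomogeneous_X ℝ i).mul (ih _)

lemma eval_taylorPoly (d : ℕ) (u : helmholtzSol n) (x : EuclideanSpace ℝ (Fin n)) :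
    MvPolynomial.eval (fun i => x i) (taylorPoly d u) = ((dir x ^ d) u).1 0 / d.factorial := by
  induction d generalizing u with
  | zero => simp [taylorPoly_zero]
  | succ d ih =>
    rw [taylorPoly_succ, MvPolynomial.smul_eval, map_sum, pow_succ, Module.End.mul_apply,
      dir_eq_sum x u, map_sum, sum_coe_apply, Finset.mul_sum, Finset.sum_div]
    refine Finset.sum_congr rfl fun i _ => ?_
    rw [map_mul, MvPolynomial.eval_X, ih, map_smul, Nat.factorial_succ]
    simp only [Submodule.coe_smul, Pi.smul_apply, smul_eq_mul]
    push_cast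
    field_simp

lemma pderiv_taylorPoly_succ (d : ℕ) (u : helmholtzSol n) (j : Fin n) :
    MvPolynomial.pderiv j (taylorPoly (d + 1) u) =
      taylorPoly d (dir (EuclideanSpace.single j 1) u) := by
  induction d generalizing u with
  | zero =>
    simp [taylorPoly_succ, taylorPoly_zero, MvPolynomial.pderiv_X, Pi.single_apply]
  | succ d ih =>
    have h1 : ∑ i, MvPolynomial.X i * taylorPoly d (dir (EuclideanSpace.single i (1 : ℝ))
        (dir (EuclideanSpace.single j 1) u)) =
        ((d : ℝ) + 1) • taylorPoly (d + 1) (dir (EuclideanSpace.single j 1) u) := by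
      rw [taylorPoly_succ, smul_smul, mul_inv_cancel₀ (by positivity), one_smul]
    rw [taylorPoly_succ (d + 1), Derivation.map_smul, map_sum]
    simp only [Derivation.leibniz, ih, MvPolynomial.pderiv_X, smul_eq_mul]
    simp only [dir_comm (EuclideanSpace.single j (1 : ℝ)), Finset.sum_add_distrib, h1]
    rw [Finset.sum_eq_single j]
    · have h2 : ((d : ℝ) + 1 + 1) ≠ 0 := by positivity
      rw [Pi.single_eq_same, mul_one, Nat.cast_succ, inv_smul_eq_iff₀ h2]
      module
    · intro i _ hi
      rw [Pi.single_eq_of_ne hi, mul_zero]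
    · simp

lemma polyLaplacian_taylorPoly (d : ℕ) (u : helmholtzSol n) :
    polyLaplacian (taylorPoly d u) = if 2 ≤ d then -taylorPoly (d - 2) u else 0 := by
  match d with
  | 0 => simp [polyLaplacian, taylorPoly_zero]
  | 1 => simp [polyLaplacian, pderiv_taylorPoly_succ, taylorPoly_zero]
  | d + 2 =>
    simp only [polyLaplacian, pderiv_taylorPoly_succ]
    rw [← map_sum, sum_dir_dir_single]
    simp

end helmholtzSol

open MvPolynomial in
/-- The polynomial `∑ᵢ Xᵢ²`. -/
def normSqPoly (n : ℕ) : MvPolynomial (Fin n) ℝ := ∑ i, X i ^ 2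

open MvPolynomial in
lemma isHomogeneous_normSqPoly (n : ℕ) : (normSqPoly n).IsHomogeneous 2 :=
  IsHomogeneous.sum _ _ _ fun i _ => isHomogeneous_X_pow i 2

lemma eval_normSqPoly {n : ℕ} (x : EuclideanSpace ℝ (Fin n)) :
    MvPolynomial.eval (fun i => x i) (normSqPoly n) = ‖x‖ ^ 2 := by
  simp [normSqPoly, EuclideanSpace.norm_sq_eq]

open MvPolynomial in
lemma pderiv_normSqPoly {n : ℕ} (i : Fin n) : pderiv i (normSqPoly n) = 2 * X i := by
  rw [normSqPoly, map_sum, Finset.sum_eq_single i]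
  · simp [Derivation.leibniz_pow]
  · intro j _ hj
    simp [Derivation.leibniz_pow, pderiv_X, hj]
  · simp

open MvPolynomial in
lemma polyLaplacian_normSqPoly_pow_mul {n m : ℕ} (k : ℕ) {p : MvPolynomial (Fin n) ℝ}
    (hp : p.IsHomogeneous m) :
    polyLaplacian (normSqPoly n ^ (k + 1) * p) =
      C (2 * ((k : ℝ) + 1) * (2 * k + n + 2 * m)) * (normSqPoly n ^ k * p) +
        normSqPoly n ^ (k + 1) * polyLaplacian p := by
  have hk : (k : MvPolynomial (Fin n) ℝ) * (normSqPoly n ^ (k - 1) * normSqPoly n) =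
      k * normSqPoly n ^ k := by
    cases k with
    | zero => simp
    | succ k => rw [Nat.add_sub_cancel, pow_succ]
  have h1 : ∀ i, pderiv i (pderiv i (normSqPoly n ^ (k + 1) * p)) =
      (4 * ((k : MvPolynomial (Fin n) ℝ) + 1) * (k : MvPolynomial (Fin n) ℝ) *
        normSqPoly n ^ (k - 1) * p) * X i ^ 2 +
      2 * ((k : MvPolynomial (Fin n) ℝ) + 1) * normSqPoly n ^ k * p +
      (4 * ((k : MvPolynomial (Fin n) ℝ) + 1) * normSqPoly n ^ k) * (X i * pderiv i p) +
        normSqPoly n ^ (k + 1) * pderiv i (pderiv i p) := by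
    intro i
    simp only [Derivation.leibniz, Derivation.leibniz_pow, pderiv_normSqPoly, smul_eq_mul,
      nsmul_eq_mul, map_add, Nat.add_sub_cancel, pderiv_X_self, Derivation.map_natCast]
    have h2 : pderiv i (2 : MvPolynomial (Fin n) ℝ) = 0 := by
      exact_mod_cast Derivation.map_natCast (pderiv i) 2
    rw [h2]
    push_cast
    ring
  have hC : (C (2 * ((k : ℝ) + 1) * (2 * k + n + 2 * m)) : MvPolynomial (Fin n) ℝ) =
      2 * (k + 1) * (2 * k + n + 2 * m) := by
    have h2 : (C 2 : MvPolynomial (Fin n) ℝ) = 2 := map_ofNat C 2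
    simp [h2]
  simp only [polyLaplacian, h1, Finset.sum_add_distrib, ← Finset.mul_sum, hp.sum_X_mul_pderiv]
  rw [← normSqPoly, hC]
  simp only [Finset.sum_const, Finset.card_univ, Fintype.card_fin, nsmul_eq_mul]
  linear_combination (4 * (k + 1) * p) * hk

/-- The coefficient of `r^{2k}` in the power series of `Γ(μ+1) (r/2)^{-μ} J_μ(r)`. -/
def besselCoeff (μ : ℝ) (k : ℕ) : ℝ :=
  (-1) ^ k / (k.factorial * 4 ^ k * ∏ i ∈ Finset.range k, (μ + 1 + i))

/-- The coefficients of the harmonic projection of a homogeneous polynomial of degree `ℓ`, with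
`μ = ℓ + (n - 2) / 2`, up to sign. -/
def projCoeff (μ : ℝ) (j : ℕ) : ℝ :=
  1 / (j.factorial * 4 ^ j * ∏ i ∈ Finset.range j, (μ - 1 - i))

lemma one_le_prod_range {k : ℕ} {f : ℕ → ℝ} (hf : ∀ i < k, 1 ≤ f i) :
    1 ≤ ∏ i ∈ Finset.range k, f i := by
  induction k with
  | zero => simp
  | succ k ih =>
    rw [Finset.prod_range_succ]
    exact one_le_mul_of_one_le_of_one_le (ih fun i hi => hf i (by omega)) (hf k (by omega))

lemma abs_besselCoeff_le {μ : ℝ} (hμ : 0 ≤ μ) (k : ℕ) :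
    |besselCoeff μ k| ≤ 1 / k.factorial := by
  have h1 : 1 ≤ ∏ i ∈ Finset.range k, (μ + 1 + i) := one_le_prod_range fun i _ => by
    have : (0 : ℝ) ≤ i := i.cast_nonneg
    linarith
  have h4 : (1 : ℝ) ≤ 4 ^ k := one_le_pow₀ (by norm_num)
  have hf : (0 : ℝ) < k.factorial := by positivity
  rw [besselCoeff, abs_div, abs_pow, abs_neg, abs_one, one_pow, abs_of_pos (by positivity)]
  refine one_div_le_one_div_of_le hf ?_
  rw [mul_assoc]
  exact le_mul_of_one_le_right hf.le (one_le_mul_of_one_le_of_one_le h4 h1)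

lemma abs_projCoeff_le {α : ℝ} (hα : 0 ≤ α) (j : ℕ) :
    |projCoeff (α + 2 * j) j| ≤ 1 / j.factorial := by
  have h1 : 1 ≤ ∏ i ∈ Finset.range j, (α + 2 * j - 1 - i) := one_le_prod_range fun i hi => by
    have : (i : ℝ) + 1 ≤ j := by exact_mod_cast hi
    have : (0 : ℝ) ≤ i := i.cast_nonneg
    linarith
  have h4 : (1 : ℝ) ≤ 4 ^ j := one_le_pow₀ (by norm_num)
  have hf : (0 : ℝ) < j.factorial := by positivity
  rw [projCoeff, abs_of_pos (by positivity)]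
  refine one_div_le_one_div_of_le hf ?_
  rw [mul_assoc]
  exact le_mul_of_one_le_right hf.le (one_le_mul_of_one_le_of_one_le h4 h1)

lemma prod_range_reflect_mul_prod_range (α : ℝ) (j b : ℕ) :
    (∏ i ∈ Finset.range j, (α + 2 * j - 1 - i)) * ((α + 2 * j) *
      ∏ i ∈ Finset.range b, (α + 2 * j + 1 + i)) =
        ∏ i ∈ Finset.range (j + b + 1), (α + j + i) := by
  rw [add_assoc j b 1, Finset.prod_range_add, Finset.prod_range_succ' _ b]
  congr 1
  · rw [← Finset.prod_range_reflect]
    refine Finset.prod_congr rfl fun i hi => ?_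
    have := Finset.mem_range.1 hi
    rw [Nat.cast_sub (by omega), Nat.cast_sub (by omega)]
    push_cast
    ring
  · rw [mul_comm]
    congr 1
    · refine Finset.prod_congr rfl fun i _ => ?_
      push_cast
      ring
    · push_cast
      ring

lemma sum_range_besselCoeff_mul_projCoeff {α : ℝ} (hα : 0 ≤ α) (m J : ℕ) (hJ : J ≤ m + 1) :
    ∑ j ∈ Finset.range (J + 1), besselCoeff (α + 2 * j) (m + 1 - j) * projCoeff (α + 2 * j) j =
      (-1) ^ (m + 1 + J) * m.choose J /
        ((m + 1).factorial * 4 ^ (m + 1) * ∏ i ∈ Finset.range (m + 1), (α + J + 1 + i)) := by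
  induction J with
  | zero => simp [besselCoeff, projCoeff]
  | succ J ih =>
    obtain ⟨b, rfl⟩ : ∃ b, m = J + b := ⟨m - J, by omega⟩
    rw [Finset.sum_range_succ, ih (by omega)]
    have hb : J + b + 1 - (J + 1) = b := by omega
    have hJ0 : (0 : ℝ) ≤ J := J.cast_nonneg
    have hpos : ∀ i : ℕ, 0 < α + J + 1 + i := fun i => by positivity
    set P := ∏ i ∈ Finset.range (J + b), (α + J + 1 + (i + 1 : ℕ)) with hP
    have hP0 : 0 < P := Finset.prod_pos fun i _ => hpos _
    have hA : ∏ i ∈ Finset.range (J + b + 1), (α + J + 1 + i) = P * (α + J + 1) := by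
      rw [Finset.prod_range_succ']
      simp [hP]
    have hB : ∏ i ∈ Finset.range (J + b + 1), (α + (J + 1 : ℕ) + 1 + i) =
        P * (α + J + 1 + (J + b + 1)) := by
      rw [Finset.prod_range_succ]
      congr 1
      · refine Finset.prod_congr rfl fun i _ => ?_
        push_cast
        ring
      · push_cast
        ring
    have hW := prod_range_reflect_mul_prod_range α (J + 1) b
    have hW' : ∏ i ∈ Finset.range (J + 1 + b + 1), (α + (J + 1 : ℕ) + i) =
        P * (α + J + 1) * (α + J + 1 + (J + b + 1)) := by
      rw [show J + 1 + b + 1 = J + b + 1 + 1 by ring, Finset.prod_range_succ, ← hA]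
      congr 1
      · refine Finset.prod_congr rfl fun i _ => ?_
        push_cast
        ring
      · push_cast
        ring
    rw [hW'] at hW
    rw [hb, hA, hB, besselCoeff, projCoeff]
    set Q := ∏ i ∈ Finset.range (J + 1), (α + 2 * (J + 1 : ℕ) - 1 - i)
    set R := ∏ i ∈ Finset.range b, (α + 2 * (J + 1 : ℕ) + 1 + i)
    have hQR : Q * ((α + 2 * (J + 1 : ℕ)) * R) ≠ 0 := by
      rw [hW]
      positivity
    obtain ⟨hQ, hR⟩ := mul_ne_zero_iff.1 hQR
    obtain ⟨hz, hR⟩ := mul_ne_zero_iff.1 hR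
    have hf : (((J + b).choose J : ℝ) + (J + b).choose (J + 1)) * (J + 1).factorial * b.factorial =
        (J + b + 1).factorial := by
      have := Nat.choose_mul_factorial_mul_factorial (show J + 1 ≤ J + b + 1 by omega)
      rw [hb, Nat.choose_succ_succ] at this
      exact_mod_cast this
    have hc : ((J + b).choose (J + 1) : ℝ) * (J + 1) = (J + b).choose J * b := by
      have := Nat.choose_succ_right_eq (J + b) J
      rw [Nat.add_sub_cancel_left] at this
      exact_mod_cast this
    set c0 := ((J + b).choose J : ℝ)
    set c1 := ((J + b).choose (J + 1) : ℝ)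
    have ht : (-1 : ℝ) ^ b / (b.factorial * 4 ^ b * R) *
        (1 / ((J + 1).factorial * 4 ^ (J + 1) * Q)) =
        (-1) ^ b * (c0 + c1) * (α + 2 * (J + 1 : ℕ)) / ((J + b + 1).factorial * 4 ^ (J + b + 1) *
          (P * (α + J + 1) * (α + J + 1 + (J + b + 1)))) := by
      rw [← hW, ← hf]
      have hne : c0 + c1 ≠ 0 := by
        intro h0
        rw [h0, zero_mul, zero_mul] at hf
        exact absurd hf.symm (by positivity)
      field_simp
      ring
    have hs1 : (-1 : ℝ) ^ (J + b + 1 + J) = -(-1) ^ b := by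
      rw [show J + b + 1 + J = 2 * J + (b + 1) by ring, pow_add, pow_mul]
      simp [pow_succ]
    have hs2 : (-1 : ℝ) ^ (J + b + 1 + (J + 1)) = (-1) ^ b := by
      rw [← add_assoc, pow_succ, hs1]
      ring
    rw [ht, hs1, hs2]
    have hX : α + J + 1 ≠ 0 := by positivity
    have hY : α + J + 1 + (J + b + 1) ≠ 0 := by positivity
    have hF : ((J + b + 1).factorial : ℝ) ≠ 0 := by positivity
    field_simp
    push_cast
    linear_combination hc

lemma sum_antidiagonal_besselCoeff_mul_projCoeff {α : ℝ} (hα : 0 ≤ α) (m : ℕ) :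
    ∑ p ∈ Finset.HasAntidiagonal.antidiagonal m,
      besselCoeff (α + 2 * p.1) p.2 * projCoeff (α + 2 * p.1) p.1 =
      if m = 0 then 1 else 0 := by
  cases m with
  | zero => simp [besselCoeff, projCoeff]
  | succ m =>
    rw [Finset.Nat.sum_antidiagonal_eq_sum_range_succ
      (fun j k => besselCoeff (α + 2 * j) k * projCoeff (α + 2 * j) j),
      sum_range_besselCoeff_mul_projCoeff hα m (m + 1) le_rfl]
    simp

/-- The harmonic projection of the degree `ℓ` Taylor component of a solution of `Δf + f = 0`. -/
def harmonicPart {n : ℕ} (ν : ℝ) (f : helmholtzSol n) (ℓ : ℕ) : MvPolynomial (Fin n) ℝ :=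
  ∑ j ∈ Finset.range (ℓ / 2 + 1), MvPolynomial.C (projCoeff (ℓ + ν) j) *
    (normSqPoly n ^ j * helmholtzSol.taylorPoly (ℓ - 2 * j) f)

lemma isHomogeneous_harmonicPart {n : ℕ} (ν : ℝ) (f : helmholtzSol n) (ℓ : ℕ) :
    (harmonicPart ν f ℓ).IsHomogeneous ℓ := by
  refine MvPolynomial.IsHomogeneous.sum _ _ _ fun j hj => MvPolynomial.IsHomogeneous.C_mul ?_ _
  have := ((isHomogeneous_normSqPoly n).pow j).mul
    (helmholtzSol.isHomogeneous_taylorPoly (ℓ - 2 * j) f)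
  rwa [show 2 * j + (ℓ - 2 * j) = ℓ by
    have := Finset.mem_range.1 hj
    omega] at this

lemma polyLaplacian_sum {n : ℕ} {ι : Type*} (s : Finset ι) (p : ι → MvPolynomial (Fin n) ℝ) :
    polyLaplacian (∑ i ∈ s, p i) = ∑ i ∈ s, polyLaplacian (p i) := by
  simp only [polyLaplacian, map_sum]
  exact Finset.sum_comm

lemma polyLaplacian_C_mul {n : ℕ} (c : ℝ) (p : MvPolynomial (Fin n) ℝ) :
    polyLaplacian (MvPolynomial.C c * p) = MvPolynomial.C c * polyLaplacian p := by
  simp only [polyLaplacian, MvPolynomial.C_mul', Derivation.map_smul, Finset.smul_sum]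

lemma polyLaplacian_harmonicPart {n : ℕ} (hn : 1 ≤ n) (f : helmholtzSol n) (ℓ : ℕ) :
    polyLaplacian (harmonicPart (((n : ℝ) - 2) / 2) f ℓ) = 0 := by
  set ν := ((n : ℝ) - 2) / 2 with hν
  let V : ℕ → MvPolynomial (Fin n) ℝ := fun j => if 1 ≤ j ∧ 2 * j ≤ ℓ then
    MvPolynomial.C (projCoeff (ℓ + ν) (j - 1)) * (normSqPoly n ^ (j - 1) *
      helmholtzSol.taylorPoly (ℓ - 2 * j) f) else 0
  have hstep : ∀ j ∈ Finset.range (ℓ / 2 + 1), polyLaplacian (MvPolynomial.C (projCoeff (ℓ + ν) j) *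
      (normSqPoly n ^ j * helmholtzSol.taylorPoly (ℓ - 2 * j) f)) = V j - V (j + 1) := by
    intro j hj
    have hj2 : 2 * j ≤ ℓ := by
      have := Finset.mem_range.1 hj
      omega
    have hV1 : MvPolynomial.C (projCoeff (ℓ + ν) j) * (normSqPoly n ^ j *
        polyLaplacian (helmholtzSol.taylorPoly (ℓ - 2 * j) f)) = -V (j + 1) := by
      rw [helmholtzSol.polyLaplacian_taylorPoly]
      simp only [V]
      by_cases h : 2 ≤ ℓ - 2 * j
      · rw [if_pos h, if_pos (by omega), Nat.add_sub_cancel,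
          show ℓ - 2 * (j + 1) = ℓ - 2 * j - 2 by omega]
        ring
      · rw [if_neg h, if_neg (by omega)]
        simp
    rw [polyLaplacian_C_mul]
    cases j with
    | zero =>
      have hV0 : V 0 = 0 := if_neg (by omega)
      rw [hV0, zero_sub, ← hV1]
      simp
    | succ j =>
      rw [polyLaplacian_normSqPoly_pow_mul j (helmholtzSol.isHomogeneous_taylorPoly _ f), mul_add,
        hV1, sub_eq_add_neg]
      congr 1
      simp only [V]
      rw [if_pos ⟨by omega, hj2⟩, Nat.add_sub_cancel, ← mul_assoc, ← map_mul]
      congr 2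
      obtain ⟨e, rfl⟩ : ∃ e, ℓ = 2 * (j + 1) + e := ⟨ℓ - 2 * (j + 1), by omega⟩
      rw [Nat.add_sub_cancel_left, projCoeff, projCoeff, Finset.prod_range_succ,
        Nat.factorial_succ, pow_succ]
      have hn' : (1 : ℝ) ≤ n := by exact_mod_cast hn
      have hlast : ((2 * (j + 1) + e : ℕ) : ℝ) + ν - 1 - j = (2 * j + n + 2 * e) / 2 := by
        rw [hν]
        push_cast
        ring
      have hpos : (0 : ℝ) < 2 * j + n + 2 * e := by positivity
      rw [hlast]
      by_cases hz : ∏ i ∈ Finset.range j, (((2 * (j + 1) + e : ℕ) : ℝ) + ν - 1 - i) = 0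
      · rw [hz]
        simp
      · push_cast at hz ⊢
        field_simp
        norm_num
  rw [harmonicPart, polyLaplacian_sum, Finset.sum_congr rfl hstep, Finset.sum_range_sub']
  simp only [V]
  rw [if_neg (by omega), if_neg (by omega), sub_zero]

/-- The entire function `Θ_μ` with `J_μ(r) = (r/2)^μ Θ_μ(r²) / Γ(μ+1)`. -/
def besselRadial (μ s : ℝ) : ℝ := ∑' k : ℕ, besselCoeff μ k * s ^ k

lemma hasSum_pow_div_factorial (s : ℝ) : HasSum (fun k : ℕ => s ^ k / k.factorial) (exp s) := by
  rw [Real.exp_eq_exp_ℝ]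
  exact NormedSpace.expSeries_div_hasSum_exp s

lemma abs_besselCoeff_mul_pow_le {μ : ℝ} (hμ : 0 ≤ μ) (s : ℝ) (k : ℕ) :
    |besselCoeff μ k * s ^ k| ≤ |s| ^ k / k.factorial := by
  rw [abs_mul, abs_pow, div_eq_mul_one_div, mul_comm]
  exact mul_le_mul_of_nonneg_left (abs_besselCoeff_le hμ k) (by positivity)

lemma hasSum_besselRadial {μ : ℝ} (hμ : 0 ≤ μ) (s : ℝ) :
    HasSum (fun k : ℕ => besselCoeff μ k * s ^ k) (besselRadial μ s) :=
  (Summable.of_norm_bounded (hasSum_pow_div_factorial |s|).summable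
    (abs_besselCoeff_mul_pow_le hμ s)).hasSum

lemma abs_besselRadial_le {μ : ℝ} (hμ : 0 ≤ μ) (s : ℝ) : |besselRadial μ s| ≤ exp |s| := by
  rw [← Real.norm_eq_abs]
  exact tsum_of_norm_bounded (hasSum_pow_div_factorial |s|) (abs_besselCoeff_mul_pow_le hμ s)

lemma besselCoeff_succ_mul {μ : ℝ} (hμ : 0 ≤ μ) (k : ℕ) :
    besselCoeff μ (k + 1) * (k + 1) = -(1 / (4 * (μ + 1))) * besselCoeff (μ + 1) k := by
  have h1 : ∏ i ∈ Finset.range (k + 1), (μ + 1 + i) =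
      (∏ i ∈ Finset.range k, (μ + 1 + 1 + i)) * (μ + 1) := by
    rw [Finset.prod_range_succ']
    congr 1
    · refine Finset.prod_congr rfl fun i _ => ?_
      push_cast
      ring
    · simp
  have h2 : 0 < ∏ i ∈ Finset.range k, (μ + 1 + 1 + i) :=
    Finset.prod_pos fun i _ => by positivity
  rw [besselCoeff, besselCoeff, h1, Nat.factorial_succ]
  push_cast
  field_simp
  ring

lemma besselCoeff_succ_mul' {μ : ℝ} (hμ : 0 ≤ μ) (k : ℕ) :
    besselCoeff μ (k + 1) * (4 * (k + 1) * (μ + 1 + k)) = -besselCoeff μ k := by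
  have h2 : 0 < ∏ i ∈ Finset.range k, (μ + 1 + i) :=
    Finset.prod_pos fun i _ => by positivity
  have h3 : 0 < μ + 1 + k := by positivity
  rw [besselCoeff, besselCoeff, Finset.prod_range_succ, Nat.factorial_succ]
  push_cast
  field_simp
  ring

lemma besselCoeff_recurrence {μ : ℝ} (hμ : 0 ≤ μ) (k : ℕ) :
    1 / (4 * (μ + 1) * (μ + 2)) * besselCoeff (μ + 2) k - besselCoeff (μ + 1) (k + 1) +
      besselCoeff μ (k + 1) = 0 := by
  have h1 := besselCoeff_succ_mul hμ k
  have h2 := besselCoeff_succ_mul' (by linarith : 0 ≤ μ + 1) k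
  have h3 := besselCoeff_succ_mul (by linarith : 0 ≤ μ + 1) k
  rw [show μ + 1 + 1 = μ + 2 by ring] at h2 h3
  have hk : (k : ℝ) + 1 ≠ 0 := by positivity
  have hμ1 : μ + 1 ≠ 0 := by positivity
  have hμ2 : μ + 2 ≠ 0 := by positivity
  have h4 : besselCoeff (μ + 2) k = -(4 * (μ + 2)) * (besselCoeff (μ + 1) (k + 1) * (k + 1)) := by
    rw [h3]
    field_simp
  have h5 : besselCoeff μ (k + 1) = (μ + 2 + k) / (μ + 1) * besselCoeff (μ + 1) (k + 1) := by
    apply mul_right_cancel₀ hk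
    rw [h1, ← neg_eq_iff_eq_neg.2 h2]
    field_simp
  rw [h4, h5]
  field_simp
  ring

lemma besselRadial_recurrence {μ : ℝ} (hμ : 0 ≤ μ) (s : ℝ) :
    s / (4 * (μ + 1) * (μ + 2)) * besselRadial (μ + 2) s - besselRadial (μ + 1) s +
      besselRadial μ s = 0 := by
  have h0 := (hasSum_besselRadial (by linarith : 0 ≤ μ + 2) s).mul_left
    (s / (4 * (μ + 1) * (μ + 2)))
  have h1 := (hasSum_nat_add_iff' 1).2 (hasSum_besselRadial (by linarith : 0 ≤ μ + 1) s)
  have h2 := (hasSum_nat_add_iff' 1).2 (hasSum_besselRadial hμ s)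
  have h3 := (h0.sub h1).add h2
  have h4 : (fun k : ℕ => s / (4 * (μ + 1) * (μ + 2)) * (besselCoeff (μ + 2) k * s ^ k) -
      besselCoeff (μ + 1) (k + 1) * s ^ (k + 1) + besselCoeff μ (k + 1) * s ^ (k + 1)) =
        fun _ => 0 := by
    ext k
    linear_combination s ^ (k + 1) * besselCoeff_recurrence hμ k
  rw [h4] at h3
  have h5 := h3.unique hasSum_zero
  simp [besselCoeff] at h5
  linarith

lemma hasDerivAt_besselRadial {μ : ℝ} (hμ : 0 ≤ μ) (s : ℝ) :
    HasDerivAt (besselRadial μ) (-(1 / (4 * (μ + 1))) * besselRadial (μ + 1) s) s := by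
  set R := |s| + 1 with hR
  have hu : Summable fun k : ℕ => (k : ℝ) * R ^ (k - 1) / k.factorial := by
    refine (summable_nat_add_iff 1).1 ?_
    refine (hasSum_pow_div_factorial R).summable.congr fun k => ?_
    rw [Nat.add_sub_cancel, Nat.factorial_succ]
    push_cast
    field_simp
  have hs : s ∈ Metric.ball (0 : ℝ) R := by simp [hR]
  have h := hasDerivAt_tsum_of_isPreconnected hu Metric.isOpen_ball
    (convex_ball (0 : ℝ) R).isPreconnected
    (g := fun k y => besselCoeff μ k * y ^ k)
    (g' := fun k y => besselCoeff μ k * (k * y ^ (k - 1)))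
    (fun k y _ => (hasDerivAt_pow k y).const_mul _)
    (fun k y hy => by
      rw [Real.norm_eq_abs, abs_mul, abs_mul, abs_pow, Nat.abs_cast, div_eq_mul_one_div,
        mul_comm |besselCoeff μ k|]
      rw [mem_ball_zero_iff, Real.norm_eq_abs] at hy
      have := abs_besselCoeff_le hμ k
      gcongr)
    hs (hasSum_besselRadial hμ s).summable hs
  refine h.congr_deriv (HasSum.tsum_eq ?_)
  refine (hasSum_nat_add_iff' 1).1 ?_
  have h1 := (hasSum_besselRadial (by linarith : 0 ≤ μ + 1) s).mul_left (-(1 / (4 * (μ + 1))))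
  have h2 : (fun k : ℕ => -(1 / (4 * (μ + 1))) * (besselCoeff (μ + 1) k * s ^ k)) =
      fun k => besselCoeff μ (k + 1) * ((k + 1 : ℕ) * s ^ (k + 1 - 1)) := by
    ext k
    rw [Nat.add_sub_cancel]
    push_cast
    linear_combination -s ^ k * besselCoeff_succ_mul hμ k
  rw [h2] at h1
  simpa using h1

lemma contDiff_besselRadial {μ : ℝ} (hμ : 0 ≤ μ) : ContDiff ℝ (⊤ : ℕ∞) (besselRadial μ) := by
  refine contDiff_infty.2 fun m => ?_
  induction m generalizing μ with
  | zero =>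
    exact contDiff_zero.2 (continuous_iff_continuousAt.2 fun s =>
      (hasDerivAt_besselRadial hμ s).continuousAt)
  | succ m ih =>
    push_cast
    refine contDiff_succ_iff_deriv.2
      ⟨fun s => (hasDerivAt_besselRadial hμ s).differentiableAt, by simp, ?_⟩
    rw [funext fun s => (hasDerivAt_besselRadial hμ s).deriv]
    exact contDiff_const.mul (ih (by linarith))

lemma besselJ_eq_besselRadial {μ r : ℝ} (hμ : 0 ≤ μ) (hr : 0 < r) :
    besselJ μ r = (2 ^ μ * Real.Gamma (μ + 1))⁻¹ * (r ^ μ * besselRadial μ (r ^ 2)) := by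
  have hΓ : ∀ k : ℕ, Real.Gamma (k + μ + 1) =
      Real.Gamma (μ + 1) * ∏ i ∈ Finset.range k, (μ + 1 + i) := by
    intro k
    induction k with
    | zero => simp
    | succ k ih =>
      rw [Finset.prod_range_succ, ← mul_assoc, ← ih, mul_comm,
        show ((k + 1 : ℕ) : ℝ) + μ + 1 = k + μ + 1 + 1 by push_cast; ring,
        Real.Gamma_add_one (by positivity)]
      ring
  rw [besselJ, besselRadial, ← tsum_mul_left, ← tsum_mul_left]
  refine tsum_congr fun k => ?_
  have hG : 0 < Real.Gamma (μ + 1) := Real.Gamma_pos_of_pos (by linarith)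
  have hP : 0 < ∏ i ∈ Finset.range k, (μ + 1 + i) := Finset.prod_pos fun i _ => by positivity
  have h2 : (0 : ℝ) < 2 ^ μ := by positivity
  rw [hΓ, besselCoeff, Real.rpow_add (by positivity), Real.div_rpow hr.le (by norm_num) μ,
    show (2 * (k : ℝ)) = ((2 * k : ℕ) : ℝ) by push_cast; rfl, Real.rpow_natCast, pow_mul, div_pow,
    div_pow, show (2 : ℝ) ^ 2 = 4 by norm_num]
  field_simp

lemma contDiff_eval {n : ℕ} (p : MvPolynomial (Fin n) ℝ) :
    ContDiff ℝ (⊤ : ℕ∞)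
      (fun x : EuclideanSpace ℝ (Fin n) => MvPolynomial.eval (fun i => x i) p) := by
  induction p using MvPolynomial.induction_on with
  | C a => simpa using contDiff_const
  | add p q hp hq => simpa using hp.add hq
  | mul_X p i hp =>
    simp only [map_mul, MvPolynomial.eval_X]
    exact hp.mul (EuclideanSpace.proj (𝕜 := ℝ) i : EuclideanSpace ℝ (Fin n) →L[ℝ] ℝ).contDiff

lemma fderiv_eval_single {n : ℕ} (p : MvPolynomial (Fin n) ℝ) (x : EuclideanSpace ℝ (Fin n))
    (i : Fin n) :
    fderiv ℝ (fun x : EuclideanSpace ℝ (Fin n) => MvPolynomial.eval (fun i => x i) p) x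
      (EuclideanSpace.single i 1) =
        MvPolynomial.eval (fun i => x i) (MvPolynomial.pderiv i p) := by
  have hd : ∀ p : MvPolynomial (Fin n) ℝ, DifferentiableAt ℝ
      (fun x : EuclideanSpace ℝ (Fin n) => MvPolynomial.eval (fun i => x i) p) x :=
    fun p => (contDiff_eval p).differentiable (by simp) x
  induction p using MvPolynomial.induction_on with
  | C a => simp
  | add p q hp hq =>
    simp only [map_add]
    rw [fderiv_fun_add (hd p) (hd q), add_apply, hp, hq]
  | mul_X p j hp =>
    have hj : HasFDerivAt (fun x : EuclideanSpace ℝ (Fin n) => x j)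
      (EuclideanSpace.proj j : EuclideanSpace ℝ (Fin n) →L[ℝ] ℝ) x :=
      (EuclideanSpace.proj j : EuclideanSpace ℝ (Fin n) →L[ℝ] ℝ).hasFDerivAt
    simp only [map_mul, MvPolynomial.eval_X]
    rw [fderiv_fun_mul (hd p) hj.differentiableAt, hj.fderiv]
    simp only [add_apply, smul_apply, hp, smul_eq_mul,
      PiLp.proj_apply, Derivation.leibniz, MvPolynomial.pderiv_X, map_add, map_mul,
      MvPolynomial.eval_X, PiLp.single_apply]
    by_cases hij : j = i
    · subst hij
      simp
    · simp [hij]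

lemma fderiv_eval_mul_comp_normSq {n : ℕ} (p : MvPolynomial (Fin n) ℝ) {θ : ℝ → ℝ} {θ' : ℝ}
    {x : EuclideanSpace ℝ (Fin n)} (hθ : HasDerivAt θ θ' (‖x‖ ^ 2)) (i : Fin n) :
    fderiv ℝ (fun y : EuclideanSpace ℝ (Fin n) =>
      MvPolynomial.eval (fun i => y i) p * θ (‖y‖ ^ 2)) x (EuclideanSpace.single i 1) =
        MvPolynomial.eval (fun i => x i) (MvPolynomial.pderiv i p) * θ (‖x‖ ^ 2) +
          MvPolynomial.eval (fun i => x i) (MvPolynomial.X i * p) * (2 * θ') := by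
  have h1 : HasFDerivAt (fun y : EuclideanSpace ℝ (Fin n) => θ (‖y‖ ^ 2))
      (θ' • (2 • innerSL ℝ x)) x :=
    hθ.comp_hasFDerivAt x (hasStrictFDerivAt_norm_sq x).hasFDerivAt
  rw [fderiv_fun_mul ((contDiff_eval p).differentiable (by simp) x) h1.differentiableAt, h1.fderiv]
  simp only [add_apply, smul_apply, fderiv_eval_single, smul_eq_mul,
    innerSL_apply_apply, EuclideanSpace.inner_single_right, map_mul, MvPolynomial.eval_X]
  simp
  ring

lemma contDiff_eval_mul_comp_normSq {n : ℕ} (p : MvPolynomial (Fin n) ℝ) {θ : ℝ → ℝ}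
    (hθ : ContDiff ℝ (⊤ : ℕ∞) θ) :
    ContDiff ℝ (⊤ : ℕ∞) (fun y : EuclideanSpace ℝ (Fin n) =>
      MvPolynomial.eval (fun i => y i) p * θ (‖y‖ ^ 2)) :=
  (contDiff_eval p).mul (hθ.comp (contDiff_norm_sq ℝ))

lemma eval_mul_besselRadial_mem {n ℓ : ℕ} {μ : ℝ} (hμ : 0 ≤ μ) (hμn : μ = ℓ + ((n : ℝ) - 2) / 2)
    {p : MvPolynomial (Fin n) ℝ} (hp : p.IsHomogeneous ℓ) (hp' : polyLaplacian p = 0) :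
    (fun x : EuclideanSpace ℝ (Fin n) =>
      MvPolynomial.eval (fun i => x i) p * besselRadial μ (‖x‖ ^ 2)) ∈ helmholtzSol n := by
  have hμ1 : 0 ≤ μ + 1 := by linarith
  refine ⟨contDiff_eval_mul_comp_normSq p (contDiff_besselRadial hμ), fun x => ?_⟩
  rw [laplacian]
  have h1 : ∀ i : Fin n, (fun y => fderiv ℝ (fun x : EuclideanSpace ℝ (Fin n) =>
      MvPolynomial.eval (fun i => x i) p * besselRadial μ (‖x‖ ^ 2)) y
        (EuclideanSpace.single i 1)) = fun y =>
      MvPolynomial.eval (fun i => y i) (MvPolynomial.pderiv i p) * besselRadial μ (‖y‖ ^ 2) +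
        MvPolynomial.eval (fun i => y i) (MvPolynomial.X i * p) *
          (2 * (-(1 / (4 * (μ + 1))) * besselRadial (μ + 1) (‖y‖ ^ 2))) := fun i =>
    funext fun y => fderiv_eval_mul_comp_normSq p (hasDerivAt_besselRadial hμ _) i
  have h2 : ∀ i : Fin n, fderiv ℝ (fun y : EuclideanSpace ℝ (Fin n) =>
      MvPolynomial.eval (fun i => y i) (MvPolynomial.pderiv i p) * besselRadial μ (‖y‖ ^ 2) +
        MvPolynomial.eval (fun i => y i) (MvPolynomial.X i * p) *
          (2 * (-(1 / (4 * (μ + 1))) * besselRadial (μ + 1) (‖y‖ ^ 2)))) x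
        (EuclideanSpace.single i 1) =
      besselRadial μ (‖x‖ ^ 2) *
        MvPolynomial.eval (fun i => x i) (MvPolynomial.pderiv i (MvPolynomial.pderiv i p)) +
      -(1 / (μ + 1)) * besselRadial (μ + 1) (‖x‖ ^ 2) *
        MvPolynomial.eval (fun i => x i) (MvPolynomial.X i * MvPolynomial.pderiv i p) +
      -(1 / (2 * (μ + 1))) * besselRadial (μ + 1) (‖x‖ ^ 2) *
        MvPolynomial.eval (fun i => x i) p +
      1 / (4 * (μ + 1) * (μ + 2)) * besselRadial (μ + 2) (‖x‖ ^ 2) *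
        MvPolynomial.eval (fun i => x i) p * (x i) ^ 2 := by
    intro i
    have hθ := ((hasDerivAt_besselRadial hμ1 (‖x‖ ^ 2)).const_mul
      (-(1 / (4 * (μ + 1))))).const_mul 2
    have hsm : ContDiff ℝ (⊤ : ℕ∞) fun s =>
        2 * (-(1 / (4 * (μ + 1))) * besselRadial (μ + 1) s) :=
      contDiff_const.mul (contDiff_const.mul (contDiff_besselRadial hμ1))
    rw [fderiv_fun_add
        ((contDiff_eval_mul_comp_normSq _ (contDiff_besselRadial hμ)).differentiable (by simp) x)
        ((contDiff_eval_mul_comp_normSq _ hsm).differentiable (by simp) x), add_apply,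
      fderiv_eval_mul_comp_normSq _ (hasDerivAt_besselRadial hμ _),
      fderiv_eval_mul_comp_normSq _ hθ]
    simp only [Derivation.leibniz, MvPolynomial.pderiv_X_self, smul_eq_mul, map_add, map_mul,
      MvPolynomial.eval_X, map_one, show μ + 1 + 1 = μ + 2 by ring]
    have : μ + 1 ≠ 0 := by positivity
    have : μ + 2 ≠ 0 := by positivity
    field_simp
    ring
  have h3 : ∑ i, MvPolynomial.eval (fun i => x i)
      (MvPolynomial.pderiv i (MvPolynomial.pderiv i p)) = 0 := by
    rw [← map_sum, ← polyLaplacian, hp', map_zero]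
  have h4 : ∑ i, MvPolynomial.eval (fun i => x i) (MvPolynomial.X i * MvPolynomial.pderiv i p) =
      ℓ * MvPolynomial.eval (fun i => x i) p := by
    rw [← map_sum, hp.sum_X_mul_pderiv, nsmul_eq_mul, map_mul, map_natCast]
  simp only [h1, h2]
  rw [Finset.sum_add_distrib, Finset.sum_add_distrib, Finset.sum_add_distrib, ← Finset.mul_sum,
    ← Finset.mul_sum, h3, h4, Finset.sum_const, Finset.card_univ, Fintype.card_fin, nsmul_eq_mul,
    ← Finset.mul_sum, ← EuclideanSpace.real_norm_sq_eq]
  have hn : (n : ℝ) = 2 * (μ - ℓ + 1) := by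
    rw [hμn]
    ring
  have hrec := besselRadial_recurrence hμ (‖x‖ ^ 2)
  rw [hn]
  have : μ + 1 ≠ 0 := by positivity
  have : μ + 2 ≠ 0 := by positivity
  have h5 : -(1 / (μ + 1)) * besselRadial (μ + 1) (‖x‖ ^ 2) * ℓ +
      2 * (μ - ℓ + 1) * (-(1 / (2 * (μ + 1))) * besselRadial (μ + 1) (‖x‖ ^ 2)) =
        -besselRadial (μ + 1) (‖x‖ ^ 2) := by
    field_simp
    ring
  linear_combination MvPolynomial.eval (fun i => x i) p * (hrec + h5)

lemma hasSum_besselCoeff_mul_projCoeff {α s : ℝ} (hα : 0 ≤ α)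
    (h : Summable fun p : ℕ × ℕ =>
      besselCoeff (α + 2 * p.1) p.2 * projCoeff (α + 2 * p.1) p.1 * (s ^ p.1 * s ^ p.2)) :
    HasSum (fun p : ℕ × ℕ =>
      besselCoeff (α + 2 * p.1) p.2 * projCoeff (α + 2 * p.1) p.1 * (s ^ p.1 * s ^ p.2)) 1 := by
  have h1 := ((Finset.HasAntidiagonal.sigmaAntidiagonalEquivProd (A := ℕ)).hasSum_iff.2
    h.hasSum).sigma fun m => hasSum_fintype _
  have h2 : ∀ m : ℕ, ∑ p : Finset.HasAntidiagonal.antidiagonal m,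
      besselCoeff (α + 2 * p.1.1) p.1.2 * projCoeff (α + 2 * p.1.1) p.1.1 *
        (s ^ p.1.1 * s ^ p.1.2) = if m = 0 then 1 else 0 := by
    intro m
    rw [Finset.sum_coe_sort (Finset.HasAntidiagonal.antidiagonal m) fun p : ℕ × ℕ =>
      besselCoeff (α + 2 * p.1) p.2 * projCoeff (α + 2 * p.1) p.1 * (s ^ p.1 * s ^ p.2)]
    rw [Finset.sum_congr rfl fun p hp => by
      rw [← pow_add, Finset.HasAntidiagonal.mem_antidiagonal.1 hp], ← Finset.sum_mul,
      sum_antidiagonal_besselCoeff_mul_projCoeff hα]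
    split_ifs with hm <;> simp [hm]
  have h3 : HasSum (fun m : ℕ => if m = 0 then (1 : ℝ) else 0) 1 := hasSum_ite_eq 0 1
  rw [← h1.unique (h3.congr_fun h2)]
  exact h.hasSum

lemma hasSum_projection_mul_besselRadial {φ : ℕ → ℝ} {A q ν s a : ℝ} (hq0 : 0 ≤ q) (hq : q < 1)
    (hφ : ∀ e, |φ e| ≤ A * q ^ e) (hν : 0 ≤ ν) (ha : HasSum φ a) :
    HasSum (fun ℓ : ℕ => (∑ j ∈ Finset.range (ℓ / 2 + 1),
      projCoeff (ℓ + ν) j * (s ^ j * φ (ℓ - 2 * j))) * besselRadial (ℓ + ν) s) a := by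
  have hα : ∀ e : ℕ, 0 ≤ e + ν := fun e => by positivity
  have hαj : ∀ e j : ℕ, 0 ≤ e + ν + 2 * j := fun e j => by positivity
  let T : ℕ × ℕ × ℕ → ℝ := fun p => φ p.1 * (besselCoeff (p.1 + ν + 2 * p.2.1) p.2.2 *
    projCoeff (p.1 + ν + 2 * p.2.1) p.2.1 * (s ^ p.2.1 * s ^ p.2.2))
  have hexp := (hasSum_pow_div_factorial |s|).summable
  have hexp2 : Summable fun p : ℕ × ℕ => |s| ^ p.1 / p.1.factorial * (|s| ^ p.2 / p.2.factorial) :=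
    hexp.mul_of_nonneg hexp (fun _ => by positivity) fun _ => by positivity
  have hbd : ∀ (e : ℕ) (p : ℕ × ℕ), |besselCoeff (e + ν + 2 * p.1) p.2 *
      projCoeff (e + ν + 2 * p.1) p.1 * (s ^ p.1 * s ^ p.2)| ≤
        |s| ^ p.1 / p.1.factorial * (|s| ^ p.2 / p.2.factorial) := by
    intro e p
    have h1 := abs_besselCoeff_le (hαj e p.1) p.2
    have h2 := abs_projCoeff_le (hα e) p.1
    rw [abs_mul, abs_mul, abs_mul, abs_pow, abs_pow]
    calc _ ≤ 1 / (p.2.factorial : ℝ) * (1 / p.1.factorial) * (|s| ^ p.1 * |s| ^ p.2) := by gcongr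
      _ = _ := by ring
  have hT : Summable T := by
    have hA : 0 ≤ A := by simpa using (abs_nonneg _).trans (hφ 0)
    refine Summable.of_norm_bounded
      (((summable_geometric_of_lt_one hq0 hq).mul_left A).mul_of_nonneg hexp2
        (fun _ => by positivity) fun _ => by positivity) fun p => ?_
    rw [Real.norm_eq_abs, abs_mul]
    exact mul_le_mul (hφ p.1) (hbd p.1 p.2) (abs_nonneg _) (by positivity)
  have hTa : HasSum T a := by
    have h1 : ∀ e, HasSum (fun p => T (e, p)) (φ e) := fun e => by
      simpa using (hasSum_besselCoeff_mul_projCoeff (hα e)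
        (Summable.of_norm_bounded hexp2 (hbd e))).mul_left (φ e)
    rw [← (hT.hasSum.prod_fiberwise h1).unique ha]
    exact hT.hasSum
  let c : ℕ × ℕ → ℝ := fun p => φ p.1 * projCoeff (p.1 + ν + 2 * p.2) p.2 * s ^ p.2 *
    besselRadial (p.1 + ν + 2 * p.2) s
  have hc : HasSum c a := by
    refine ((Equiv.prodAssoc ℕ ℕ ℕ).hasSum_iff.2 hTa).prod_fiberwise fun p => ?_
    refine ((hasSum_besselRadial (hαj p.1 p.2) s).mul_left
      (φ p.1 * projCoeff (p.1 + ν + 2 * p.2) p.2 * s ^ p.2)).congr_fun fun k => ?_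
    simp only [T, Function.comp_apply, Equiv.prodAssoc_apply]
    ring
  let d : ℕ × ℕ → ℝ := fun p => if 2 * p.2 ≤ p.1 then c (p.1 - 2 * p.2, p.2) else 0
  have hd : HasSum d a := by
    have hinj : Function.Injective fun p : ℕ × ℕ => (p.1 + 2 * p.2, p.2) := by
      rintro ⟨e, j⟩ ⟨e', j'⟩ h
      simp only [Prod.mk.injEq] at h ⊢
      omega
    refine (hinj.hasSum_iff fun p hp => if_neg fun hle => hp ⟨(p.1 - 2 * p.2, p.2), ?_⟩).1
      (hc.congr_fun fun p => ?_)
    · simp [Nat.sub_add_cancel hle]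
    · simp
  refine hd.prod_fiberwise fun ℓ => ?_
  rw [Finset.sum_mul]
  convert hasSum_sum_of_ne_finset_zero (s := Finset.range (ℓ / 2 + 1)) (f := fun j => d (ℓ, j))
    fun j hj => if_neg fun hle => hj (Finset.mem_range.2 ?_) using 1
  · refine Finset.sum_congr rfl fun j hj => ?_
    have hle : 2 * j ≤ ℓ := by
      have := Finset.mem_range.1 hj
      omega
    have hcast : ((ℓ - 2 * j : ℕ) : ℝ) + ν + 2 * j = ℓ + ν := by
      rw [Nat.cast_sub hle]
      push_cast
      ring
    simp only [d, c]
    rw [if_pos hle, hcast]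
    ring
  · simp only at hle
    omega
  · infer_instance

lemma eval_harmonicPart {n : ℕ} (ν : ℝ) (f : helmholtzSol n) (ℓ : ℕ)
    (x : EuclideanSpace ℝ (Fin n)) :
    MvPolynomial.eval (fun i => x i) (harmonicPart ν f ℓ) = ∑ j ∈ Finset.range (ℓ / 2 + 1),
      projCoeff (ℓ + ν) j * ((‖x‖ ^ 2) ^ j *
        (((helmholtzSol.dir x ^ (ℓ - 2 * j)) f).1 0 / (ℓ - 2 * j).factorial)) := by
  simp only [harmonicPart, map_sum, map_mul, map_pow, MvPolynomial.eval_C, eval_normSqPoly,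
    helmholtzSol.eval_taylorPoly]

/-- Expansion of a solution of `Δf + f = 0` into separated solutions. -/
lemma hasSum_harmonicPart_mul_besselRadial {n : ℕ} (hn : 1 ≤ n) {ν : ℝ} (hν : 0 ≤ ν)
    (f : helmholtzSol n) (x : EuclideanSpace ℝ (Fin n)) :
    HasSum (fun ℓ : ℕ => MvPolynomial.eval (fun i => x i) (harmonicPart ν f ℓ) *
      besselRadial (ℓ + ν) (‖x‖ ^ 2)) (f.1 x) := by
  obtain ⟨A, -, hA⟩ := helmholtzSol.exists_abs_dir_pow_div_factorial_le hn f
    (show 0 < ‖x‖ + 1 by positivity) (one_half_pos (α := ℝ))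
  simp only [eval_harmonicPart]
  exact hasSum_projection_mul_besselRadial
    (φ := fun e => ((helmholtzSol.dir x ^ e) f).1 0 / e.factorial) (by norm_num) one_half_lt_one
    (fun e => by
      rw [abs_div, Nat.abs_cast]
      exact hA e x 0 (by linarith) (by simp; positivity)) hν (helmholtzSol.hasSum_dir_pow hn f x)

lemma exists_abs_harmonicPart_mul_besselRadial_le {n : ℕ} (hn : 1 ≤ n) {ν : ℝ} (hν : 0 ≤ ν)
    (f : helmholtzSol n) {ρ : ℝ} (hρ : 0 < ρ) :
    ∃ B : ℝ, ∀ (ℓ : ℕ) (x : EuclideanSpace ℝ (Fin n)), ‖x‖ ≤ ρ →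
      |MvPolynomial.eval (fun i => x i) (harmonicPart ν f ℓ) * besselRadial (ℓ + ν) (‖x‖ ^ 2)| ≤
        B * (1 / 2) ^ ℓ := by
  obtain ⟨A, hA0, hA⟩ := helmholtzSol.exists_abs_dir_pow_div_factorial_le hn f hρ
    (one_half_pos (α := ℝ))
  refine ⟨A * exp (4 * ρ ^ 2) * exp (ρ ^ 2), fun ℓ x hx => ?_⟩
  have hx2 : ‖x‖ ^ 2 ≤ ρ ^ 2 := by gcongr
  have h1 : |besselRadial (ℓ + ν) (‖x‖ ^ 2)| ≤ exp (ρ ^ 2) := by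
    refine (abs_besselRadial_le (by positivity) _).trans (exp_le_exp.2 ?_)
    rwa [abs_of_nonneg (by positivity)]
  have h2 : |MvPolynomial.eval (fun i => x i) (harmonicPart ν f ℓ)| ≤
      A * exp (4 * ρ ^ 2) * (1 / 2) ^ ℓ := by
    rw [eval_harmonicPart]
    calc _ ≤ ∑ j ∈ Finset.range (ℓ / 2 + 1), A * (1 / 2) ^ ℓ * ((4 * ρ ^ 2) ^ j / j.factorial) := by
          refine (Finset.abs_sum_le_sum_abs _ _).trans (Finset.sum_le_sum fun j hj => ?_)
          obtain ⟨e, rfl⟩ : ∃ e, ℓ = 2 * j + e := ⟨ℓ - 2 * j, by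
            have := Finset.mem_range.1 hj
            omega⟩
          rw [Nat.add_sub_cancel_left, abs_mul, abs_mul,
            abs_of_nonneg (show 0 ≤ (‖x‖ ^ 2) ^ j by positivity), abs_div, Nat.abs_cast]
          have h3 := abs_projCoeff_le (α := e + ν) (by positivity) j
          rw [show (e : ℝ) + ν + 2 * j = ((2 * j + e : ℕ) : ℝ) + ν by push_cast; ring] at h3
          have h4 := hA e x 0 hx (by simpa using hρ.le)
          calc _ ≤ 1 / (j.factorial : ℝ) * ((ρ ^ 2) ^ j * (A * (1 / 2) ^ e)) := by gcongr
            _ = _ := by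
              rw [pow_add, pow_mul, mul_pow]
              have : ((1 / 2 : ℝ) ^ 2) ^ j * 4 ^ j = 1 := by
                rw [← mul_pow]
                norm_num
              linear_combination -(A * (1 / 2) ^ e * (ρ ^ 2) ^ j / j.factorial) * this
      _ ≤ A * (1 / 2) ^ ℓ * exp (4 * ρ ^ 2) := by
          rw [← Finset.mul_sum]
          gcongr
          exact sum_le_hasSum _ (fun _ _ => by positivity) (hasSum_pow_div_factorial _)
      _ = _ := by ring
  rw [abs_mul]
  calc _ ≤ A * exp (4 * ρ ^ 2) * (1 / 2) ^ ℓ * exp (ρ ^ 2) := by gcongr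
    _ = _ := by ring

theorem stmt8 (n : ℕ) (hn : 2 ≤ n)
    (ν : ℝ) (hν : ν = ((n : ℝ) - 2) / 2)
    (f : EuclideanSpace ℝ (Fin n) → ℝ) (hf : ContDiff ℝ (⊤ : ℕ∞) f)
    (hfeq : ∀ x : EuclideanSpace ℝ (Fin n), laplacian f x + f x = 0)
    (K : Set (EuclideanSpace ℝ (Fin n))) (hK : IsCompact K)
    (t : ℕ) (ε : ℝ) (hε : 0 < ε) :
    ∃ (N : ℕ) (ℓ : Fin N → ℕ) (P : Fin N → MvPolynomial (Fin n) ℝ) (c : Fin N → ℝ)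
      (g : Fin N → EuclideanSpace ℝ (Fin n) → ℝ),
      (∀ j, (P j).IsHomogeneous (ℓ j)) ∧
      (∀ j, polyLaplacian (P j) = 0) ∧
      (∀ j, ContDiff ℝ (⊤ : ℕ∞) (g j)) ∧
      (∀ j, ∀ x : EuclideanSpace ℝ (Fin n), x ≠ 0 →
        g j x = MvPolynomial.eval (fun i => x i) (P j) *
          besselJ ((ℓ j : ℝ) + ν) ‖x‖ / ‖x‖ ^ ((ℓ j : ℝ) + ν)) ∧
      (∀ m : ℕ, m ≤ t → ∀ x ∈ K,
        ‖iteratedFDeriv ℝ m (fun y => f y - ∑ j, c j * g j y) x‖ < ε) := by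
  have hn1 : 1 ≤ n := by omega
  have hn2 : (2 : ℝ) ≤ n := by exact_mod_cast hn
  have hν0 : 0 ≤ ν := by
    rw [hν]
    linarith
  let F : helmholtzSol n := ⟨f, hf, hfeq⟩
  obtain ⟨C, hC, hdir⟩ := helmholtzSol.exists_dir_bound n hn1
  obtain ⟨R, hR, hKR⟩ := hK.isBounded.exists_pos_norm_le
  obtain ⟨δ, hδ, hδε⟩ : ∃ δ > 0, ∀ m ≤ t, (C * 2) ^ m * δ < ε := by
    have hpos : 0 < (C * 2 + 1) ^ t := by positivity
    refine ⟨ε / (2 * (C * 2 + 1) ^ t), by positivity, fun m hm => ?_⟩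
    have h1 : (C * 2) ^ m ≤ (C * 2 + 1) ^ t :=
      (pow_le_pow_left₀ (by positivity) (by linarith) m).trans
        (pow_le_pow_right₀ (by linarith) hm)
    calc _ ≤ (C * 2 + 1) ^ t * (ε / (2 * (C * 2 + 1) ^ t)) := by gcongr
      _ = ε / 2 := by field_simp
      _ < ε := by linarith
  let P : ℕ → MvPolynomial (Fin n) ℝ := harmonicPart ν F
  have hP : ∀ ℓ, polyLaplacian (P ℓ) = 0 := fun ℓ => by
    simp only [P, hν]
    exact polyLaplacian_harmonicPart hn1 F ℓ
  let G : ℕ → helmholtzSol n := fun ℓ => ⟨_, eval_mul_besselRadial_mem (μ := ℓ + ν) (by positivity)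
    (by rw [hν]) (isHomogeneous_harmonicPart ν F ℓ) (hP ℓ)⟩
  obtain ⟨B, hB⟩ := exists_abs_harmonicPart_mul_besselRadial_le hn1 hν0 F
    (show 0 < R + t by positivity)
  have hunif := tendstoUniformlyOn_tsum_nat
    ((summable_geometric_of_lt_one (by norm_num) one_half_lt_one).mul_left B)
    (f := fun ℓ => (G ℓ).1) (s := {x | ‖x‖ ≤ R + t}) fun ℓ x hx => hB ℓ x hx
  obtain ⟨N, hN⟩ := (Metric.tendstoUniformlyOn_iff.1 hunif δ hδ).exists
  let c : ℕ → ℝ := fun ℓ => 2 ^ (ℓ + ν) * Real.Gamma (ℓ + ν + 1)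
  have hc : ∀ ℓ, c ℓ ≠ 0 := fun ℓ =>
    (mul_pos (by positivity) (Real.Gamma_pos_of_pos (by positivity))).ne'
  refine ⟨N, fun j => j, fun j => P j, fun j => c j, fun j x => (c j)⁻¹ * (G j).1 x,
    fun j => isHomogeneous_harmonicPart ν F j, fun j => hP j,
    fun j => contDiff_const.mul (helmholtzSol.contDiff_coe (G j)), fun j x hx => ?_,
    fun m hm x hx => ?_⟩
  · have hx0 : 0 < ‖x‖ := norm_pos_iff.2 hx
    have hpow : 0 < ‖x‖ ^ ((j : ℝ) + ν) := by positivity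
    rw [besselJ_eq_besselRadial (by positivity) hx0]
    simp only [G, P, c]
    field_simp
  · let u : helmholtzSol n := F - ∑ ℓ ∈ Finset.range N, G ℓ
    have hu : ∀ y, u.1 y = f y - ∑ ℓ ∈ Finset.range N, (G ℓ).1 y := fun y => by
      rw [← helmholtzSol.sum_coe_apply]
      rfl
    have hfu : (fun y => f y - ∑ j : Fin N, c j * ((c j)⁻¹ * (G j).1 y)) = u.1 := by
      ext y
      rw [hu, Finset.sum_range]
      simp only [mul_inv_cancel_left₀ (hc _)]
    rw [hfu]
    refine (helmholtzSol.norm_iteratedFDeriv_le hC hdir x m u δ fun y hy => ?_).trans_lt (hδε m hm)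
    have hy' : ‖y‖ ≤ R + t := by
      have h1 : ‖y‖ ≤ ‖x‖ + ‖y - x‖ := by simpa using norm_add_le x (y - x)
      have h2 : ‖y - x‖ ≤ m := by rwa [← dist_eq_norm]
      have h3 : (m : ℝ) ≤ t := by exact_mod_cast hm
      linarith [hKR x hx]
    have h := hN y hy'
    rw [(hasSum_harmonicPart_mul_besselRadial hn1 hν0 F y).tsum_eq, Real.dist_eq] at h
    rw [hu]
    exact h.le
end
end
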